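/- arXiv:math/0510071 — 3 statements merged into one kernel-verified Lean document; each statement's English description precedes it below -/
import Mathlib

section
/- Let μ be a C^∞ function, defined on an open neighborhood of the closed unit disc in ℂ, with sup |μ| < 1. Then there exists a C^∞ diffeomorphism Φ of the open unit disc D = {z : |z| < 1} onto itself such that ∂Φ/∂z̄ = μ·∂Φ/∂z and ∂Φ/∂z ≠ 0 everywhere on D. -/
open MeasureTheory

/-- The Wirtinger derivative `∂f/∂z = (1/2)(∂f/∂x − i ∂f/∂y)` of `f` at `z`,
where `∂f/∂x`, `∂f/∂y` are the directional derivatives in directions `1`, `i`. -/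
noncomputable def wderiv (f : ℂ → ℂ) (z : ℂ) : ℂ :=
  (fderiv ℝ f z 1 - Complex.I * fderiv ℝ f z Complex.I) / 2

/-- The Wirtinger derivative `∂f/∂z̄ = (1/2)(∂f/∂x + i ∂f/∂y)` of `f` at `z`. -/
noncomputable def wderivBar (f : ℂ → ℂ) (z : ℂ) : ℂ :=
  (fderiv ℝ f z 1 + Complex.I * fderiv ℝ f z Complex.I) / 2

open UnitAddTorus Topology

attribute [local instance] instMeasureSpaceUnitAddCircle instIsAddHaarMeasureUnitAddCircleVolume instIsProbabilityMeasureUnitAddCircleVolume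

abbrev T2 := UnitAddTorus (Fin 2)
noncomputable abbrev H2 := Lp ℂ 2 (volume : Measure T2)

def pr (z : ℂ) : T2 := ![(z.re : UnitAddCircle), (z.im : UnitAddCircle)]

lemma pr_add (z w : ℂ) : pr (z + w) = pr z + pr w := by
  funext i; fin_cases i <;> simp [pr]

lemma pr_neg (z : ℂ) : pr (-z) = -pr z := by
  funext i; fin_cases i <;> simp [pr]

lemma pr_zero : pr 0 = 0 := by
  funext i; fin_cases i <;> simp [pr]

lemma pr_cont : Continuous pr := by
  refine continuous_pi fun i => ?_
  fin_cases i
  · exact (AddCircle.continuous_mk' 1).comp Complex.continuous_re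
  · exact (AddCircle.continuous_mk' 1).comp Complex.continuous_im

lemma pr_quot : IsOpenQuotientMap pr := by
  have h1 : IsOpenQuotientMap (Pi.map (fun (_ : Fin 2) (x : ℝ) => (x : UnitAddCircle))) :=
    IsOpenQuotientMap.piMap (fun _ => QuotientAddGroup.isOpenQuotientMap_mk)
  have h2 : IsOpenQuotientMap (fun z : ℂ => (![z.re, z.im] : Fin 2 → ℝ)) := by
    let e : ℂ ≃ₜ (Fin 2 → ℝ) := Complex.equivRealProdCLM.toHomeomorph.trans
      (Homeomorph.finTwoArrow (X := ℝ)).symm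
    exact e.isOpenQuotientMap
  have := h1.comp h2
  convert this using 1
  funext z i
  fin_cases i <;> simp [pr]

lemma pr_surj : Function.Surjective pr := pr_quot.surjective

noncomputable def EE (n : Fin 2 → ℤ) (z : ℂ) : ℂ :=
  Complex.exp (2 * Real.pi * Complex.I * (n 0 * z.re + n 1 * z.im))

lemma mFourier_pr (n : Fin 2 → ℤ) (z : ℂ) : mFourier n (pr z) = EE n z := by
  simp only [mFourier, pr, EE, ContinuousMap.coe_mk, Fin.prod_univ_two]
  simp only [Matrix.cons_val_zero, Matrix.cons_val_one, fourier_coe_apply]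
  rw [← Complex.exp_add]
  congr 1; push_cast; ring

lemma mFourier_add_arg (n : Fin 2 → ℤ) (x y : T2) : mFourier n (x + y) = mFourier n x * mFourier n y := by
  simp [mFourier, Fin.prod_univ_two, fourier_apply, smul_add, AddCircle.toCircle_add]
  ring

lemma EE_add (n : Fin 2 → ℤ) (z w : ℂ) : EE n (z + w) = EE n z * EE n w := by
  rw [← mFourier_pr, pr_add, mFourier_add_arg, mFourier_pr, mFourier_pr]

lemma norm_EE (n : Fin 2 → ℤ) (z : ℂ) : ‖EE n z‖ = 1 := by
  have : (2 * Real.pi * Complex.I * (n 0 * z.re + n 1 * z.im) : ℂ) =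
    ((2 * Real.pi * (n 0 * z.re + n 1 * z.im) : ℝ) : ℂ) * Complex.I := by push_cast; ring
  rw [EE, this, Complex.norm_exp_ofReal_mul_I]

def Sm (m : C(T2, ℂ)) : Prop := ContDiff ℝ (⊤ : ℕ∞) (fun z => m (pr z))

lemma exists_lift (F : ℂ → ℂ) (hF : Continuous F) (h : ∀ z w, pr z = pr w → F z = F w) :
    ∃ m : C(T2, ℂ), ∀ z, m (pr z) = F z := by
  let p : C(ℂ, T2) := ⟨pr, pr_cont⟩
  have hp : IsQuotientMap p := pr_quot.isQuotientMap
  let m := hp.lift ⟨F, hF⟩ (fun a b hab => h a b hab)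
  refine ⟨m, fun z => ?_⟩
  have := hp.lift_comp ⟨F, hF⟩ (fun a b hab => h a b hab)
  exact DFunLike.congr_fun this z

lemma exists_dm (m : C(T2, ℂ)) (hm : Sm m) (e : ℂ) :
    ∃ m' : C(T2, ℂ), Sm m' ∧ ∀ z, m' (pr z) = fderiv ℝ (fun z => m (pr z)) z e := by
  have hs : ContDiff ℝ (⊤ : ℕ∞) (fun z => fderiv ℝ (fun z => m (pr z)) z e) := by
    have := (contDiff_infty_iff_fderiv.1 hm).2
    exact this.clm_apply contDiff_const
  obtain ⟨m', hm'⟩ := exists_lift (fun z => fderiv ℝ (fun z => m (pr z)) z e) hs.continuous (by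
    intro z w hzw
    have h1 : (fun u => m (pr u)) = fun u => (fun u => m (pr u)) (u + (w - z)) := by
      funext u
      have : pr (u + (w - z)) = pr u := by
        rw [sub_eq_add_neg, pr_add, pr_add, pr_neg, hzw]; simp
      simp only [this]
    have h2 : fderiv ℝ (fun z => m (pr z)) z = fderiv ℝ (fun z => m (pr z)) w := by
      conv_lhs => rw [h1]
      refine (fderiv_comp_add_right (f := fun u => m (pr u)) (w - z)).trans ?_
      congr 1; ring
    simp only [h2])
  refine ⟨m', ?_, hm'⟩
  unfold Sm
  simpa only [hm'] using hs

noncomputable def tau (m : C(T2, ℂ)) (e : ℂ) (t : ℝ) : C(T2, ℂ) :=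
  m.comp ⟨fun x => x + pr (t • e), by fun_prop⟩

lemma tau_apply (m : C(T2, ℂ)) (e : ℂ) (t : ℝ) (x : T2) : tau m e t x = m (x + pr (t • e)) := rfl

lemma tau_cont (m : C(T2, ℂ)) (e : ℂ) : Continuous (tau m e) := by
  let F : C(ℝ × T2, ℂ) := ⟨fun q => m (q.2 + pr (q.1 • e)), by
    have := pr_cont
    fun_prop⟩
  exact F.curry.continuous

lemma tau_deriv (m m' : C(T2, ℂ)) (hm : Sm m) (e : ℂ)
    (h : ∀ z, m' (pr z) = fderiv ℝ (fun z => m (pr z)) z e) (t : ℝ) :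
    HasDerivAt (tau m e) (tau m' e t) t := by
  have key : ∀ t, tau m e t = tau m e 0 + ∫ s in (0:ℝ)..t, tau m' e s := by
    intro t
    ext x
    obtain ⟨z, rfl⟩ := pr_surj x
    have h1 : (∫ s in (0:ℝ)..t, tau m' e s) (pr z) = ∫ s in (0:ℝ)..t, tau m' e s (pr z) := by
      have := (ContinuousMap.evalCLM ℝ (pr z) : C(T2, ℂ) →L[ℝ] ℂ).intervalIntegral_comp_comm
        ((tau_cont m' e).intervalIntegrable (μ := volume) 0 t)
      exact this.symm
    rw [ContinuousMap.add_apply, h1, intervalIntegral.integral_eq_sub_of_hasDerivAt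
      (f := fun s => tau m e s (pr z))]
    · ring
    · intro s _
      simp only [tau_apply, ← pr_add, h]
      have h3 : HasDerivAt (fun s : ℝ => z + s • e) e s := by
        simpa using ((hasDerivAt_id s).smul_const e).const_add z
      have h4 : HasFDerivAt (fun z => m (pr z)) (fderiv ℝ (fun z => m (pr z)) (z + s • e)) (z + s • e) :=
        ((hm.differentiable (by simp)) _).hasFDerivAt
      exact h4.comp_hasDerivAt s h3
    · apply Continuous.intervalIntegrable
      exact (ContinuousMap.evalCLM ℝ (pr z) : C(T2, ℂ) →L[ℝ] ℂ).continuous.comp (tau_cont m' e)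
  have h5 : tau m e = fun t => tau m e 0 + ∫ s in (0:ℝ)..t, tau m' e s := funext key
  rw [h5]
  apply HasDerivAt.const_add
  exact intervalIntegral.integral_hasDerivAt_right ((tau_cont m' e).intervalIntegrable 0 t)
    (tau_cont m' e).stronglyMeasurable.stronglyMeasurableAtFilter (tau_cont m' e).continuousAt

lemma tau_smooth (e : ℂ) (m : C(T2, ℂ)) (hm : Sm m) : ContDiff ℝ (⊤ : ℕ∞) (tau m e) := by
  rw [contDiff_infty]
  intro p
  induction p generalizing m with
  | zero => exact_mod_cast contDiff_zero.2 (tau_cont m e)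
  | succ p ih =>
    obtain ⟨m', h1, h2⟩ := exists_dm m hm e
    have := tau_deriv m m' hm e h2
    rw [Nat.cast_add, Nat.cast_one, contDiff_succ_iff_deriv]
    refine ⟨fun t => (this t).differentiableAt, by simp, ?_⟩
    rw [show deriv (tau m e) = tau m' e from funext fun t => (this t).deriv]
    exact ih m' h1

lemma coeff_tau (m : C(T2, ℂ)) (e : ℂ) (t : ℝ) (n : Fin 2 → ℤ) :
    mFourierCoeff (tau m e t) n = EE n (t • e) * mFourierCoeff m n := by
  unfold mFourierCoeff
  rw [← integral_const_mul]
  rw [← integral_add_right_eq_self _ (-pr (t • e))]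
  congr 1; funext x
  rw [tau_apply, mFourier_add_arg, mFourier_neg (n := n) (x := -pr (t • e)), ← mFourier_pr]
  have h1 : mFourier n (-pr (t • e)) = (starRingEnd ℂ) (mFourier n (pr (t • e))) := by
    rw [← mFourier_neg]
    simp [mFourier, fourier_apply]
  rw [h1]
  simp [mul_comm, mul_left_comm]

def RD (a : (Fin 2 → ℤ) → ℂ) : Prop := ∀ p : ℕ, Summable fun n : Fin 2 → ℤ => ‖n‖ ^ p * ‖a n‖

lemma norm_fin2 (n : Fin 2 → ℤ) : ‖n‖ = max |(n 0 : ℝ)| |(n 1 : ℝ)| := by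
  rw [Pi.norm_def]
  simp [Fin.univ_succ, Int.norm_eq_abs]

lemma RD.mono {a b : (Fin 2 → ℤ) → ℂ} (ha : RD a) (C : ℝ) (q : ℕ)
    (h : ∀ n, ‖b n‖ ≤ C * ‖n‖ ^ q * ‖a n‖) : RD b := by
  intro p
  refine Summable.of_nonneg_of_le (fun n => by positivity) (fun n => ?_) ((ha (p + q)).mul_left C)
  calc ‖n‖ ^ p * ‖b n‖ ≤ ‖n‖ ^ p * (C * ‖n‖ ^ q * ‖a n‖) := by gcongr; exact h n
    _ = _ := by ring

lemma RD.summable {a : (Fin 2 → ℤ) → ℂ} (ha : RD a) : Summable a := by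
  have := ha 0
  simp only [pow_zero, one_mul] at this
  exact this.of_norm

lemma RD.mul_n {a : (Fin 2 → ℤ) → ℂ} (ha : RD a) (j : Fin 2) (c : ℂ) :
    RD (fun n => c * n j * a n) := by
  refine ha.mono ‖c‖ 1 (fun n => ?_)
  rw [norm_mul, norm_mul, pow_one]
  gcongr
  have := norm_le_pi_norm n j
  rwa [Complex.norm_intCast, ← Int.norm_eq_abs]

lemma summable_off_zero {f g : (Fin 2 → ℤ) → ℝ} (hs : Summable g)
    (h : ∀ n, n ≠ 0 → |f n| ≤ g n) : Summable f := by
  refine Summable.of_norm_bounded_eventually hs ?_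
  rw [Filter.eventually_cofinite]
  refine (Set.finite_singleton (0 : Fin 2 → ℤ)).subset ?_
  intro n hn
  by_contra h0
  exact hn (h n h0)

lemma rd_of_bound (a : (Fin 2 → ℤ) → ℂ)
    (h : ∀ (j : Fin 2) (p : ℕ), ∃ C : ℝ, ∀ n, |(n j : ℝ)| ^ p * ‖a n‖ ≤ C) : RD a := by
  intro p
  obtain ⟨C0, hC0⟩ := h 0 (p + 3)
  obtain ⟨C1, hC1⟩ := h 1 (p + 3)
  have hs := (EisensteinSeries.summable_one_div_norm_rpow (k := 3) (by norm_num)).mul_left (max C0 C1)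
  refine summable_off_zero hs (fun n hn => ?_)
  have hn' : 0 < ‖n‖ := norm_pos_iff.2 hn
  rw [abs_of_nonneg (by positivity), Real.rpow_neg hn'.le, ← div_eq_mul_inv, le_div_iff₀ (by positivity)]
  have h3 : ‖n‖ ^ (3 : ℝ) = ‖n‖ ^ 3 := by exact_mod_cast Real.rpow_natCast ‖n‖ 3
  rw [h3]
  have h4 : ‖n‖ ^ p * ‖a n‖ * ‖n‖ ^ 3 = ‖n‖ ^ (p + 3) * ‖a n‖ := by ring
  rw [h4]
  rcases max_choice |(n 0 : ℝ)| |(n 1 : ℝ)| with h5 | h5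
  · rw [norm_fin2, h5]; exact (hC0 n).trans (le_max_left _ _)
  · rw [norm_fin2, h5]; exact (hC1 n).trans (le_max_right _ _)

lemma orbit_bound {ι : Type*} {E : Type*} [NormedAddCommGroup E] [NormedSpace ℝ E]
    (L : ι → E →L[ℝ] ℂ) (hL : ∀ i, ‖L i‖ ≤ 1) (c : ι → ℝ) (p : ℕ) :
    ∀ (γ : ℝ → E) (_ : ContDiff ℝ (⊤ : ℕ∞) γ) (a : ι → ℂ)
    (_ : ∀ t i, L i (γ t) = Complex.exp (Complex.I * c i * t) * a i),
    ∃ C : ℝ, ∀ i, |c i| ^ p * ‖a i‖ ≤ C := by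
  induction p with
  | zero =>
    intro γ hγ a h
    refine ⟨‖γ 0‖, fun i => ?_⟩
    have := h 0 i
    simp only [Complex.ofReal_zero, mul_zero, Complex.exp_zero, one_mul] at this
    rw [pow_zero, one_mul, ← this]
    exact ((L i).le_of_opNorm_le (hL i) _).trans (by simp)
  | succ p ih =>
    intro γ hγ a h
    obtain ⟨C, hC⟩ := ih (deriv γ) ((contDiff_infty_iff_deriv.1 hγ).2)
      (fun i => Complex.I * c i * a i) (by
      intro t i
      have h1 : HasDerivAt (fun t => L i (γ t)) (L i (deriv γ t)) t :=
        (L i).hasFDerivAt.comp_hasDerivAt t ((contDiff_infty_iff_deriv.1 hγ).1 t).hasDerivAt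
      have h2 : HasDerivAt (fun t : ℝ => Complex.exp (Complex.I * c i * t) * a i)
          (Complex.exp (Complex.I * c i * t) * (Complex.I * c i * a i)) t := by
        have h3 : HasDerivAt (fun t : ℝ => Complex.I * c i * (t : ℂ)) (Complex.I * c i) t := by
          simpa using (Complex.ofRealCLM.hasDerivAt (x := t)).const_mul (Complex.I * c i)
        refine (h3.cexp.mul_const (a i)).congr_deriv ?_
        ring
      have h4 : (fun t => L i (γ t)) = fun t : ℝ => Complex.exp (Complex.I * c i * t) * a i :=
        funext fun t => h t i
      rw [h4] at h1
      exact h1.unique h2)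
    refine ⟨C, fun i => ?_⟩
    refine le_trans (le_of_eq ?_) (hC i)
    simp only [pow_succ, norm_mul, Complex.norm_I, Complex.norm_real, Real.norm_eq_abs]; ring

noncomputable def cf (n : Fin 2 → ℤ) : H2 →L[ℂ] ℂ := innerSL ℂ (mFourierBasis n)

lemma cf_repr (n : Fin 2 → ℤ) (x : H2) : cf n x = mFourierBasis.repr x n := by
  rw [HilbertBasis.repr_apply_apply]; rfl

lemma cf_eq (n : Fin 2 → ℤ) (x : H2) : cf n x = mFourierCoeff x n := by
  rw [cf_repr, mFourierBasis_repr]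

lemma cf_toLp (n : Fin 2 → ℤ) (m : C(T2, ℂ)) :
    cf n (m.toLp 2 volume ℂ) = mFourierCoeff m n := by
  rw [cf_eq, mFourierCoeff_toLp]

lemma cf_ext (x y : H2) (h : ∀ n, cf n x = cf n y) : x = y := by
  apply mFourierBasis.repr.injective
  ext n
  rw [← cf_repr, ← cf_repr, h]

lemma norm_cf (n : Fin 2 → ℤ) : ‖cf n‖ ≤ 1 := by
  unfold cf
  rw [innerSL_apply_norm]
  exact (mFourierBasis.orthonormal.1 n).le

lemma rd_of_orbit (x : H2) (γ : ℂ → ℝ → H2) (hγ : ∀ e, ContDiff ℝ (⊤ : ℕ∞) (γ e))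
    (h : ∀ e t n, cf n (γ e t) = EE n (t • e) * cf n x) : RD (fun n => cf n x) := by
  have key : ∀ (e : ℂ) (c : (Fin 2 → ℤ) → ℝ), (∀ n, c n = 2 * Real.pi * (n 0 * e.re + n 1 * e.im)) →
     ∀ p, ∃ C : ℝ, ∀ n, |c n| ^ p * ‖cf n x‖ ≤ C := by
    intro e c hc p
    refine orbit_bound (fun n => (cf n).restrictScalars ℝ) (fun n => ?_) c p (γ e) (hγ e) _ ?_
    · rw [ContinuousLinearMap.norm_restrictScalars]; exact norm_cf n
    · intro t n
      rw [ContinuousLinearMap.coe_restrictScalars', h, EE]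
      congr 2
      rw [hc]
      simp
      ring
  apply rd_of_bound
  intro j p
  have h2 : ∃ e : ℂ, ∀ n : Fin 2 → ℤ, (n 0 * e.re + n 1 * e.im : ℝ) = n j := by
    fin_cases j
    · exact ⟨1, fun n => by simp⟩
    · exact ⟨Complex.I, fun n => by simp⟩
  obtain ⟨e, he⟩ := h2
  obtain ⟨C, hC⟩ := key e (fun n => 2 * Real.pi * n j) (fun n => by rw [he]) p
  refine ⟨C, fun n => le_trans ?_ (hC n)⟩
  refine mul_le_mul_of_nonneg_right (pow_le_pow_left₀ (abs_nonneg _) ?_ p) (norm_nonneg _)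
  rw [abs_mul]
  refine le_mul_of_one_le_left (abs_nonneg _) ?_
  rw [abs_of_pos (by positivity)]
  have := Real.pi_gt_three
  linarith

lemma rd_coeff (m : C(T2, ℂ)) (hm : Sm m) : RD (mFourierCoeff m) := by
  have := rd_of_orbit (m.toLp 2 volume ℂ) (fun e t => (tau m e t).toLp 2 volume ℂ)
    (fun e => ((ContinuousMap.toLp 2 (volume : Measure T2) ℂ).restrictScalars ℝ).contDiff.comp (tau_smooth e m hm))
    (fun e t n => by rw [cf_toLp, cf_toLp, coeff_tau])
  simpa only [cf_toLp] using this

noncomputable def FF (a : (Fin 2 → ℤ) → ℂ) (z : ℂ) : ℂ := ∑' n, a n * EE n z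

lemma FF_summable {a : (Fin 2 → ℤ) → ℂ} (ha : RD a) (z : ℂ) : Summable (fun n => a n * EE n z) := by
  apply Summable.of_norm
  simpa [norm_EE] using ha.summable.norm

lemma EE_hasFDerivAt (n : Fin 2 → ℤ) (z : ℂ) : HasFDerivAt (EE n)
    ((2 * Real.pi * Complex.I * n 0 * EE n z) • (Complex.ofRealCLM.comp Complex.reCLM)
      + (2 * Real.pi * Complex.I * n 1 * EE n z) • (Complex.ofRealCLM.comp Complex.imCLM)) z := by
  have h0 : HasFDerivAt (fun z : ℂ => (z.re : ℂ)) (Complex.ofRealCLM.comp Complex.reCLM) z :=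
    (Complex.ofRealCLM.comp Complex.reCLM).hasFDerivAt
  have h1 : HasFDerivAt (fun z : ℂ => (z.im : ℂ)) (Complex.ofRealCLM.comp Complex.imCLM) z :=
    (Complex.ofRealCLM.comp Complex.imCLM).hasFDerivAt
  have := (((h0.const_mul (n 0 : ℂ)).add (h1.const_mul (n 1 : ℂ))).const_mul
    (2 * Real.pi * Complex.I)).cexp
  refine this.congr_fderiv ?_
  ext
  simp [EE]
  ring

lemma FF_hasFDerivAt {a : (Fin 2 → ℤ) → ℂ} (ha : RD a) (z : ℂ) : HasFDerivAt (FF a)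
    ((FF (fun n => 2 * Real.pi * Complex.I * n 0 * a n) z) • (Complex.ofRealCLM.comp Complex.reCLM)
      + (FF (fun n => 2 * Real.pi * Complex.I * n 1 * a n) z) • (Complex.ofRealCLM.comp Complex.imCLM)) z := by
  have hr := ha.mul_n 0 (2 * Real.pi * Complex.I)
  have hi := ha.mul_n 1 (2 * Real.pi * Complex.I)
  have h1 : ∀ n z, HasFDerivAt (fun z => a n * EE n z)
     ((2 * Real.pi * Complex.I * n 0 * a n * EE n z) • (Complex.ofRealCLM.comp Complex.reCLM)
      + (2 * Real.pi * Complex.I * n 1 * a n * EE n z) • (Complex.ofRealCLM.comp Complex.imCLM)) z := by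
    intro n z
    refine ((EE_hasFDerivAt n z).const_mul (a n)).congr_fderiv ?_
    ext; simp; ring
  have h2 := hasFDerivAt_tsum (u := fun n => ‖2 * Real.pi * Complex.I * n 0 * a n‖ * ‖Complex.ofRealCLM.comp Complex.reCLM‖
     + ‖2 * Real.pi * Complex.I * n 1 * a n‖ * ‖Complex.ofRealCLM.comp Complex.imCLM‖)
     ((hr.summable.norm.mul_right _).add (hi.summable.norm.mul_right _)) h1 (by
      intro n z
      refine (norm_add_le _ _).trans ?_
      gcongr
      · refine (norm_smul_le _ _).trans ?_
        rw [norm_mul _ (EE n z), norm_EE, mul_one]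
      · refine (norm_smul_le _ _).trans ?_
        rw [norm_mul _ (EE n z), norm_EE, mul_one]) (FF_summable ha 0) z
  refine h2.congr_fderiv ?_
  rw [Summable.tsum_add]
  · rw [Summable.tsum_smul_const (FF_summable hr z), Summable.tsum_smul_const (FF_summable hi z)]; rfl
  · exact (FF_summable hr z).smul_const _
  · exact (FF_summable hi z).smul_const _

lemma FF_smooth {a : (Fin 2 → ℤ) → ℂ} (ha : RD a) : ContDiff ℝ (⊤ : ℕ∞) (FF a) := by
  rw [contDiff_infty]
  intro p
  induction p generalizing a with
  | zero =>
    exact_mod_cast contDiff_zero.2 (continuous_iff_continuousAt.2 fun z => (FF_hasFDerivAt ha z).continuousAt)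
  | succ p ih =>
    rw [Nat.cast_add, Nat.cast_one, contDiff_succ_iff_fderiv]
    refine ⟨fun z => (FF_hasFDerivAt ha z).differentiableAt, by simp, ?_⟩
    rw [show fderiv ℝ (FF a) = _ from funext fun z => (FF_hasFDerivAt ha z).fderiv]
    exact ((ih (ha.mul_n 0 _)).smul contDiff_const).add ((ih (ha.mul_n 1 _)).smul contDiff_const)

noncomputable def nu (n : Fin 2 → ℤ) : ℂ := n 0 + Complex.I * n 1
noncomputable def nub (n : Fin 2 → ℤ) : ℂ := n 0 - Complex.I * n 1

lemma FF_wbar {a : (Fin 2 → ℤ) → ℂ} (ha : RD a) (z : ℂ) :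
    wderivBar (FF a) z = FF (fun n => Real.pi * Complex.I * nu n * a n) z := by
  rw [wderivBar, (FF_hasFDerivAt ha z).fderiv]
  have hr := FF_summable (ha.mul_n 0 (2 * Real.pi * Complex.I)) z
  have hi := FF_summable (ha.mul_n 1 (2 * Real.pi * Complex.I)) z
  simp [FF]
  rw [← tsum_mul_left, ← hr.tsum_add (hi.mul_left _), ← tsum_div_const]
  congr 1; funext n; rw [nu]; ring

lemma FF_w {a : (Fin 2 → ℤ) → ℂ} (ha : RD a) (z : ℂ) :
    wderiv (FF a) z = FF (fun n => Real.pi * Complex.I * nub n * a n) z := by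
  rw [wderiv, (FF_hasFDerivAt ha z).fderiv]
  have hr := FF_summable (ha.mul_n 0 (2 * Real.pi * Complex.I)) z
  have hi := FF_summable (ha.mul_n 1 (2 * Real.pi * Complex.I)) z
  simp [FF]
  rw [← tsum_mul_left, ← hr.tsum_sub (hi.mul_left _), ← tsum_div_const]
  congr 1; funext n; rw [nub]; ring

lemma FF_coeff (m : C(T2, ℂ)) (hm : Sm m) (z : ℂ) : FF (mFourierCoeff m) z = m (pr z) := by
  have := hasSum_mFourier_series_apply_of_summable (rd_coeff m hm).summable (pr z)
  simp only [mFourier_pr, smul_eq_mul] at this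
  exact this.tsum_eq

lemma exists_torus {a : (Fin 2 → ℤ) → ℂ} (ha : RD a) :
    ∃ m : C(T2, ℂ), Sm m ∧ (∀ z, m (pr z) = FF a z) ∧ mFourierCoeff m = a := by
  have hs : Summable (fun n => a n • mFourier n) := by
    apply Summable.of_norm
    simpa [norm_smul, mFourier_norm] using ha.summable.norm
  have h1 : ∀ z, (∑' n, a n • mFourier n : C(T2, ℂ)) (pr z) = FF a z := by
    intro z
    have := (hs.hasSum.mapL (ContinuousMap.evalCLM ℂ (pr z))).tsum_eq
    simp only [ContinuousMap.evalCLM_apply] at this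
    rw [← this]
    simp [FF, mFourier_pr]
  refine ⟨∑' n, a n • mFourier n, ?_, h1, ?_⟩
  · unfold Sm; simp only [h1]; exact FF_smooth ha
  · funext k
    have := (hs.hasSum.mapL ((cf k).comp (ContinuousMap.toLp 2 volume ℂ))).tsum_eq
    simp only [ContinuousLinearMap.comp_apply, map_smul] at this
    rw [← cf_toLp, ← this, tsum_eq_single k]
    · have h3 : cf k (mFourierLp 2 k) = 1 := by
        rw [← coe_mFourierBasis, cf_repr, HilbertBasis.repr_self]; simp
      rw [show (ContinuousMap.toLp 2 volume ℂ (mFourier k) : H2) = mFourierLp 2 k from rfl, h3]; simp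
    · intro n hn
      have h3 : cf k (mFourierLp 2 n) = 0 := by
        rw [← coe_mFourierBasis, cf_repr, HilbertBasis.repr_self]; simp [hn.symm, lp.single_apply]
      rw [show (ContinuousMap.toLp 2 volume ℂ (mFourier n) : H2) = mFourierLp 2 n from rfl, h3]; simp

noncomputable def mulOp : C(T2, ℂ) →L[ℂ] (H2 →L[ℂ] H2) :=
  ((ContinuousLinearMap.mul ℂ ℂ).holderL (volume : Measure T2) ⊤ 2 2).comp (ContinuousMap.toLp ⊤ volume ℂ)

lemma mulOp_ae (m : C(T2, ℂ)) (x : H2) : mulOp m x =ᵐ[volume] fun t => m t * x t := by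
  have h1 := (ContinuousLinearMap.mul ℂ ℂ).coeFn_holder (r := 2) (m.toLp ⊤ (volume : Measure T2) ℂ) x
  have h2 := ContinuousMap.coeFn_toLp (p := ⊤) (𝕜 := ℂ) (volume : Measure T2) m
  filter_upwards [h1, h2] with t h3 h4
  rw [h4] at h3
  exact h3

lemma mulOp_norm (m : C(T2, ℂ)) : ‖mulOp m‖ ≤ ‖m‖ := by
  have h1 : ‖(ContinuousLinearMap.mul ℂ ℂ).holderL (volume : Measure T2) ⊤ 2 2‖ ≤ 1 :=
    (ContinuousLinearMap.norm_holderL_le _).trans (ContinuousLinearMap.opNorm_mul_le ℂ ℂ)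
  have h2 : ‖(ContinuousMap.toLp ⊤ volume ℂ : C(T2, ℂ) →L[ℂ] Lp ℂ ⊤ (volume : Measure T2))‖ ≤ 1 := by
    refine (ContinuousMap.toLp_norm_le _).trans ?_
    simp
  have h3 : ‖mulOp‖ ≤ 1 := (ContinuousLinearMap.opNorm_comp_le _ _).trans
    (mul_le_one₀ h1 (norm_nonneg _) h2)
  exact (mulOp.le_of_opNorm_le h3 m).trans (by simp)

lemma mulOp_toLp (m f : C(T2, ℂ)) :
    mulOp m (f.toLp 2 volume ℂ) = (m * f).toLp 2 volume ℂ := by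
  apply Lp.ext
  filter_upwards [mulOp_ae m (f.toLp 2 volume ℂ), ContinuousMap.coeFn_toLp (p := 2) (𝕜 := ℂ) (volume : Measure T2) f,
    ContinuousMap.coeFn_toLp (p := 2) (𝕜 := ℂ) (volume : Measure T2) (m * f)] with t h1 h2 h3
  rw [h1, h2, h3]; rfl

noncomputable def sym (n : Fin 2 → ℤ) : ℂ := nub n / nu n

lemma norm_nub (n : Fin 2 → ℤ) : ‖nub n‖ = ‖nu n‖ := by
  have : nub n = (starRingEnd ℂ) (nu n) := by simp [nub, nu, sub_eq_add_neg]
  rw [this, RCLike.norm_conj]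

lemma norm_sym (n : Fin 2 → ℤ) : ‖sym n‖ ≤ 1 := by
  rw [sym, norm_div, norm_nub]; exact div_self_le_one _

lemma sym_neg (n : Fin 2 → ℤ) : sym (-n) = sym n := by
  have h1 : nub (-n) = - nub n := by simp [nub]; ring
  have h2 : nu (-n) = - nu n := by simp [nu]; ring
  rw [sym, sym, h1, h2, neg_div_neg_eq]

lemma nu_zero : nu 0 = 0 := by simp [nu]

lemma one_le_nu (n : Fin 2 → ℤ) (hn : n ≠ 0) : 1 ≤ ‖nu n‖ := by
  have h1 : |(n 0 : ℝ)| ≤ ‖nu n‖ := by simpa [nu] using Complex.abs_re_le_norm (nu n)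
  have h2 : |(n 1 : ℝ)| ≤ ‖nu n‖ := by simpa [nu] using Complex.abs_im_le_norm (nu n)
  by_cases h0 : n 0 = 0
  · have h3 : n 1 ≠ 0 := by
      intro h4; apply hn; funext i; fin_cases i <;> simp [h0, h4]
    exact le_trans (by exact_mod_cast Int.one_le_abs h3) h2
  · exact le_trans (by exact_mod_cast Int.one_le_abs h0) h1

noncomputable def diagLin : lp (fun _ : Fin 2 → ℤ => ℂ) 2 →ₗ[ℂ] lp (fun _ : Fin 2 → ℤ => ℂ) 2 where
  toFun x := ⟨fun n => sym n * x n, (lp.memℓp x).mono' (fun n => by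
    rw [norm_mul]; exact mul_le_of_le_one_left (norm_nonneg _) (norm_sym n))⟩
  map_add' x y := by ext n; exact mul_add _ _ _
  map_smul' c x := by ext n; exact mul_left_comm _ _ _

lemma diagLin_bound (x : lp (fun _ : Fin 2 → ℤ => ℂ) 2) : ‖diagLin x‖ ≤ 1 * ‖x‖ := by
  rw [one_mul]
  refine lp.norm_mono (by norm_num) (fun n => ?_)
  change ‖sym n * x n‖ ≤ _
  rw [norm_mul]; exact mul_le_of_le_one_left (norm_nonneg _) (norm_sym n)

noncomputable def SS : H2 →L[ℂ] H2 :=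
  (mFourierBasis (d := Fin 2)).repr.symm.toContinuousLinearEquiv.toContinuousLinearMap.comp
    ((diagLin.mkContinuous 1 diagLin_bound).comp
      (mFourierBasis (d := Fin 2)).repr.toContinuousLinearEquiv.toContinuousLinearMap)

lemma cf_SS (n : Fin 2 → ℤ) (x : H2) : cf n (SS x) = sym n * cf n x := by
  rw [cf_repr, cf_repr]
  simp [SS]
  rfl

lemma norm_SS (x : H2) : ‖SS x‖ ≤ ‖x‖ := by
  have := diagLin_bound (mFourierBasis.repr x)
  simp only [one_mul, LinearIsometryEquiv.norm_map] at this
  simpa [SS] using this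

lemma norm_mulSS (m : C(T2, ℂ)) : ‖mulOp m * SS‖ ≤ ‖m‖ := by
  refine (norm_mul_le _ _).trans ?_
  have : ‖SS‖ ≤ 1 := SS.opNorm_le_bound zero_le_one (fun x => by simpa using norm_SS x)
  calc _ ≤ ‖m‖ * 1 := by gcongr; exact mulOp_norm m
    _ = _ := mul_one _

noncomputable def sol (m g : C(T2, ℂ)) : H2 :=
  Ring.inverse (1 - mulOp m * SS) (g.toLp 2 volume ℂ)

lemma isUnit_sub_mulSS (m : C(T2, ℂ)) (hm : ‖m‖ < 1) : IsUnit (1 - mulOp m * SS) :=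
  ⟨Units.oneSub _ ((norm_mulSS m).trans_lt hm), rfl⟩

lemma sol_spec (m g : C(T2, ℂ)) (hm : ‖m‖ < 1) :
    sol m g = mulOp m (SS (sol m g)) + g.toLp 2 volume ℂ := by
  have h := Ring.mul_inverse_cancel _ (isUnit_sub_mulSS m hm)
  have h2 := congrArg (fun A : H2 →L[ℂ] H2 => A (g.toLp 2 volume ℂ)) h
  simp only [mul_apply_eq_comp, sub_apply, one_apply_eq_self] at h2
  rw [sub_eq_iff_eq_add'] at h2
  exact h2

lemma sol_unique (m g : C(T2, ℂ)) (hm : ‖m‖ < 1) (x : H2)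
    (hx : x = mulOp m (SS x) + g.toLp 2 volume ℂ) : x = sol m g := by
  have h := Ring.inverse_mul_cancel _ (isUnit_sub_mulSS m hm)
  have h2 := congrArg (fun A : H2 →L[ℂ] H2 => A x) h
  simp only [mul_apply_eq_comp, sub_apply, one_apply_eq_self] at h2
  rw [← h2, sol]
  congr 1
  conv_lhs => rw [hx]
  conv_lhs => enter [2]; rw [← hx]
  simp

lemma sol_smooth (m g : ℝ → C(T2, ℂ)) (hm : ContDiff ℝ (⊤ : ℕ∞) m) (hg : ContDiff ℝ (⊤ : ℕ∞) g)
    (h : ∀ t, ‖m t‖ < 1) : ContDiff ℝ (⊤ : ℕ∞) (fun t => sol (m t) (g t)) := by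
  have h1 : ContDiff ℝ (⊤ : ℕ∞) (fun t => 1 - mulOp (m t) * SS) := by
    refine contDiff_const.sub (ContDiff.mul ?_ contDiff_const)
    exact (mulOp.restrictScalars ℝ).contDiff.comp hm
  have h2 : ContDiff ℝ (⊤ : ℕ∞) (fun t => Ring.inverse (1 - mulOp (m t) * SS)) := by
    rw [contDiff_iff_contDiffAt]
    intro t
    have h3 := contDiffAt_ringInverse ℝ (n := (⊤ : ℕ∞)) (isUnit_sub_mulSS (m t) (h t)).unit
    exact ContDiffAt.comp t h3 h1.contDiffAt
  have h4 : ContDiff ℝ (⊤ : ℕ∞) (fun t => ((g t).toLp 2 volume ℂ : H2)) :=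
    ((ContinuousMap.toLp 2 (volume : Measure T2) ℂ).restrictScalars ℝ).contDiff.comp hg
  have h5 : ContDiff ℝ (⊤ : ℕ∞) (fun t => ContinuousLinearMap.restrictScalarsL ℂ H2 H2 ℝ ℝ (Ring.inverse (1 - mulOp (m t) * SS))) :=
    (ContinuousLinearMap.contDiff _).comp h2
  exact h5.clm_apply h4

lemma mulOp_comp (φ : T2 → T2) (hφc : Continuous φ) (hφ : MeasurePreserving φ (volume : Measure T2) volume)
    (m : C(T2, ℂ)) (x : H2) :
    Lp.compMeasurePreserving φ hφ (mulOp m x) = mulOp (m.comp ⟨φ, hφc⟩) (Lp.compMeasurePreserving φ hφ x) := by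
  apply Lp.ext
  filter_upwards [Lp.coeFn_compMeasurePreserving (mulOp m x) hφ, Lp.coeFn_compMeasurePreserving x hφ,
    mulOp_ae (m.comp ⟨φ, hφc⟩) (Lp.compMeasurePreserving φ hφ x),
    hφ.quasiMeasurePreserving.ae (mulOp_ae m x)] with t h1 h2 h3 h4
  rw [h1, h3, h2, Function.comp_apply, h4]; rfl

lemma toLp_comp (φ : T2 → T2) (hφc : Continuous φ) (hφ : MeasurePreserving φ (volume : Measure T2) volume)
    (g : C(T2, ℂ)) :
    Lp.compMeasurePreserving φ hφ (g.toLp 2 volume ℂ) = (g.comp ⟨φ, hφc⟩).toLp 2 volume ℂ := by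
  apply Lp.ext
  filter_upwards [Lp.coeFn_compMeasurePreserving (g.toLp 2 volume ℂ : H2) hφ,
    ContinuousMap.coeFn_toLp (p := 2) (𝕜 := ℂ) (volume : Measure T2) (g.comp ⟨φ, hφc⟩),
    hφ.quasiMeasurePreserving.ae (ContinuousMap.coeFn_toLp (p := 2) (𝕜 := ℂ) (volume : Measure T2) g)] with t h1 h2 h3
  rw [h1, h2, Function.comp_apply, h3]; rfl

lemma sol_comp (φ : T2 → T2) (hφc : Continuous φ) (hφ : MeasurePreserving φ (volume : Measure T2) volume)
    (hS : ∀ x : H2, Lp.compMeasurePreserving φ hφ (SS x) = SS (Lp.compMeasurePreserving φ hφ x))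
    (m g : C(T2, ℂ)) (hm : ‖m‖ < 1) (hm' : ‖m.comp ⟨φ, hφc⟩‖ < 1) :
    Lp.compMeasurePreserving φ hφ (sol m g) = sol (m.comp ⟨φ, hφc⟩) (g.comp ⟨φ, hφc⟩) := by
  apply sol_unique _ _ hm'
  conv_lhs => rw [sol_spec m g hm]
  rw [map_add, mulOp_comp φ hφc, toLp_comp φ hφc, hS]

lemma mp_trans (y : T2) : MeasurePreserving (fun x : T2 => x + y) volume volume :=
  measurePreserving_add_right volume y

instance T2_negInv : (volume : Measure T2).IsNegInvariant :=
  Measure.IsAddHaarMeasure.isNegInvariant_of_regular _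

lemma mp_neg : MeasurePreserving (fun x : T2 => -x) volume volume :=
  Measure.measurePreserving_neg volume

lemma cf_trans (y : T2) (x : H2) (n : Fin 2 → ℤ) :
    cf n (Lp.compMeasurePreserving _ (mp_trans y) x) = mFourier n y * cf n x := by
  rw [cf_eq, cf_eq]
  have h0 : mFourierCoeff (Lp.compMeasurePreserving _ (mp_trans y) x) n = mFourierCoeff (fun t => x (t + y)) n := by
    unfold mFourierCoeff
    apply integral_congr_ae
    filter_upwards [Lp.coeFn_compMeasurePreserving x (mp_trans y)] with t ht
    rw [ht]; rfl
  rw [h0]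
  unfold mFourierCoeff
  rw [← integral_const_mul]
  rw [← integral_add_right_eq_self _ (-y)]
  congr 1; funext t
  have h1 : mFourier (-n) (-y) = mFourier n y := by
    simp [mFourier, fourier_apply]
  rw [mFourier_add_arg, h1]
  simp [mul_comm, mul_left_comm]

lemma cf_negc (x : H2) (n : Fin 2 → ℤ) :
    cf n (Lp.compMeasurePreserving _ mp_neg x) = cf (-n) x := by
  rw [cf_eq, cf_eq]
  have h0 : mFourierCoeff (Lp.compMeasurePreserving _ mp_neg x) n = mFourierCoeff (fun t => x (-t)) n := by
    unfold mFourierCoeff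
    apply integral_congr_ae
    filter_upwards [Lp.coeFn_compMeasurePreserving x mp_neg] with t ht
    rw [ht]; rfl
  rw [h0]
  unfold mFourierCoeff
  rw [← integral_neg_eq_self]
  congr 1; funext t
  have h1 : mFourier (-n) (-t) = mFourier (-(-n)) t := by
    simp [mFourier, fourier_apply]
  rw [h1, neg_neg]
  beta_reduce
  rw [neg_neg]

lemma norm_comp_lt (φ : T2 → T2) (hφc : Continuous φ) (m : C(T2, ℂ)) (hm : ‖m‖ < 1) :
    ‖m.comp ⟨φ, hφc⟩‖ < 1 := by
  rw [ContinuousMap.norm_lt_iff _ zero_lt_one] at hm ⊢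
  exact fun x => hm _

lemma sol_rd (m g : C(T2, ℂ)) (hm : Sm m) (hg : Sm g) (h : ‖m‖ < 1) : RD (fun n => cf n (sol m g)) := by
  apply rd_of_orbit _ (fun e t => sol (tau m e t) (tau g e t))
  · intro e
    exact sol_smooth _ _ (tau_smooth e m hm) (tau_smooth e g hg) (fun t => norm_comp_lt _ _ m h)
  · intro e t n
    have h1 := sol_comp (fun x => x + pr (t • e)) (by fun_prop) (mp_trans _) (by
      intro x
      apply cf_ext
      intro n
      rw [cf_trans, cf_SS, cf_SS, cf_trans]; ring) m g h (norm_comp_lt _ _ m h)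
    change cf n (sol _ _) = _
    rw [tau, tau, ← h1, cf_trans, mFourier_pr]

lemma sol_zero (m g : C(T2, ℂ)) (h : ‖m‖ < 1) (hm : ∀ x, m (-x) = m x) (hg : ∀ x, g (-x) = - g x) :
    cf 0 (sol m g) = 0 := by
  have h1 := sol_comp (fun x => -x) (by fun_prop) mp_neg (by
      intro x
      apply cf_ext
      intro n
      rw [cf_negc, cf_SS, cf_SS, cf_negc, sym_neg]) m g h (norm_comp_lt _ _ m h)
  have h2 : m.comp ⟨fun x => -x, by fun_prop⟩ = m := by ext x; exact hm x
  have h3 : g.comp ⟨fun x => -x, by fun_prop⟩ = -g := by ext x; exact hg x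
  rw [h2, h3] at h1
  have h4 : sol m (-g) = - sol m g := by simp [sol]
  have h5 := congrArg (cf 0) h1
  rw [cf_negc, h4, map_neg, neg_zero] at h5
  exact self_eq_neg.1 h5

lemma exists_wd (m : C(T2, ℂ)) (hm : Sm m) : ∃ g : C(T2, ℂ), Sm g ∧
    ∀ z, g (pr z) = wderiv (fun z => m (pr z)) z := by
  obtain ⟨a, ha, ha'⟩ := exists_dm m hm 1
  obtain ⟨b, hb, hb'⟩ := exists_dm m hm Complex.I
  refine ⟨(2⁻¹ : ℂ) • (a - Complex.I • b), ?_, ?_⟩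
  · exact contDiff_const.smul (ContDiff.sub ha (contDiff_const.smul hb))
  · intro z
    simp [wderiv, ha', hb']; ring

theorem exists_sigma (m : C(T2, ℂ)) (hm : Sm m) (h : ‖m‖ < 1) (heven : ∀ x, m (-x) = m x) :
    ∃ a, RD a ∧ ∀ z, wderivBar (FF a) z = m (pr z) * wderiv (FF a) z + wderiv (fun z => m (pr z)) z := by
  obtain ⟨g, hg, hg'⟩ := exists_wd m hm
  have hodd : ∀ x, g (-x) = - g x := by
    intro x
    obtain ⟨z, rfl⟩ := pr_surj x
    rw [← pr_neg, hg', hg']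
    have h1 : (fun z => m (pr z)) = fun z => (fun z => m (pr z)) (-z) := by
      funext z; simp only [pr_neg, heven]
    have h2 : fderiv ℝ (fun z => m (pr z)) (-z) = - fderiv ℝ (fun z => m (pr z)) z := by
      conv_lhs => rw [h1]
      have h3 : HasFDerivAt (fun z => m (pr z)) (fderiv ℝ (fun z => m (pr z)) z) (- -z) := by
        rw [neg_neg]; exact (hm.differentiable (by simp) z).hasFDerivAt
      have h4 := (h3.comp (-z) (hasFDerivAt_id (-z)).neg).fderiv
      refine h4.trans ?_
      ext <;> simp
    rw [wderiv, wderiv, h2]; simp; ring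
  set v := sol m g with hv
  have hrd : RD (fun n => cf n v) := sol_rd m g hm hg h
  have h0 : cf 0 v = 0 := sol_zero m g h heven hodd
  have hrd2 : RD (fun n => sym n * cf n v) := hrd.mono 1 0 (fun n => by
    rw [norm_mul]; simpa using mul_le_of_le_one_left (norm_nonneg _) (norm_sym n))
  obtain ⟨V, hV, hV1, hV2⟩ := exists_torus hrd
  obtain ⟨W, hW, hW1, hW2⟩ := exists_torus hrd2
  have hVv : V.toLp 2 volume ℂ = v := by
    apply cf_ext; intro n; rw [cf_toLp, hV2]
  have hWv : W.toLp 2 volume ℂ = SS v := by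
    apply cf_ext; intro n; rw [cf_toLp, hW2, cf_SS]
  have heq : V = m * W + g := by
    apply ContinuousMap.toLp_injective (p := 2) (𝕜 := ℂ) (volume : Measure T2)
    rw [map_add, ← mulOp_toLp, hWv, hVv]
    exact sol_spec m g h
  have hpi : (Real.pi * Complex.I : ℂ) ≠ 0 := by simp [Real.pi_ne_zero]
  have hra : RD (fun n => cf n v / (Real.pi * Complex.I * nu n)) := hrd.mono 1 0 (fun n => by
    rw [norm_div]
    by_cases hn : n = 0
    · rw [hn, h0]; simp
    · have h1 := one_le_nu n hn
      have h2 : 1 ≤ ‖(Real.pi * Complex.I * nu n : ℂ)‖ := by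
        rw [norm_mul, norm_mul, Complex.norm_I, Complex.norm_real, Real.norm_eq_abs, abs_of_pos Real.pi_pos]
        nlinarith [Real.pi_gt_three]
      simpa using div_le_self (norm_nonneg _) h2)
  refine ⟨_, hra, fun z => ?_⟩
  rw [FF_wbar hra, FF_w hra, ← hg']
  have e1 : (fun n => Real.pi * Complex.I * nu n * (cf n v / (Real.pi * Complex.I * nu n))) = fun n => cf n v := by
    funext n
    by_cases hn : n = 0
    · rw [hn, h0]; simp
    · have : nu n ≠ 0 := by
        intro h; have := one_le_nu n hn; rw [h] at this; norm_num at this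
      field_simp
  have e2 : (fun n => Real.pi * Complex.I * nub n * (cf n v / (Real.pi * Complex.I * nu n))) = fun n => sym n * cf n v := by
    funext n
    by_cases hn : n = 0
    · rw [hn, h0]; simp
    · have : nu n ≠ 0 := by
        intro h; have := one_le_nu n hn; rw [h] at this; norm_num at this
      rw [sym]
      field_simp
  rw [e1, e2, ← hV1, ← hW1, heq]
  rfl

lemma fderiv_holo_comp {h f : ℂ → ℂ} {h' z : ℂ} (hh : HasDerivAt h h' (f z)) (hf : DifferentiableAt ℝ f z)
    (e : ℂ) : fderiv ℝ (fun z => h (f z)) z e = h' * fderiv ℝ f z e := by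
  have h1 : HasFDerivAt h ((ContinuousLinearMap.toSpanSingleton ℂ h').restrictScalars ℝ) (f z) :=
    hh.hasFDerivAt.restrictScalars ℝ
  have h2 := (h1.comp z hf.hasFDerivAt).fderiv
  rw [show (fun z => h (f z)) = h ∘ f from rfl, h2]
  simp [mul_comm]

lemma wderiv_holo_comp {h f : ℂ → ℂ} {h' z : ℂ} (hh : HasDerivAt h h' (f z)) (hf : DifferentiableAt ℝ f z) :
    wderiv (fun z => h (f z)) z = h' * wderiv f z := by
  rw [wderiv, wderiv, fderiv_holo_comp hh hf, fderiv_holo_comp hh hf]; ring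

lemma wderivBar_holo_comp {h f : ℂ → ℂ} {h' z : ℂ} (hh : HasDerivAt h h' (f z)) (hf : DifferentiableAt ℝ f z) :
    wderivBar (fun z => h (f z)) z = h' * wderivBar f z := by
  rw [wderivBar, wderivBar, fderiv_holo_comp hh hf, fderiv_holo_comp hh hf]; ring

lemma wderiv_mul {f g : ℂ → ℂ} {z : ℂ} (hf : DifferentiableAt ℝ f z) (hg : DifferentiableAt ℝ g z) :
    wderiv (fun z => f z * g z) z = f z * wderiv g z + g z * wderiv f z := by
  rw [wderiv, wderiv, wderiv, fderiv_fun_mul hf hg]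
  simp; ring

lemma FF_inj {a b : (Fin 2 → ℤ) → ℂ} (ha : RD a) (hb : RD b) (h : ∀ z, FF a z = FF b z) : a = b := by
  obtain ⟨m, _, h1, h2⟩ := exists_torus ha
  obtain ⟨m', _, h1', h2'⟩ := exists_torus hb
  have : m = m' := by
    ext x
    obtain ⟨z, rfl⟩ := pr_surj x
    rw [h1, h1', h]
  rw [← h2, ← h2', this]

lemma RD.mul_nu {a : (Fin 2 → ℤ) → ℂ} (ha : RD a) (c : ℂ) : RD (fun n => c * nu n * a n) := by
  refine ha.mono (‖c‖ * 2) 1 (fun n => ?_)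
  have h0 : |(n 0 : ℝ)| ≤ ‖n‖ := by rw [norm_fin2]; exact le_max_left _ _
  have h1 : |(n 1 : ℝ)| ≤ ‖n‖ := by rw [norm_fin2]; exact le_max_right _ _
  have h2 : ‖nu n‖ ≤ 2 * ‖n‖ := by
    refine (norm_add_le _ _).trans ?_
    simp only [norm_mul, Complex.norm_I, Complex.norm_intCast, one_mul]
    linarith
  rw [norm_mul, norm_mul, pow_one]
  calc _ ≤ ‖c‖ * (2 * ‖n‖) * ‖a n‖ := by gcongr
    _ = _ := by ring

lemma RD.mul_nub {a : (Fin 2 → ℤ) → ℂ} (ha : RD a) (c : ℂ) : RD (fun n => c * nub n * a n) := by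
  refine (ha.mul_nu c).mono 1 0 (fun n => ?_)
  simp [norm_nub]

lemma EE_zero (z : ℂ) : EE 0 z = 1 := by simp [EE]

lemma nu_ne {n : Fin 2 → ℤ} (hn : n ≠ 0) : nu n ≠ 0 := by
  intro h; have := one_le_nu n hn; rw [h] at this; norm_num at this

lemma FF_split {a : (Fin 2 → ℤ) → ℂ} (ha : RD a) (z : ℂ) :
    FF a z = a 0 + FF (fun n => if n = 0 then 0 else a n) z := by
  rw [FF, (FF_summable ha z).tsum_eq_add_tsum_ite 0, EE_zero, mul_one, FF]
  congr 2; funext n; split_ifs <;> simp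

lemma fderiv_lin (A B z : ℂ) : HasFDerivAt (fun z : ℂ => A * z + B * (starRingEnd ℂ) z)
   (A • ContinuousLinearMap.id ℝ ℂ + B • (Complex.conjCLE : ℂ →L[ℝ] ℂ)) z :=
  ((hasFDerivAt_id z).const_mul A).add (((Complex.conjCLE : ℂ →L[ℝ] ℂ).hasFDerivAt).const_mul B)

lemma norm_FF_le {a : (Fin 2 → ℤ) → ℂ} (ha : RD a) (z : ℂ) : ‖FF a z‖ ≤ ∑' n, ‖a n‖ := by
  refine (norm_tsum_le_tsum_norm (FF_summable ha z).norm).trans (le_of_eq ?_)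
  simp [norm_EE]

theorem exists_f (m : C(T2, ℂ)) (hm : Sm m) (h : ‖m‖ < 1) (heven : ∀ x, m (-x) = m x) :
    ∃ f : ℂ → ℂ, ContDiff ℝ (⊤ : ℕ∞) f ∧ (∀ z, wderivBar f z = m (pr z) * wderiv f z ∧ wderiv f z ≠ 0) ∧
     ∃ (A B : ℂ) (K : ℝ), ‖B‖ < ‖A‖ ∧ ∀ z, ‖f z - (A * z + B * (starRingEnd ℂ) z)‖ ≤ K := by
  obtain ⟨a, ha, hsig⟩ := exists_sigma m hm h heven
  obtain ⟨s, hs, hs1, -⟩ := exists_torus ha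
  let G : C(T2, ℂ) := ⟨fun x => Complex.exp (s x), by fun_prop⟩
  have hG1 : ∀ z, G (pr z) = Complex.exp (FF a z) := fun z => by rw [← hs1]; rfl
  have hG : Sm G := by
    unfold Sm; simp only [hG1]; exact (FF_smooth ha).cexp
  have hH : Sm (m * G) := ContDiff.mul hm hG
  have dm : ∀ z, DifferentiableAt ℝ (fun z => m (pr z)) z := hm.differentiable (by simp)
  have dG : ∀ z, DifferentiableAt ℝ (fun z => G (pr z)) z := hG.differentiable (by simp)
  have da : ∀ z, DifferentiableAt ℝ (FF a) z := (FF_smooth ha).differentiable (by simp)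
  have hG2 : (fun z => G (pr z)) = fun z => Complex.exp (FF a z) := funext hG1
  have wG : ∀ z, wderiv (fun z => G (pr z)) z = G (pr z) * wderiv (FF a) z := by
    intro z; rw [hG2, hG1, wderiv_holo_comp (Complex.hasDerivAt_exp _) (da z)]
  have wbG : ∀ z, wderivBar (fun z => G (pr z)) z = G (pr z) * wderivBar (FF a) z := by
    intro z; rw [hG2, hG1, wderivBar_holo_comp (Complex.hasDerivAt_exp _) (da z)]
  have wH : ∀ z, wderivBar (fun z => G (pr z)) z = wderiv (fun z => (m * G) (pr z)) z := by
    intro z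
    have : (fun z => (m * G) (pr z)) = fun z => m (pr z) * G (pr z) := rfl
    rw [this, wderiv_mul (dm z) (dG z), wG, wbG, hsig]; ring
  have rG := rd_coeff G hG
  have rH := rd_coeff (m * G) hH
  have fG : (fun z => G (pr z)) = FF (mFourierCoeff G) := funext fun z => (FF_coeff G hG z).symm
  have fH : (fun z => (m * G) (pr z)) = FF (mFourierCoeff (⇑(m * G : C(T2, ℂ)))) := funext fun z => (FF_coeff _ hH z).symm
  have hc : ∀ n, nu n * mFourierCoeff G n = nub n * mFourierCoeff (⇑(m * G : C(T2, ℂ))) n := by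
    have h1 := FF_inj (rG.mul_nu (Real.pi * Complex.I)) (rH.mul_nub (Real.pi * Complex.I)) (by
      intro z
      rw [← FF_wbar rG, ← FF_w rH, ← fG, ← fH, wH])
    intro n
    have h2 := congrFun h1 n
    have hpi : (Real.pi * Complex.I : ℂ) ≠ 0 := by simp [Real.pi_ne_zero]
    simp only [mul_assoc _ (nu n), mul_assoc _ (nub n)] at h2
    exact mul_left_cancel₀ hpi h2
  generalize hgc : mFourierCoeff G = gc at *
  generalize hhc : mFourierCoeff (⇑(m * G : C(T2, ℂ))) = hc' at *
  have hnorm : ‖hc' 0‖ < ‖gc 0‖ := by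
    by_contra hcon
    push Not at hcon
    have h1 : ‖(G.toLp 2 volume ℂ : H2)‖ ≤ ‖((m * G).toLp 2 volume ℂ : H2)‖ := by
      rw [← mFourierBasis.repr.norm_map, ← mFourierBasis.repr.norm_map ((m * G).toLp 2 volume ℂ : H2)]
      refine lp.norm_mono (by norm_num) (fun n => ?_)
      rw [← cf_repr, ← cf_repr, cf_toLp, cf_toLp, hgc, hhc]
      by_cases hn : n = 0
      · rw [hn]; exact hcon
      · have h2 := congrArg norm (hc n)
        rw [norm_mul, norm_mul, norm_nub] at h2
        exact (mul_left_cancel₀ (norm_ne_zero_iff.2 (nu_ne hn)) h2).le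
    rw [← mulOp_toLp] at h1
    have h2 : ‖(G.toLp 2 volume ℂ : H2)‖ ≤ ‖m‖ * ‖(G.toLp 2 volume ℂ : H2)‖ :=
      h1.trans ((mulOp m).le_of_opNorm_le (mulOp_norm m) _)
    have h3 : (G.toLp 2 volume ℂ : H2) ≠ 0 := by
      intro h4
      rw [← map_zero (ContinuousMap.toLp 2 volume ℂ)] at h4
      have h5 := ContinuousMap.toLp_injective (p := 2) (𝕜 := ℂ) (volume : Measure T2) h4
      have h6 := DFunLike.congr_fun h5 0
      exact Complex.exp_ne_zero _ h6
    have := norm_pos_iff.2 h3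
    nlinarith
  have hpi : (Real.pi * Complex.I : ℂ) ≠ 0 := by simp [Real.pi_ne_zero]
  have hrb : RD (fun n => hc' n / (Real.pi * Complex.I * nu n)) := rH.mono 1 0 (fun n => by
    rw [norm_div]
    by_cases hn : n = 0
    · rw [hn, nu_zero]; simp
    · have h1 := one_le_nu n hn
      have h2 : 1 ≤ ‖(Real.pi * Complex.I * nu n : ℂ)‖ := by
        rw [norm_mul, norm_mul, Complex.norm_I, Complex.norm_real, Real.norm_eq_abs, abs_of_pos Real.pi_pos]
        nlinarith [Real.pi_gt_three]
      simpa using div_le_self (norm_nonneg _) h2)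
  generalize hb : (fun n => hc' n / (Real.pi * Complex.I * nu n)) = b at *
  have db : ∀ z, DifferentiableAt ℝ (FF b) z := (FF_smooth hrb).differentiable (by simp)
  have hfd : ∀ z, fderiv ℝ (fun z => (gc 0 * z + hc' 0 * (starRingEnd ℂ) z) + FF b z) z =
     (gc 0 • ContinuousLinearMap.id ℝ ℂ + hc' 0 • (Complex.conjCLE : ℂ →L[ℝ] ℂ)) + fderiv ℝ (FF b) z :=
    fun z => ((fderiv_lin _ _ z).add (db z).hasFDerivAt).fderiv
  have hwb : ∀ z, wderivBar (fun z => (gc 0 * z + hc' 0 * (starRingEnd ℂ) z) + FF b z) z = m (pr z) * G (pr z) := by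
    intro z
    have h1 : wderivBar (fun z => (gc 0 * z + hc' 0 * (starRingEnd ℂ) z) + FF b z) z = hc' 0 + wderivBar (FF b) z := by
      rw [wderivBar, wderivBar, hfd]
      simp
      linear_combination (gc 0 / 2 - hc' 0 / 2) * Complex.I_sq
    have h2 : m (pr z) * G (pr z) = FF hc' z := congrFun fH z
    rw [h1, h2, FF_split rH, FF_wbar hrb]
    congr 2; funext n
    rw [← hb]
    beta_reduce
    split_ifs with hn
    · rw [hn, nu_zero]; simp
    · have := nu_ne hn
      field_simp
  have hw : ∀ z, wderiv (fun z => (gc 0 * z + hc' 0 * (starRingEnd ℂ) z) + FF b z) z = G (pr z) := by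
    intro z
    have h1 : wderiv (fun z => (gc 0 * z + hc' 0 * (starRingEnd ℂ) z) + FF b z) z = gc 0 + wderiv (FF b) z := by
      rw [wderiv, wderiv, hfd]
      simp
      linear_combination (-gc 0 / 2 + hc' 0 / 2) * Complex.I_sq
    have h2 : G (pr z) = FF gc z := congrFun fG z
    rw [h1, h2, FF_split rG, FF_w hrb]
    congr 2; funext n
    rw [← hb]
    beta_reduce
    split_ifs with hn
    · rw [hn, nu_zero]; simp
    · have := nu_ne hn
      have h3 : gc n = nub n * hc' n / nu n := by rw [← hc]; field_simp
      rw [h3]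
      field_simp
  refine ⟨fun z => (gc 0 * z + hc' 0 * (starRingEnd ℂ) z) + FF b z, ?_, ?_, gc 0, hc' 0, ∑' n, ‖b n‖, hnorm, ?_⟩
  · refine ContDiff.add (ContDiff.add (contDiff_const.mul contDiff_id) (contDiff_const.mul ?_)) (FF_smooth hrb)
    exact (Complex.conjCLE : ℂ →L[ℝ] ℂ).contDiff
  · intro z
    rw [hwb, hw]
    exact ⟨rfl, by rw [hG1]; exact Complex.exp_ne_zero _⟩
  · intro z
    simpa using norm_FF_le hrb z

lemma fderiv_eq_w (f : ℂ → ℂ) (z v : ℂ) :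
    fderiv ℝ f z v = wderiv f z * v + wderivBar f z * (starRingEnd ℂ) v := by
  have h : v = v.re • (1 : ℂ) + v.im • Complex.I := by
    apply Complex.ext <;> simp
  have h2 : fderiv ℝ f z v = v.re * fderiv ℝ f z 1 + v.im * fderiv ℝ f z Complex.I := by
    conv_lhs => rw [h]
    rw [map_add, map_smul, map_smul, Complex.real_smul, Complex.real_smul]
  have h3 : v = v.re + v.im * Complex.I := (Complex.re_add_im v).symm
  have h4 : (starRingEnd ℂ) v = v.re - v.im * Complex.I := by
    apply Complex.ext <;> simp
  rw [h2, h4, wderiv, wderivBar]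
  linear_combination (v.im * fderiv ℝ f z Complex.I) * Complex.I_sq - (fderiv ℝ f z 1 - Complex.I * fderiv ℝ f z Complex.I) / 2 * h3

lemma exists_fderiv_equiv {f : ℂ → ℂ} {z c : ℂ} (hc : ‖c‖ < 1) (h1 : wderivBar f z = c * wderiv f z)
    (h2 : wderiv f z ≠ 0) : ∃ e : ℂ ≃L[ℝ] ℂ, (e : ℂ →L[ℝ] ℂ) = fderiv ℝ f z := by
  have hinj : Function.Injective (fderiv ℝ f z : ℂ →ₗ[ℝ] ℂ) := by
    rw [← LinearMap.ker_eq_bot, LinearMap.ker_eq_bot']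
    intro v hv
    have hv' : fderiv ℝ f z v = 0 := hv
    rw [fderiv_eq_w, h1] at hv'
    have h3 : wderiv f z * (v + c * (starRingEnd ℂ) v) = 0 := by rw [← hv']; ring
    have h4 := (mul_eq_zero.1 h3).resolve_left h2
    have h5 : ‖v‖ = ‖c‖ * ‖v‖ := by
      have h6 := congrArg norm (eq_neg_of_add_eq_zero_left h4)
      rwa [norm_neg, norm_mul, RCLike.norm_conj] at h6
    by_contra hne
    have := norm_pos_iff.2 hne
    nlinarith
  refine ⟨(LinearEquiv.ofInjectiveEndo _ hinj).toContinuousLinearEquiv, ?_⟩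
  ext v <;> rfl

theorem f_emb {f : ℂ → ℂ} (hf : ContDiff ℝ (⊤ : ℕ∞) f) {c : ℂ → ℂ} (hc : ∀ z, ‖c z‖ < 1)
    (h : ∀ z, wderivBar f z = c z * wderiv f z ∧ wderiv f z ≠ 0)
    {A B : ℂ} {K : ℝ} (hAB : ‖B‖ < ‖A‖) (hK : ∀ z, ‖f z - (A * z + B * (starRingEnd ℂ) z)‖ ≤ K) :
    IsOpenEmbedding f := by
  have hloc : IsLocalHomeomorph f := by
    apply IsLocalHomeomorph.mk
    intro z
    obtain ⟨e, he⟩ := exists_fderiv_equiv (hc z) (h z).1 (h z).2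
    have hd : HasFDerivAt f (e : ℂ →L[ℝ] ℂ) z := by
      rw [he]; exact (hf.differentiable (by simp) z).hasFDerivAt
    refine ⟨hf.contDiffAt.toOpenPartialHomeomorph f hd (by simp), ContDiffAt.mem_toOpenPartialHomeomorph_source _ _ _, ?_⟩
    intro x _; rfl
  have hcont := hf.continuous
  have hbd : ∀ z, (‖A‖ - ‖B‖) * ‖z‖ - K ≤ ‖f z‖ := by
    intro z
    have h1 := hK z
    have h2 : ‖A * z‖ ≤ ‖f z‖ + ‖f z - (A * z + B * (starRingEnd ℂ) z)‖ + ‖B * (starRingEnd ℂ) z‖ := by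
      have : A * z = f z - (f z - (A * z + B * (starRingEnd ℂ) z)) - B * (starRingEnd ℂ) z := by ring
      conv_lhs => rw [this]
      exact (norm_sub_le _ _).trans (add_le_add_left (norm_sub_le _ _) _)
    rw [norm_mul, norm_mul, RCLike.norm_conj] at h2
    linarith
  have hprop : IsProperMap f := by
    rw [isProperMap_iff_tendsto_cocompact]
    refine ⟨hcont, ?_⟩
    rw [← Metric.cobounded_eq_cocompact, ← comap_norm_atTop, Filter.tendsto_comap_iff]
    refine Filter.tendsto_atTop_mono hbd ?_
    refine Filter.tendsto_atTop_add_const_right _ _ (Filter.Tendsto.const_mul_atTop (by linarith) ?_)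
    exact Filter.tendsto_comap
  have hclosed := hprop.isClosedMap
  have hcov : IsCoveringMap f := by
    rw [isCoveringMap_iff_isCoveringMapOn_univ]
    refine hclosed.isCoveringMapOn_of_isLocalHomeomorphOn (fun x _ => ?_) ?_
    · refine (hprop.isCompact_preimage isCompact_singleton).finite ?_
      refine IsDiscrete.of_openPartialHomeomorph f subset_rfl (fun e _ => ?_)
      obtain ⟨φ, h1, h2⟩ := hloc e
      exact ⟨φ, h1, h2.symm⟩
    · exact isLocalHomeomorph_iff_isLocalHomeomorphOn_univ.1 hloc |>.mono (Set.subset_univ _)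
  refine hloc.isOpenEmbedding_of_injective ?_
  intro a b hab
  obtain ⟨F, ⟨hF1, hF2⟩, -⟩ := hcov.existsUnique_continuousMap_lifts (ContinuousMap.id ℂ) (f a) a rfl
  have h1 : (F ∘ f : ℂ → ℂ) = id := by
    refine hcov.eq_of_comp_eq (F.continuous.comp hcont) continuous_id ?_ a hF1
    funext x
    exact congrFun hF2 (f x)
  have ha := congrFun h1 a
  have hb := congrFun h1 b
  simp only [Function.comp, id] at ha hb
  rw [← ha, ← hb, hab]

lemma exists_ext {V : Set ℂ} (hV : IsOpen V) (hVs : Metric.closedBall 0 1 ⊆ V) {μ : ℂ → ℂ}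
    (hμ : ContDiffOn ℝ (⊤ : ℕ∞) μ V) {k : ℝ} (hk : ∀ z ∈ V, ‖μ z‖ ≤ k) :
    ∃ m : ℂ → ℂ, ContDiff ℝ (⊤ : ℕ∞) m ∧ (∀ z, ‖m z‖ ≤ k) ∧ ∀ z ∈ Metric.closedBall (0 : ℂ) 1, m z = μ z := by
  have hk0 : 0 ≤ k := (norm_nonneg _).trans (hk 0 (hVs (by simp)))
  obtain ⟨δ, hδ, hsub⟩ := (isCompact_closedBall (0 : ℂ) 1).exists_cthickening_subset_open hV hVs
  rw [cthickening_closedBall hδ.le zero_le_one] at hsub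
  let b : ContDiffBump (0 : ℂ) := ⟨1, δ + 1, one_pos, by linarith⟩
  have hts : tsupport b ⊆ V := by rw [b.tsupport_eq]; exact hsub
  refine ⟨fun z => (b z : ℂ) * μ z, ?_, ?_, ?_⟩
  · rw [contDiff_iff_contDiffAt]
    intro z
    by_cases hz : z ∈ V
    · exact ContDiffAt.mul (Complex.ofRealCLM.contDiff.contDiffAt.comp z b.contDiffAt) (hμ.contDiffAt (hV.mem_nhds hz))
    · have h1 : z ∉ tsupport b := fun h => hz (hts h)
      have h2 := notMem_tsupport_iff_eventuallyEq.1 h1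
      refine (contDiffAt_const (c := (0 : ℂ))).congr_of_eventuallyEq ?_
      filter_upwards [h2] with x hx
      simp [hx]
  · intro z
    by_cases hz : z ∈ V
    · rw [norm_mul, Complex.norm_real, Real.norm_of_nonneg b.nonneg]
      exact (mul_le_of_le_one_left (norm_nonneg _) b.le_one).trans (hk z hz)
    · have h1 : z ∉ tsupport b := fun h => hz (hts h)
      simp [image_eq_zero_of_notMem_tsupport h1, hk0]
  · intro z hz
    simp [b.one_of_mem_closedBall hz]

lemma exists_rho : ∃ r : ℝ → ℝ, ContDiff ℝ (⊤ : ℕ∞) r ∧ Function.Periodic r 1 ∧ (∀ x, r (-x) = r x) ∧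
    ∀ x, |x| ≤ 1 / 12 → r (1 / 4 + x) = x := by
  let b : ContDiffBump (0 : ℝ) := ⟨1 / 2, 3 / 4, by norm_num, by norm_num⟩
  have hth : ContDiff ℝ (⊤ : ℕ∞) (fun t => b t * (Real.arcsin t / (2 * Real.pi))) := by
    rw [contDiff_iff_contDiffAt]
    intro t
    by_cases ht : t ∈ tsupport b
    · rw [b.tsupport_eq, mem_closedBall_zero_iff, Real.norm_eq_abs, abs_le] at ht
      obtain ⟨h1, h2⟩ := ht
      change -(3 / 4) ≤ t at h1
      change t ≤ 3 / 4 at h2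
      exact b.contDiffAt.mul ((Real.contDiffAt_arcsin (by linarith) (by linarith)).div_const _)
    · have h2 := notMem_tsupport_iff_eventuallyEq.1 ht
      refine (contDiffAt_const (c := (0 : ℝ))).congr_of_eventuallyEq ?_
      filter_upwards [h2] with x hx
      simp [hx]
  refine ⟨fun x => (fun t => b t * (Real.arcsin t / (2 * Real.pi))) (-Real.cos (2 * Real.pi * x)), ?_, ?_, ?_, ?_⟩
  · exact hth.comp ((Real.contDiff_cos.comp (contDiff_const.mul contDiff_id)).neg)
  · intro x
    simp only [mul_add, mul_one, Real.cos_add_two_pi]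
  · intro x
    simp only [mul_neg, Real.cos_neg]
  · intro x hx
    rw [abs_le] at hx
    have h1 : -Real.cos (2 * Real.pi * (1 / 4 + x)) = Real.sin (2 * Real.pi * x) := by
      rw [show 2 * Real.pi * (1 / 4 + x) = 2 * Real.pi * x + Real.pi / 2 by ring, Real.cos_add_pi_div_two]; ring
    have hp := Real.pi_pos
    have h2 : Real.sin (2 * Real.pi * x) ≤ 1 / 2 := by
      rw [← Real.sin_pi_div_six]
      apply Real.sin_le_sin_of_le_of_le_pi_div_two <;> nlinarith
    have h3 : -(1 / 2) ≤ Real.sin (2 * Real.pi * x) := by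
      rw [← Real.sin_pi_div_six, ← Real.sin_neg]
      apply Real.sin_le_sin_of_le_of_le_pi_div_two <;> nlinarith
    simp only [h1]
    rw [b.one_of_mem_closedBall (by rw [mem_closedBall_zero_iff, Real.norm_eq_abs, abs_le]; exact ⟨h3, h2⟩),
      Real.arcsin_sin (by nlinarith) (by nlinarith)]
    field_simp

theorem exists_mu {V : Set ℂ} (hV : IsOpen V) (hVs : Metric.closedBall 0 1 ⊆ V) {μ : ℂ → ℂ}
    (hμ : ContDiffOn ℝ (⊤ : ℕ∞) μ V) {k : ℝ} (hk1 : k < 1) (hk : ∀ z ∈ V, ‖μ z‖ ≤ k) :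
    ∃ (m : C(T2, ℂ)) (p : ℂ), Sm m ∧ ‖m‖ < 1 ∧ (∀ x, m (-x) = m x) ∧
      ∀ w ∈ Metric.ball (0 : ℂ) 1, m (pr (p + w / 12)) = μ w := by
  have hk0 : 0 ≤ k := (norm_nonneg _).trans (hk 0 (hVs (by simp)))
  obtain ⟨M, hM, hMk, hMμ⟩ := exists_ext hV hVs hμ hk
  obtain ⟨r, hr, hper, heven, hid⟩ := exists_rho
  have hF : ContDiff ℝ (⊤ : ℕ∞) (fun z : ℂ => M (12 * ((r z.re : ℂ) + (r z.im : ℂ) * Complex.I))) := by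
    refine hM.comp (contDiff_const.mul (ContDiff.add ?_ (ContDiff.mul ?_ contDiff_const)))
    · exact Complex.ofRealCLM.contDiff.comp (hr.comp Complex.reCLM.contDiff)
    · exact Complex.ofRealCLM.contDiff.comp (hr.comp Complex.imCLM.contDiff)
  have hrr : ∀ x y : ℝ, (x : UnitAddCircle) = y → r x = r y := fun x y hxy => by
    rw [← hper.lift_coe x, ← hper.lift_coe y]; exact congrArg _ hxy
  obtain ⟨m, hm⟩ := exists_lift _ hF.continuous (fun z w hzw => by
    have h0 := congrFun hzw 0
    have h1 := congrFun hzw 1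
    simp only [pr, Matrix.cons_val_zero, Matrix.cons_val_one] at h0 h1
    simp only [hrr _ _ h0, hrr _ _ h1])
  refine ⟨m, 1 / 4 + 1 / 4 * Complex.I, ?_, ?_, ?_, ?_⟩
  · unfold Sm; simp only [hm]; exact hF
  · refine lt_of_le_of_lt ((ContinuousMap.norm_le _ hk0).2 ?_) hk1
    intro x
    obtain ⟨z, rfl⟩ := pr_surj x
    rw [hm]; exact hMk _
  · intro x
    obtain ⟨z, rfl⟩ := pr_surj x
    rw [← pr_neg, hm, hm]
    simp only [Complex.neg_re, Complex.neg_im, heven]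
  · intro w hw
    rw [mem_ball_zero_iff] at hw
    have e1 : (1 / 4 + 1 / 4 * Complex.I + w / 12 : ℂ) = ((1 / 4 + w.re / 12 : ℝ) : ℂ) + ((1 / 4 + w.im / 12 : ℝ) : ℂ) * Complex.I := by
      conv_lhs => rw [← Complex.re_add_im w]
      push_cast; ring
    have h1 := (Complex.abs_re_le_norm w).trans hw.le
    have h2 := (Complex.abs_im_le_norm w).trans hw.le
    rw [hm, e1]
    simp only [Complex.add_re, Complex.add_im, Complex.ofReal_re, Complex.ofReal_im, Complex.re_ofReal_mul, Complex.im_ofReal_mul, Complex.I_re, Complex.I_im, mul_zero, mul_one, add_zero, zero_add]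
    rw [hid _ (by rw [abs_div]; norm_num; linarith), hid _ (by rw [abs_div]; norm_num; linarith), ← hMμ w (by simpa using hw.le)]
    congr 1
    conv_rhs => rw [← Complex.re_add_im w]
    push_cast; ring

lemma montel {U : Set ℂ} (hU : IsOpen U) {F : ℕ → ℂ → ℂ} (hd : ∀ n, DifferentiableOn ℂ (F n) U)
    (hF : ∀ n, Set.MapsTo (F n) U (Metric.ball 0 1)) :
    ∃ H : ℂ → ℂ, TendstoLocallyUniformlyOn F H (Filter.hyperfilter ℕ : Filter ℕ) U ∧
      Set.MapsTo H U (Metric.closedBall 0 1) := by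
  have hex : ∀ z, ∃ w, z ∈ U → w ∈ Metric.closedBall (0 : ℂ) 1 ∧
      Filter.Tendsto (fun n => F n z) (Filter.hyperfilter ℕ : Filter ℕ) (𝓝 w) := by
    intro z
    by_cases hz : z ∈ U
    · obtain ⟨w, hw1, hw2⟩ := (isCompact_closedBall (0 : ℂ) 1).ultrafilter_le_nhds
        ((Filter.hyperfilter ℕ).map (fun n => F n z)) (by
          rw [Filter.le_principal_iff]
          rw [Ultrafilter.mem_coe, Ultrafilter.mem_map]
          exact Filter.Eventually.of_forall (f := ((Filter.hyperfilter ℕ : Ultrafilter ℕ) : Filter ℕ))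
            (fun n => Metric.ball_subset_closedBall (hF n hz)))
      exact ⟨w, fun _ => ⟨hw1, hw2⟩⟩
    · exact ⟨0, fun h => absurd h hz⟩
  choose H hH using hex
  refine ⟨H, ?_, fun z hz => (hH z hz).1⟩
  rw [Metric.tendstoLocallyUniformlyOn_iff]
  intro ε hε x hx
  obtain ⟨r, hr, hrU⟩ := Metric.isOpen_iff.1 hU x hx
  have hlip : ∀ n, ∀ y ∈ Metric.ball x r, dist (F n y) (F n x) ≤ 2 / r * dist y x := by
    intro n y hy
    refine Complex.dist_le_div_mul_dist_of_mapsTo_ball ((hd n).mono hrU) (fun z hz => ?_) hy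
    have h1 := hF n (hrU hz)
    have h2 := hF n hx
    rw [mem_ball_zero_iff] at h1 h2
    rw [Metric.mem_closedBall, dist_eq_norm]
    exact (norm_sub_le _ _).trans (by linarith)
  have hlipH : ∀ y ∈ Metric.ball x r, dist (H y) (H x) ≤ 2 / r * dist y x := by
    intro y hy
    exact le_of_tendsto ((hH y (hrU hy)).2.dist (hH x hx).2) (Filter.Eventually.of_forall fun n => hlip n y hy)
  refine ⟨Metric.ball x (min r (r / 2 * (ε / 3))), mem_nhdsWithin_of_mem_nhds (Metric.ball_mem_nhds _ (by positivity)), ?_⟩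
  filter_upwards [Metric.tendsto_nhds.1 (hH x hx).2 (ε / 3) (by positivity)] with n hn y hy
  have hy1 : y ∈ Metric.ball x r := Metric.ball_subset_ball (min_le_left _ _) hy
  have hy2 : dist y x < r / 2 * (ε / 3) := lt_of_lt_of_le hy (min_le_right _ _)
  have h3 : 2 / r * dist y x < ε / 3 := by
    calc 2 / r * dist y x < 2 / r * (r / 2 * (ε / 3)) := by gcongr
      _ = ε / 3 := by field_simp
  have h1 := hlip n y hy1
  have h2 := hlipH y hy1
  have t1 := dist_triangle (H y) (H x) (F n y)
  have t2 := dist_triangle (H x) (F n x) (F n y)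
  rw [dist_comm (F n x) (F n y)] at t2
  rw [dist_comm (H x) (F n x)] at t2
  linarith

lemma hurwitz {U : Set ℂ} (hU : IsOpen U) {φ : Filter ℕ} [φ.NeBot] {F : ℕ → ℂ → ℂ} {H : ℂ → ℂ}
    (hlim : TendstoLocallyUniformlyOn F H φ U) (hd : ∀ n, DifferentiableOn ℂ (F n) U)
    (hne : ∀ n, ∀ z ∈ U, F n z ≠ 0) {b : ℂ} (hb : b ∈ U) (hHb : H b = 0) : ∀ᶠ z in 𝓝 b, H z = 0 := by
  have hHd : DifferentiableOn ℂ H U := hlim.differentiableOn (Filter.Eventually.of_forall hd) hU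
  have han : AnalyticAt ℂ H b := hHd.analyticAt (hU.mem_nhds hb)
  refine han.eventually_eq_zero_or_eventually_ne_zero.resolve_right (fun hcon => ?_)
  rw [eventually_nhdsWithin_iff] at hcon
  obtain ⟨r, hr, hrs⟩ := Metric.nhds_basis_closedBall.mem_iff.1 (Filter.inter_mem hcon (hU.mem_nhds hb))
  have hrU : Metric.closedBall b r ⊆ U := fun z hz => (hrs hz).2
  have hsph : ∀ z ∈ Metric.sphere b r, H z ≠ 0 := fun z hz =>
    (hrs (Metric.sphere_subset_closedBall hz)).1 (by
      rintro rfl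
      simp at hz; linarith)
  obtain ⟨w, hw, hwm⟩ := (isCompact_sphere b r).exists_isMinOn (NormedSpace.sphere_nonempty.2 hr.le)
    ((hHd.continuousOn.mono (Metric.sphere_subset_closedBall.trans hrU)).norm)
  have hδ : 0 < ‖H w‖ := norm_pos_iff.2 (hsph w hw)
  have hunif := (tendstoLocallyUniformlyOn_iff_forall_isCompact hU).1 hlim _ hrU (isCompact_closedBall b r)
  obtain ⟨n, hn⟩ := (Metric.tendstoUniformlyOn_iff.1 hunif (‖H w‖ / 2) (by positivity)).exists
  have h1 : ‖(F n b)⁻¹‖ ≤ (‖H w‖ / 2)⁻¹ := by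
    refine Complex.norm_le_of_forall_mem_frontier_norm_le (f := fun z => (F n z)⁻¹) (U := Metric.ball b r)
      Metric.isBounded_ball ?_ ?_ (subset_closure (Metric.mem_ball_self hr))
    · refine (DifferentiableOn.mono (t := U) ?_ ?_).diffContOnCl
      · exact (hd n).inv (hne n)
      · rw [closure_ball b hr.ne']; exact hrU
    · rw [frontier_ball b hr.ne']
      intro z hz
      rw [norm_inv]
      apply inv_anti₀ (by positivity)
      have h2 := hn z (Metric.sphere_subset_closedBall hz)
      have h3 : ‖H w‖ ≤ ‖H z‖ := hwm hz
      rw [dist_eq_norm] at h2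
      have h4 := norm_sub_norm_le (H z) (F n z)
      linarith
  have h2 := hn b (Metric.mem_closedBall_self hr.le)
  rw [hHb, dist_zero_left] at h2
  rw [norm_inv] at h1
  have h3 := (inv_le_inv₀ (norm_pos_iff.2 (hne n b hb)) (by positivity)).1 h1
  linarith

noncomputable def bl (a z : ℂ) : ℂ := (z - a) / (1 - (starRingEnd ℂ) a * z)

lemma bl_den {a z : ℂ} (ha : ‖a‖ < 1) (hz : ‖z‖ < 1) : 1 - (starRingEnd ℂ) a * z ≠ 0 := by
  intro h
  have h1 : ‖(starRingEnd ℂ) a * z‖ = 1 := by rw [← sub_eq_zero.1 h]; simp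
  rw [norm_mul, RCLike.norm_conj] at h1
  nlinarith [norm_nonneg a, norm_nonneg z]

lemma bl_norm {a z : ℂ} (ha : ‖a‖ < 1) (hz : ‖z‖ < 1) : ‖bl a z‖ < 1 := by
  rw [bl, norm_div, div_lt_one (norm_pos_iff.2 (bl_den ha hz))]
  apply lt_of_pow_lt_pow_left₀ 2 (norm_nonneg _)
  have h1 : ‖a‖ ^ 2 < 1 := by nlinarith [norm_nonneg a]
  have h2 : ‖z‖ ^ 2 < 1 := by nlinarith [norm_nonneg z]
  rw [Complex.sq_norm, Complex.normSq_apply] at h1 h2 ⊢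
  rw [Complex.sq_norm, Complex.normSq_apply]
  simp
  nlinarith [mul_pos (sub_pos.2 h1) (sub_pos.2 h2)]

lemma bl_inj {a z w : ℂ} (ha : ‖a‖ < 1) (hz : ‖z‖ < 1) (hw : ‖w‖ < 1) (h : bl a z = bl a w) : z = w := by
  rw [bl, bl, div_eq_div_iff (bl_den ha hz) (bl_den ha hw)] at h
  have h1 : (z - w) * (1 - (starRingEnd ℂ) a * a) = 0 := by linear_combination h
  exact sub_eq_zero.1 ((mul_eq_zero.1 h1).resolve_right (bl_den ha ha))

lemma bl_deriv {a z : ℂ} (ha : ‖a‖ < 1) (hz : ‖z‖ < 1) :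
    HasDerivAt (bl a) ((1 - (starRingEnd ℂ) a * a) / (1 - (starRingEnd ℂ) a * z) ^ 2) z := by
  have h1 : HasDerivAt (fun z => z - a) 1 z := (hasDerivAt_id z).sub_const a
  have h2 : HasDerivAt (fun z => 1 - (starRingEnd ℂ) a * z) (-((starRingEnd ℂ) a * 1)) z :=
    ((hasDerivAt_id z).const_mul _).const_sub 1
  refine (h1.div h2 (bl_den ha hz)).congr_deriv ?_
  congr 1; ring

structure Fam (U : Set ℂ) (z0 : ℂ) (h : ℂ → ℂ) : Prop where
  inj : Set.InjOn h U
  maps : Set.MapsTo h U (Metric.ball 0 1)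
  zero : h z0 = 0
  der : ∀ z ∈ U, deriv h z ≠ 0

lemma Fam.diff {U : Set ℂ} {z0 : ℂ} {h : ℂ → ℂ} (H : Fam U z0 h) : DifferentiableOn ℂ h U :=
  fun z hz => (differentiableAt_of_deriv_ne_zero (H.der z hz)).differentiableWithinAt

lemma sqrt_deriv {U : Set ℂ} (hU : IsOpen U) {q k : ℂ → ℂ} (hq : ContinuousOn q U) (hqk : ∀ z, q z ^ 2 = k z)
    {a k' : ℂ} (ha : a ∈ U) (hk : HasDerivAt k k' a) (hqa : q a ≠ 0) : HasDerivAt q (k' / (2 * q a)) a := by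
  have hc : ContinuousAt q a := hq.continuousAt (hU.mem_nhds ha)
  rw [hasDerivAt_iff_tendsto_slope] at hk ⊢
  have h1 : Filter.Tendsto (fun z => q z + q a) (𝓝[≠] a) (𝓝 (2 * q a)) := by
    rw [two_mul]
    exact (hc.tendsto.mono_left nhdsWithin_le_nhds).add tendsto_const_nhds
  have h2 : 2 * q a ≠ 0 := mul_ne_zero two_ne_zero hqa
  refine (hk.div h1 h2).congr' ?_
  filter_upwards [h1.eventually_ne h2] with z hz
  simp only [Pi.div_apply]
  rw [div_eq_iff hz, slope_def_field, slope_def_field, ← hqk, ← hqk]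
  ring

lemma koebe {U : Set ℂ} (hU : IsOpen U) (hs : IsSimplyConnected U) {z0 : ℂ} (hz0 : z0 ∈ U) {h : ℂ → ℂ}
    (H : Fam U z0 h) {w : ℂ} (hw : ‖w‖ < 1) (hwU : ∀ z ∈ U, h z ≠ w) :
    ∃ h2, Fam U z0 h2 ∧ ‖deriv h z0‖ < ‖deriv h2 z0‖ := by
  have hn : ∀ z ∈ U, ‖h z‖ < 1 := fun z hz => mem_ball_zero_iff.1 (H.maps hz)
  have hhd : ∀ z ∈ U, HasDerivAt h (deriv h z) z := fun z hz =>
    (differentiableAt_of_deriv_ne_zero (H.der z hz)).hasDerivAt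
  have hkd : ∀ z ∈ U, HasDerivAt (fun z => bl w (h z)) ((1 - (starRingEnd ℂ) w * w) / (1 - (starRingEnd ℂ) w * h z) ^ 2 * deriv h z) z :=
    fun z hz => (bl_deriv hw (hn z hz)).comp z (hhd z hz)
  have hk0 : ∀ z ∈ U, bl w (h z) ≠ 0 := fun z hz =>
    div_ne_zero (sub_ne_zero.2 (hwU z hz)) (bl_den hw (hn z hz))
  obtain ⟨q, hqc, hqk⟩ := Complex.exists_continuousOn_pow_eq hs hU (g := fun z => bl w (h z))
    (fun z hz => (hkd z hz).continuousAt.continuousWithinAt) (by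
      rintro ⟨z, hz, h0⟩; exact hk0 z hz h0) two_ne_zero
  have hq0 : ∀ z ∈ U, q z ≠ 0 := fun z hz h0 => hk0 z hz (by rw [← hqk, h0]; simp)
  have hqn : ∀ z ∈ U, ‖q z‖ < 1 := fun z hz => by
    have := bl_norm hw (hn z hz)
    rw [← hqk, norm_pow] at this
    exact (sq_lt_one_iff₀ (norm_nonneg _)).1 this
  have hqd := fun z hz => sqrt_deriv hU hqc hqk hz (hkd z hz) (hq0 z hz)
  have hQ := hqn z0 hz0
  have hgd : ∀ z ∈ U, HasDerivAt (fun z => bl (q z0) (q z)) _ z := fun z hz =>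
    (bl_deriv hQ (hqn z hz)).comp z (hqd z hz)
  refine ⟨fun z => bl (q z0) (q z), ⟨?_, ?_, ?_, ?_⟩, ?_⟩
  · intro x hx y hy hxy
    have h1 := bl_inj hQ (hqn x hx) (hqn y hy) hxy
    have h2 : bl w (h x) = bl w (h y) := by rw [← hqk, ← hqk, h1]
    exact H.inj hx hy (bl_inj hw (hn x hx) (hn y hy) h2)
  · intro x hx
    rw [mem_ball_zero_iff]
    exact bl_norm hQ (hqn x hx)
  · simp [bl]
  · intro z hz
    rw [(hgd z hz).deriv]
    exact mul_ne_zero (div_ne_zero (bl_den hQ hQ) (pow_ne_zero 2 (bl_den hQ (hqn z hz))))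
      (div_ne_zero (mul_ne_zero (div_ne_zero (bl_den hw hw) (pow_ne_zero 2 (bl_den hw (hn z hz)))) (H.der z hz))
        (mul_ne_zero two_ne_zero (hq0 z hz)))
  · rw [(hgd z0 hz0).deriv]
    have hQw : q z0 ^ 2 = -w := by rw [hqk, H.zero]; simp [bl]
    have hQ0 : 0 < ‖q z0‖ := norm_pos_iff.2 (hq0 z0 hz0)
    have hwn : ‖w‖ = ‖q z0‖ ^ 2 := by rw [← norm_neg, ← hQw, norm_pow]
    have hnn : ∀ a : ℂ, (1 - (starRingEnd ℂ) a * a) = ((1 - ‖a‖ ^ 2 : ℝ) : ℂ) := fun a => by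
      rw [← Complex.normSq_eq_conj_mul_self, Complex.normSq_eq_norm_sq]; push_cast; rfl
    have hD := norm_pos_iff.2 (H.der z0 hz0)
    rw [H.zero, hnn, hnn, hwn]
    simp only [norm_mul, norm_div, norm_pow, Complex.norm_real, Real.norm_eq_abs, mul_zero, sub_zero, one_pow,
      div_one, Complex.norm_ofNat]
    generalize ‖deriv h z0‖ = D at *
    generalize ‖q z0‖ = t at *
    have ht2 : t ^ 2 < 1 := by nlinarith
    rw [abs_of_pos (by linarith : 0 < 1 - t ^ 2), abs_of_pos (by nlinarith [sq_nonneg t] : 0 < 1 - (t ^ 2) ^ 2)]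
    have e : (1 - t ^ 2) / (1 - t ^ 2) ^ 2 * ((1 - (t ^ 2) ^ 2) * D / (2 * t)) = D * ((1 + t ^ 2) / (2 * t)) := by
      have : 1 - t ^ 2 ≠ 0 := by linarith
      field_simp
      ring
    rw [e]
    refine lt_mul_of_one_lt_right hD ?_
    rw [one_lt_div (by positivity)]
    nlinarith [sq_pos_of_pos (sub_pos.2 hQ)]

theorem rmt {U : Set ℂ} (hU : IsOpen U) (hs : IsSimplyConnected U) (hbdd : Bornology.IsBounded U) :
    ∃ h : ℂ → ℂ, Set.BijOn h U (Metric.ball 0 1) ∧ ∀ z ∈ U, deriv h z ≠ 0 := by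
  obtain ⟨z0, hz0⟩ := hs.nonempty
  obtain ⟨R, hR, hUR⟩ := hbdd.subset_ball_lt 0 z0
  have hne : Fam U z0 (fun z => (z - z0) / R) := by
    have hR' : (R : ℂ) ≠ 0 := by exact_mod_cast hR.ne'
    have hd : ∀ z, HasDerivAt (fun z => (z - z0) / (R : ℂ)) (1 / R) z := fun z => ((hasDerivAt_id z).sub_const z0).div_const _
    refine ⟨?_, ?_, by simp, fun z _ => by rw [(hd z).deriv]; simp [hR']⟩
    · intro x _ y _ hxy
      simpa [hR'] using hxy
    · intro x hx
      have := hUR hx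
      rw [Metric.mem_ball, dist_eq_norm] at this
      rw [mem_ball_zero_iff, norm_div, Complex.norm_real, Real.norm_of_nonneg hR.le, div_lt_one hR]
      exact this
  obtain ⟨r, hr, hrU⟩ := Metric.isOpen_iff.1 hU z0 hz0
  let S : Set ℝ := {x | ∃ h, Fam U z0 h ∧ ‖deriv h z0‖ = x}
  have hSne : S.Nonempty := ⟨_, _, hne, rfl⟩
  have hSb : BddAbove S := by
    refine ⟨1 / r, ?_⟩
    rintro _ ⟨h, H, rfl⟩
    refine Complex.norm_deriv_le_div_of_mapsTo_ball (H.diff.mono hrU) (fun z hz => ?_) hr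
    rw [H.zero]
    exact Metric.ball_subset_closedBall (H.maps (hrU hz))
  obtain ⟨u, -, hu, huS⟩ := exists_seq_tendsto_sSup hSne hSb
  choose F hF hFu using huS
  obtain ⟨H, hlim, hHm⟩ := montel hU (fun n => (hF n).diff) (fun n => (hF n).maps)
  have hev : ∀ᶠ n in (Filter.hyperfilter ℕ : Filter ℕ), DifferentiableOn ℂ (F n) U :=
    Filter.Eventually.of_forall (fun n => (hF n).diff)
  have hHd : DifferentiableOn ℂ H U := hlim.differentiableOn hev hU
  have hlimd := hlim.deriv hev hU
  have hat : ∀ z ∈ U, Filter.Tendsto (fun n => F n z) (Filter.hyperfilter ℕ : Filter ℕ) (𝓝 (H z)) :=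
    fun z hz => hlim.tendsto_at hz
  have hdz : ‖deriv H z0‖ = sSup S := by
    have h1 := (hlimd.tendsto_at hz0).norm
    have h2 := hu.mono_left Nat.hyperfilter_le_atTop
    refine tendsto_nhds_unique h1 ?_
    simpa only [Function.comp, hFu] using h2
  have hpos : 0 < sSup S := lt_of_lt_of_le (norm_pos_iff.2 (hne.der z0 hz0)) (le_csSup hSb ⟨_, hne, rfl⟩)
  have hder : ∀ z ∈ U, deriv H z ≠ 0 := by
    intro z hz h0
    have h1 := hurwitz hU hlimd (fun n => (hF n).diff.deriv hU) (fun n => (hF n).der) hz h0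
    have h2 := ((hHd.deriv hU).analyticOnNhd hU).eqOn_zero_of_preconnected_of_eventuallyEq_zero
      hs.isPathConnected.isConnected.isPreconnected hz h1 hz0
    rw [h2] at hdz
    simp at hdz
    linarith
  have hinj : Set.InjOn H U := by
    intro a ha b hb hab
    by_contra hne'
    have hUo : IsOpen (U \ {a}) := hU.sdiff isClosed_singleton
    have hl : TendstoLocallyUniformlyOn (fun n z => F n z - F n a) (fun z => H z - H a) (Filter.hyperfilter ℕ : Filter ℕ) (U \ {a}) := by
      have h1 : TendstoLocallyUniformlyOn (fun n (_ : ℂ) => F n a) (fun _ => H a) (Filter.hyperfilter ℕ : Filter ℕ) (U \ {a}) := by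
        refine TendstoUniformlyOn.tendstoLocallyUniformlyOn ?_
        rw [Metric.tendstoUniformlyOn_iff]
        intro ε hε
        filter_upwards [Metric.tendsto_nhds.1 (hat a ha) ε hε] with n hn x _
        rwa [dist_comm]
      exact (hlim.mono Set.sdiff_subset).sub h1
    have h2 := hurwitz hUo hl (fun n => ((hF n).diff.mono Set.sdiff_subset).sub_const _) (by
      intro n z hz h0
      exact hz.2 ((hF n).inj hz.1 ha (sub_eq_zero.1 h0))) ⟨hb, fun h => hne' (by rw [h])⟩ (by rw [hab, sub_self])
    refine hder b hb ?_
    have h3 : H =ᶠ[𝓝 b] fun _ => H a := by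
      filter_upwards [h2] with z hz
      exact sub_eq_zero.1 hz
    rw [h3.deriv_eq]; simp
  have hmaps : Set.MapsTo H U (Metric.ball 0 1) := by
    intro z hz
    have han : AnalyticAt ℂ H z := hHd.analyticAt (hU.mem_nhds hz)
    have h1 := han.hasStrictDerivAt.map_nhds_eq (hder z hz)
    rw [← interior_closedBall (0 : ℂ) one_ne_zero, mem_interior_iff_mem_nhds, ← h1, Filter.mem_map]
    filter_upwards [hU.mem_nhds hz] with x hx
    exact hHm hx
  have hFam : Fam U z0 H := ⟨hinj, hmaps, by
    refine tendsto_nhds_unique (hat z0 hz0) ?_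
    simp only [fun n => (hF n).zero]
    exact tendsto_const_nhds, hder⟩
  refine ⟨H, ⟨hmaps, hinj, ?_⟩, hder⟩
  intro w hw
  by_contra hcon
  obtain ⟨h2, hf2, hlt⟩ := koebe hU hs hz0 hFam (mem_ball_zero_iff.1 hw) (fun z hz h => hcon ⟨z, hz, h⟩)
  rw [hdz] at hlt
  exact absurd (le_csSup hSb ⟨h2, hf2, rfl⟩) (not_le.2 hlt)

lemma wderiv_affine {f : ℂ → ℂ} {p w : ℂ} (hf : DifferentiableAt ℝ f (p + w / 12)) :
    wderiv (fun w => f (p + w / 12)) w = wderiv f (p + w / 12) / 12 ∧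
    wderivBar (fun w => f (p + w / 12)) w = wderivBar f (p + w / 12) / 12 := by
  have h1 : HasFDerivAt (fun w : ℂ => p + w / 12) ((1 / 12 : ℝ) • ContinuousLinearMap.id ℝ ℂ) w := by
    have : (fun w : ℂ => p + w / 12) = fun w => p + (1 / 12 : ℝ) • w := by
      funext w; rw [Complex.real_smul]; push_cast; ring
    rw [this]
    exact ((hasFDerivAt_id w).const_smul (1 / 12 : ℝ)).const_add p
  have h2 : fderiv ℝ (fun w => f (p + w / 12)) w = (fderiv ℝ f (p + w / 12)).comp ((1 / 12 : ℝ) • ContinuousLinearMap.id ℝ ℂ) :=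
    (hf.hasFDerivAt.comp w h1).fderiv
  have h3 : ∀ v, fderiv ℝ (fun w => f (p + w / 12)) w v = fderiv ℝ f (p + w / 12) v / 12 := by
    intro v
    rw [h2, ContinuousLinearMap.comp_apply, smul_apply, map_smul, Complex.real_smul]
    push_cast [id_eq]
    ring
  constructor
  · rw [wderiv, wderiv, h3, h3]; ring
  · rw [wderivBar, wderivBar, h3, h3]; ring

lemma inv_smooth {Φ g : ℂ → ℂ} {D E : Set ℂ} (hD : IsOpen D)
    (hΦ : ∀ z ∈ D, ContDiffAt ℝ (⊤ : ℕ∞) Φ z) (hb : Set.BijOn Φ D E) (hg : Set.InvOn g Φ D E)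
    (hd : ∀ z ∈ D, ∃ e : ℂ ≃L[ℝ] ℂ, (e : ℂ →L[ℝ] ℂ) = fderiv ℝ Φ z) : ContDiffOn ℝ (⊤ : ℕ∞) g E := by
  intro y hy
  obtain ⟨x, hx, rfl⟩ := hb.surjOn hy
  obtain ⟨e, he⟩ := hd x hx
  have hdx : HasFDerivAt Φ (e : ℂ →L[ℝ] ℂ) x := by
    rw [he]; exact ((hΦ x hx).differentiableAt (by simp)).hasFDerivAt
  have hli := (hΦ x hx).to_localInverse hdx (by simp)
  refine ContDiffAt.contDiffWithinAt (hli.congr_of_eventuallyEq ?_)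
  let P := (hΦ x hx).toOpenPartialHomeomorph Φ hdx (by simp)
  have hxs : x ∈ P.source := ContDiffAt.mem_toOpenPartialHomeomorph_source _ _ _
  have hcoe : ∀ z, P z = Φ z := fun z => rfl
  have hyt : Φ x ∈ P.target := P.map_source hxs
  have hsx : P.symm (Φ x) = x := P.left_inv hxs
  have hc : ContinuousAt P.symm (Φ x) := P.continuousAt_symm hyt
  have h1 : ∀ᶠ y in 𝓝 (Φ x), P.symm y ∈ D := hc.eventually (by rw [hsx]; exact hD.mem_nhds hx)
  filter_upwards [h1, P.open_target.mem_nhds hyt] with y hy1 hy2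
  have h2 : Φ (P.symm y) = y := P.right_inv hy2
  have h3 := hg.1 hy1
  rw [h2] at h3
  exact h3

/-- **Integrability of smooth almost complex structures on the disc.**
If `μ` is `C^∞` on an open neighborhood `V` of the closed unit disc with
`sup_V |μ| < 1`, then there is a `C^∞` diffeomorphism `Φ` of the open unit disc
onto itself with `∂Φ/∂z̄ = μ ∂Φ/∂z` and `∂Φ/∂z ≠ 0` everywhere on the disc. -/
theorem disc_uniformization
    (V : Set ℂ) (hV : IsOpen V) (hDV : Metric.closedBall (0:ℂ) 1 ⊆ V)
    (μ : ℂ → ℂ) (hμ : ContDiffOn ℝ (⊤ : ℕ∞) μ V)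
    (k : ℝ) (hk : k < 1) (hbound : ∀ z ∈ V, ‖μ z‖ ≤ k) :
    ∃ Φ g : ℂ → ℂ,
      ContDiffOn ℝ (⊤ : ℕ∞) Φ (Metric.ball (0:ℂ) 1) ∧
      ContDiffOn ℝ (⊤ : ℕ∞) g (Metric.ball (0:ℂ) 1) ∧
      Set.BijOn Φ (Metric.ball (0:ℂ) 1) (Metric.ball (0:ℂ) 1) ∧
      Set.InvOn g Φ (Metric.ball (0:ℂ) 1) (Metric.ball (0:ℂ) 1) ∧
      ∀ z ∈ Metric.ball (0:ℂ) 1, wderivBar Φ z = μ z * wderiv Φ z ∧ wderiv Φ z ≠ 0 := by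
  obtain ⟨m, p, hm, hm1, hev, hmμ⟩ := exists_mu hV hDV hμ hk hbound
  obtain ⟨f, hf, hfb, A, B, K, hAB, hK⟩ := exists_f m hm hm1 hev
  have hemb : IsOpenEmbedding f :=
    f_emb hf (fun z => lt_of_le_of_lt (m.norm_coe_le_norm (pr z)) hm1) hfb hAB hK
  have haff : Set.BijOn (fun w : ℂ => p + w / 12) (Metric.ball 0 1) (Metric.ball p (1 / 12)) := by
    refine ⟨?_, ?_, ?_⟩
    · intro w hw
      rw [mem_ball_zero_iff] at hw
      rw [mem_ball_iff_norm, add_sub_cancel_left, norm_div]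
      norm_num; linarith
    · intro x _ y _ hxy
      simpa using hxy
    · intro y hy
      rw [mem_ball_iff_norm] at hy
      refine ⟨12 * (y - p), ?_, ?_⟩
      · rw [mem_ball_zero_iff, norm_mul]
        norm_num; linarith
      · simp
  have hUo : IsOpen (f '' Metric.ball p (1 / 12)) := hemb.isOpenMap _ Metric.isOpen_ball
  have hUs : IsSimplyConnected (f '' Metric.ball p (1 / 12)) := by
    rw [hemb.isEmbedding.isSimplyConnected_image]
    have : ContractibleSpace (Metric.ball p (1 / 12)) :=
      (convex_ball p (1 / 12)).contractibleSpace (Metric.nonempty_ball.2 (by norm_num))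
    exact (inferInstance : SimplyConnectedSpace (Metric.ball p (1 / 12)))
  have hUb : Bornology.IsBounded (f '' Metric.ball p (1 / 12)) :=
    ((isCompact_closedBall p (1 / 12)).image hf.continuous).isBounded.subset (Set.image_mono Metric.ball_subset_closedBall)
  obtain ⟨h, hbij, hder⟩ := rmt hUo hUs hUb
  have hhd : DifferentiableOn ℂ h (f '' Metric.ball p (1 / 12)) := fun z hz =>
    (differentiableAt_of_deriv_ne_zero (hder z hz)).differentiableWithinAt
  have hmem : ∀ w ∈ Metric.ball (0 : ℂ) 1, f (p + w / 12) ∈ f '' Metric.ball p (1 / 12) :=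
    fun w hw => ⟨_, haff.mapsTo hw, rfl⟩
  have hF : ContDiff ℝ (⊤ : ℕ∞) (fun w : ℂ => f (p + w / 12)) :=
    hf.comp (contDiff_const.add (contDiff_id.div_const _))
  have hB : Set.BijOn (fun w => h (f (p + w / 12))) (Metric.ball (0 : ℂ) 1) (Metric.ball 0 1) :=
    hbij.comp ((hemb.injective.injOn.bijOn_image).comp haff)
  have hΦ : ∀ w ∈ Metric.ball (0 : ℂ) 1, ContDiffAt ℝ (⊤ : ℕ∞) (fun w => h (f (p + w / 12))) w := by
    intro w hw
    have han : AnalyticAt ℂ h (f (p + w / 12)) := hhd.analyticAt (hUo.mem_nhds (hmem w hw))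
    have h1 : ContDiffAt ℝ (⊤ : ℕ∞) h (f (p + w / 12)) := (han.contDiffAt (n := (⊤ : ℕ∞))).restrict_scalars ℝ
    exact ContDiffAt.comp w h1 hF.contDiffAt
  have hW : ∀ w ∈ Metric.ball (0 : ℂ) 1, wderivBar (fun w => h (f (p + w / 12))) w = μ w * wderiv (fun w => h (f (p + w / 12))) w ∧
      wderiv (fun w => h (f (p + w / 12))) w ≠ 0 := by
    intro w hw
    have hd := (differentiableAt_of_deriv_ne_zero (hder _ (hmem w hw))).hasDerivAt
    have hFd : DifferentiableAt ℝ (fun w : ℂ => f (p + w / 12)) w := hF.differentiable (by simp) w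
    obtain ⟨h1, h2⟩ := wderiv_affine (p := p) (w := w) (hf.differentiable (by simp) _)
    rw [wderiv_holo_comp (f := fun w => f (p + w / 12)) hd hFd, wderivBar_holo_comp (f := fun w => f (p + w / 12)) hd hFd, h1, h2, (hfb _).1, hmμ w hw]
    refine ⟨by ring, mul_ne_zero (hder _ (hmem w hw)) (div_ne_zero (hfb _).2 (by norm_num))⟩
  have hinv : Set.InvOn (Function.invFunOn (fun w => h (f (p + w / 12))) (Metric.ball (0 : ℂ) 1))
    (fun w => h (f (p + w / 12))) (Metric.ball (0 : ℂ) 1) (Metric.ball 0 1) := hB.invOn_invFunOn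
  refine ⟨fun w => h (f (p + w / 12)), Function.invFunOn (fun w => h (f (p + w / 12))) (Metric.ball (0 : ℂ) 1),
    fun w hw => (hΦ w hw).contDiffWithinAt, ?_, hB, hinv, hW⟩
  refine inv_smooth Metric.isOpen_ball hΦ hB hinv (fun w hw => ?_)
  exact exists_fderiv_equiv (lt_of_le_of_lt (hbound w (hDV (Metric.ball_subset_closedBall hw))) hk) (hW w hw).1 (hW w hw).2
end

section
/- Let U ⊆ ℂ be a domain, K ≥ 1, k = (K−1)/(K+1). Let Φ_n : U → ℂ be orientation-preserving injective C¹ maps with nonvanishing differential satisfying |∂Φ_n/∂z̄| ≤ k·|∂Φ_n/∂z| everywhere, converging uniformly on compact subsets of U to a homeomorphism Φ : U → Φ(U). Let μ_n = (∂Φ_n/∂z̄)/(∂Φ_n/∂z) and suppose μ_n converges almost everywhere on U to a measurable function μ. Then Φ has locally L² distributional derivatives and satisfies ∂Φ/∂z̄ = μ·∂Φ/∂z almost everywhere on U. -/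
open MeasureTheory

/-- `g` is locally square-integrable on `U`. -/
def LocallyL2On (U : Set ℂ) (g : ℂ → ℂ) : Prop :=
  ∀ K : Set ℂ, K ⊆ U → IsCompact K → IntegrableOn (fun z => ‖g z‖ ^ 2) K volume

/-- `Φ` has locally `L²` distributional derivatives `g` (in direction `1`) and `h`
(in direction `i`) on the open set `U`: for every `C^∞` compactly supported test
function `φ` with support in `U`, `∫ Φ ∂φ/∂x = −∫ g φ` and `∫ Φ ∂φ/∂y = −∫ h φ`.
The distributional Wirtinger derivatives are then `∂Φ/∂z = (g − i h)/2` and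
`∂Φ/∂z̄ = (g + i h)/2`. -/
def HasWeakDerivsOn (U : Set ℂ) (Φ g h : ℂ → ℂ) : Prop :=
  LocallyL2On U g ∧ LocallyL2On U h ∧
    ∀ φ : ℂ → ℂ, ContDiff ℝ (⊤ : ℕ∞) φ → HasCompactSupport φ → tsupport φ ⊆ U →
      ((∫ z in U, Φ z * fderiv ℝ φ z 1 ∂volume) = -∫ z in U, g z * φ z ∂volume) ∧
      ((∫ z in U, Φ z * fderiv ℝ φ z Complex.I ∂volume) = -∫ z in U, h z * φ z ∂volume)

open scoped ENNReal NNReal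

theorem aux_weak {H : Type*} [NormedAddCommGroup H] [InnerProductSpace ℂ H] [CompleteSpace H]
    (x : ℕ → H) (R : ℝ) (hx : ∀ n, ‖x n‖ ≤ R) :
    ∃ y : H, ∀ v : H, Filter.Tendsto (fun n => inner ℂ v (x n))
      (Filter.hyperfilter ℕ : Filter ℕ) (nhds (inner ℂ v y)) := by
  have hc := WeakDual.isCompact_closedBall (𝕜 := ℂ) (E := H) 0 R
  let ℓ : ℕ → WeakDual ℂ H := fun n =>
    WeakDual.toStrongDual.symm (InnerProductSpace.toDual ℂ H (x n))
  obtain ⟨L, -, hL⟩ := hc.ultrafilter_le_nhds ((Filter.hyperfilter ℕ).map ℓ) (by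
    rw [Filter.le_principal_iff]
    change ∀ᶠ n in (Filter.hyperfilter ℕ : Filter ℕ), ℓ n ∈ _
    refine Filter.Eventually.of_forall fun n => ?_
    simp [ℓ, hx n])
  refine ⟨(InnerProductSpace.toDual ℂ H).symm (WeakDual.toStrongDual L), fun v => ?_⟩
  have h1 : Filter.Tendsto (fun n => ℓ n v) (Filter.hyperfilter ℕ : Filter ℕ) (nhds (L v)) :=
    ((WeakDual.eval_continuous v).tendsto L).comp hL
  have h2 := (Complex.continuous_conj.tendsto _).comp h1
  have h3 : ∀ n, ℓ n v = inner ℂ (x n) v := fun n => rfl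
  have h4 : L v = inner ℂ ((InnerProductSpace.toDual ℂ H).symm (WeakDual.toStrongDual L)) v := by
    rw [InnerProductSpace.toDual_symm_apply]; rfl
  rw [h4] at h2
  rw [inner_conj_symm] at h2
  refine h2.congr fun n => ?_
  simp only [Function.comp_apply, h3, inner_conj_symm]

theorem aux_eLpNorm (f : ℂ → ℂ) (μ : Measure ℂ) :
    eLpNorm f 2 μ ^ 2 = ∫⁻ z, ‖f z‖ₑ ^ 2 ∂μ := by
  have := eLpNorm_nnreal_pow_eq_lintegral (f := f) (μ := μ) (p := 2) (by norm_num)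
  simpa using this

theorem aux_memLp {f : ℂ → ℂ} {μ : Measure ℂ} (hf : Measurable f)
    (h : ∫⁻ z, ‖f z‖ₑ ^ 2 ∂μ < ⊤) : MemLp f 2 μ := by
  refine ⟨hf.aestronglyMeasurable, ?_⟩
  rw [← aux_eLpNorm] at h
  by_contra hh
  simp at hh
  simp [hh] at h

/-- locally bounded sequences have weak limits along the hyperfilter -/
theorem aux_loc (U : Set ℂ) (hU : IsOpen U) (F : ℕ → ℂ → ℂ) (hF : ∀ n, Measurable (F n))
    (hb : ∀ C : Set ℂ, C ⊆ U → IsCompact C →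
      ∃ M : ℝ≥0, ∀ n, ∫⁻ z in C, ‖F n z‖ₑ ^ 2 ≤ M) :
    ∃ g : ℂ → ℂ, Measurable g ∧
      (∀ C : Set ℂ, C ⊆ U → IsCompact C → ∫⁻ z in C, ‖g z‖ₑ ^ 2 < ⊤) ∧
      ∀ f : ℂ → ℂ, Measurable f → (∃ B : ℝ≥0, ∀ z, ‖f z‖ₑ ≤ B) →
        ∀ C : Set ℂ, C ⊆ U → IsCompact C → (∀ z, z ∉ C → f z = 0) →
        Filter.Tendsto (fun n => ∫ z, F n z * f z) (Filter.hyperfilter ℕ : Filter ℕ)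
          (nhds (∫ z, g z * f z)) := by
  have : LocallyCompactSpace U := hU.locallyCompactSpace
  let E : CompactExhaustion U := default
  let Kc : ℕ → Set ℂ := fun j => (Subtype.val) '' (E j)
  have hKc : ∀ j, IsCompact (Kc j) := fun j => (E.isCompact j).image continuous_subtype_val
  have hKU : ∀ j, Kc j ⊆ U := by
    rintro j _ ⟨z, -, rfl⟩; exact z.2
  have hKm : ∀ j, MeasurableSet (Kc j) := fun j => (hKc j).measurableSet
  have hKs : ∀ C : Set ℂ, C ⊆ U → IsCompact C → ∃ j, C ⊆ Kc j := by
    intro C hC hCc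
    have : IsCompact ((Subtype.val : U → ℂ) ⁻¹' C) := by
      rw [Subtype.isCompact_iff, Subtype.image_preimage_coe, Set.inter_eq_right.mpr hC]
      exact hCc
    obtain ⟨j, hj⟩ := E.exists_superset_of_isCompact this
    exact ⟨j, fun z hz => ⟨⟨z, hC hz⟩, hj hz, rfl⟩⟩
  choose M hM using fun j => hb (Kc j) (hKU j) (hKc j)
  obtain ⟨ε, hε, hεs⟩ := ENNReal.exists_pos_sum_of_countable (ε := 1) (by simp) ℕ
  let c : ℕ → ℝ≥0 := fun j => ε j / (M j + 1)
  have hc0 : ∀ j, 0 < c j := fun j => div_pos (hε j) (by positivity)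
  have hcM : ∀ j, c j * M j ≤ ε j := fun j => by
    have : c j * (M j + 1) = ε j := div_mul_cancel₀ _ (by positivity)
    rw [← this]; gcongr; simp
  have hcε : ∀ j, c j ≤ ε j := fun j => div_le_self zero_le (by simp)
  let W : ℂ → ℝ≥0∞ := fun z => ∑' j, (Kc j).indicator (fun _ => (c j : ℝ≥0∞)) z
  have hWm : Measurable W := Measurable.tsum fun j => measurable_const.indicator (hKm j)
  have hW1 : ∀ z, W z < 1 := fun z => by
    refine lt_of_le_of_lt (ENNReal.tsum_le_tsum fun j => ?_) hεs
    refine (Set.indicator_le_self _ _ _).trans ?_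
    exact ENNReal.coe_le_coe.mpr (hcε j)
  have hWl : ∀ j, ∀ z ∈ Kc j, (c j : ℝ≥0∞) ≤ W z := fun j z hz => by
    refine le_trans ?_ (ENNReal.le_tsum j)
    simp [hz]
  let w : ℂ → ℝ := fun z => Real.sqrt (W z).toReal
  have hwm : Measurable w := (hWm.ennreal_toReal).sqrt
  have hw2 : ∀ z, ‖(w z : ℂ)‖ₑ ^ 2 = W z := fun z => by
    have : ‖(w z : ℂ)‖ₑ = ENNReal.ofReal (w z) := by
      rw [← ofReal_norm, Complex.norm_real, Real.norm_of_nonneg (Real.sqrt_nonneg _)]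
    rw [this, ← ENNReal.ofReal_pow (Real.sqrt_nonneg _), Real.sq_sqrt ENNReal.toReal_nonneg,
      ENNReal.ofReal_toReal (hW1 z).ne_top]
  have hw0 : ∀ z ∈ U, (w z : ℂ) ≠ 0 := by
    intro z hz h0
    obtain ⟨j, hj⟩ := hKs {z} (by simpa using hz) isCompact_singleton
    have := hWl j z (hj rfl)
    rw [← hw2, h0] at this
    simp at this
    exact (hc0 j).ne' this
  have hGm : ∀ n, Measurable (fun z => F n z * (w z : ℂ)) := fun n => by
    have := hF n
    fun_prop
  have hGb : ∀ n, ∫⁻ z, ‖F n z * (w z : ℂ)‖ₑ ^ 2 ≤ 1 := by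
    intro n
    calc ∫⁻ z, ‖F n z * (w z : ℂ)‖ₑ ^ 2
        = ∫⁻ z, ∑' j, (Kc j).indicator (fun z => (c j : ℝ≥0∞) * ‖F n z‖ₑ ^ 2) z := by
          congr 1; ext z
          rw [enorm_mul, mul_pow, hw2, mul_comm, ← ENNReal.tsum_mul_right]
          congr 1; ext j
          by_cases h : z ∈ Kc j <;> simp [h]
      _ = ∑' j, ∫⁻ z, (Kc j).indicator (fun z => (c j : ℝ≥0∞) * ‖F n z‖ₑ ^ 2) z := by
          rw [lintegral_tsum]
          intro j
          refine Measurable.aemeasurable (Measurable.indicator ?_ (hKm j))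
          have := hF n
          fun_prop
      _ ≤ ∑' j, (ε j : ℝ≥0∞) := by
          refine ENNReal.tsum_le_tsum fun j => ?_
          rw [lintegral_indicator (hKm j), lintegral_const_mul' _ _ (by simp)]
          calc (c j : ℝ≥0∞) * _ ≤ c j * M j := by gcongr; exact hM j n
            _ ≤ ε j := by exact_mod_cast hcM j
      _ ≤ 1 := hεs.le
  have hGL : ∀ n, MemLp (fun z => F n z * (w z : ℂ)) 2 volume := fun n =>
    aux_memLp (hGm n) ((hGb n).trans_lt (by simp))
  obtain ⟨y, hy⟩ := aux_weak (fun n => (hGL n).toLp _) 1 (by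
    intro n
    rw [Lp.norm_toLp]
    refine ENNReal.toReal_le_of_le_ofReal (by simp) ?_
    have := hGb n
    rw [← aux_eLpNorm] at this
    rw [ENNReal.ofReal_one]
    exact (pow_le_one_iff two_ne_zero).mp this)
  have hym : Measurable (y : ℂ → ℂ) := (Lp.stronglyMeasurable y).measurable
  have hyL : ∫⁻ z, ‖y z‖ₑ ^ 2 < ⊤ := by
    rw [← aux_eLpNorm]
    exact ENNReal.pow_lt_top (Lp.memLp y).2
  have hinv : ∀ j, ∀ z ∈ Kc j, ‖((w z : ℂ))⁻¹‖ₑ ^ 2 ≤ ((c j)⁻¹ : ℝ≥0) := by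
    intro j z hz
    rw [enorm_inv (hw0 z (hKU j hz)), ← ENNReal.inv_pow, hw2, ENNReal.coe_inv (hc0 j).ne']
    exact ENNReal.inv_le_inv.mpr (hWl j z hz)
  refine ⟨fun z => y z * ((w z : ℂ))⁻¹, by fun_prop, ?_, ?_⟩
  · intro C hC hCc
    obtain ⟨j, hj⟩ := hKs C hC hCc
    calc ∫⁻ z in C, ‖y z * ((w z : ℂ))⁻¹‖ₑ ^ 2
        ≤ ∫⁻ z in C, ‖y z‖ₑ ^ 2 * ((c j)⁻¹ : ℝ≥0) := by
          refine setLIntegral_mono' hCc.measurableSet fun z hz => ?_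
          rw [enorm_mul, mul_pow]
          gcongr
          exact hinv j z (hj hz)
      _ ≤ ∫⁻ z, ‖y z‖ₑ ^ 2 * ((c j)⁻¹ : ℝ≥0) := setLIntegral_le_lintegral _ _
      _ < ⊤ := by
          rw [lintegral_mul_const' _ _ (by simp)]
          exact ENNReal.mul_lt_top hyL (by simp)
  · rintro f hf ⟨B, hB⟩ C hC hCc hf0
    obtain ⟨j, hj⟩ := hKs C hC hCc
    let v : ℂ → ℂ := fun z => star (f z * ((w z : ℂ))⁻¹)
    have hvm : Measurable v := by
      have : Measurable (fun z => f z * ((w z : ℂ))⁻¹) := by fun_prop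
      exact Complex.continuous_conj.measurable.comp this
    have hvL : MemLp v 2 volume := by
      refine aux_memLp hvm ?_
      calc ∫⁻ z, ‖v z‖ₑ ^ 2 ≤ ∫⁻ z, C.indicator (fun _ => (B : ℝ≥0∞) ^ 2 * ((c j)⁻¹ : ℝ≥0)) z := by
            refine lintegral_mono fun z => ?_
            by_cases hz : z ∈ C
            · simp only [hz, Set.indicator_of_mem, v]
              rw [← ofReal_norm, norm_star, ofReal_norm, enorm_mul, mul_pow]
              gcongr
              · exact hB z
              · exact hinv j z (hj hz)
            · simp [v, hz, hf0 z hz]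
        _ < ⊤ := by
            rw [lintegral_indicator hCc.measurableSet, setLIntegral_const]
            exact ENNReal.mul_lt_top (ENNReal.mul_lt_top (by simp) (by simp)) hCc.measure_lt_top
    have := hy (hvL.toLp v)
    simp only [L2.inner_def] at this
    have e1 : ∀ n, ∫ z, inner ℂ ((hvL.toLp v : ℂ → ℂ) z) (((hGL n).toLp _ : ℂ → ℂ) z)
        = ∫ z, F n z * f z := by
      intro n
      refine integral_congr_ae ?_
      filter_upwards [hvL.coeFn_toLp, (hGL n).coeFn_toLp] with z h1 h2
      rw [h1, h2]
      simp only [v, RCLike.inner_apply, RCLike.star_def, RCLike.conj_conj]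
      by_cases hz : z ∈ C
      · have := hw0 z (hC hz)
        field_simp
      · simp [hf0 z hz]
    have e2 : ∫ z, inner ℂ ((hvL.toLp v : ℂ → ℂ) z) (y z)
        = ∫ z, (y z * ((w z : ℂ))⁻¹) * f z := by
      refine integral_congr_ae ?_
      filter_upwards [hvL.coeFn_toLp] with z h1
      rw [h1]
      simp only [v, RCLike.inner_apply, RCLike.star_def, RCLike.conj_conj]
      ring
    simp only [e1, e2] at this
    exact this

theorem aux_int {F f : ℂ → ℂ} (hF : Measurable F) (hf : Measurable f) (C : Set ℂ)
    (hC : IsCompact C) (hFC : ∫⁻ z in C, ‖F z‖ₑ ^ 2 < ⊤) (B : ℝ≥0) (hB : ∀ z, ‖f z‖ₑ ≤ B)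
    (hf0 : ∀ z, z ∉ C → f z = 0) : Integrable (fun z => F z * f z) := by
  have h1 : MemLp F 2 (volume.restrict C) := aux_memLp hF hFC
  have : IsFiniteMeasure (volume.restrict C) := ⟨by simpa using hC.measure_lt_top⟩
  have h2 : Integrable F (volume.restrict C) := h1.integrable (by norm_num)
  have h3 : IntegrableOn (fun z => F z * f z) C := by
    refine Integrable.mul_bdd (c := B) h2 hf.aestronglyMeasurable ?_
    refine Filter.Eventually.of_forall fun z => ?_
    have := hB z
    rw [← ofReal_norm] at this
    exact (ENNReal.ofReal_le_coe).mp this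
  refine (integrableOn_iff_integrable_of_support_subset ?_).mp h3
  intro z hz
  by_contra h
  exact hz (by simp [hf0 z h])

theorem aux_det (A : ℂ →L[ℝ] ℂ) :
    A.det = ‖(A 1 - Complex.I * A Complex.I) / 2‖ ^ 2 - ‖(A 1 + Complex.I * A Complex.I) / 2‖ ^ 2 := by
  rw [ContinuousLinearMap.det, ← LinearMap.det_toMatrix Complex.basisOneI, Matrix.det_fin_two]
  simp only [LinearMap.toMatrix_apply, Complex.coe_basisOneI, Complex.coe_basisOneI_repr]
  rw [Complex.sq_norm, Complex.sq_norm, Complex.normSq_apply, Complex.normSq_apply]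
  simp
  ring

theorem aux_energy (U : Set ℂ) (hU : IsOpen U) (K : ℝ) (hK : 1 ≤ K) (f : ℂ → ℂ)
    (hC1 : ContDiffOn ℝ 1 f U) (hinj : Set.InjOn f U)
    (hqc : ∀ z ∈ U, ‖wderivBar f z‖ ≤ (K - 1) / (K + 1) * ‖wderiv f z‖)
    (C : Set ℂ) (hC : C ⊆ U) (hCc : IsCompact C) :
    ∫⁻ z in C, ‖wderiv f z‖ₑ ^ 2 ≤
      ENNReal.ofReal ((K + 1) ^ 2 / (4 * K)) * volume (f '' C) := by
  rw [← lintegral_abs_det_fderiv_eq_addHaar_image (f' := fderiv ℝ f) volume hCc.measurableSet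
    (fun x hx => (((hC1.differentiableOn one_ne_zero).differentiableAt
      (hU.mem_nhds (hC hx))).hasFDerivAt).hasFDerivWithinAt) (hinj.mono hC),
    ← lintegral_const_mul' _ _ (by simp)]
  refine setLIntegral_mono' hCc.measurableSet fun z hz => ?_
  rw [← ofReal_norm, ← ENNReal.ofReal_pow (norm_nonneg _), ← ENNReal.ofReal_mul (by positivity)]
  refine ENNReal.ofReal_le_ofReal ?_
  have h1 : (fderiv ℝ f z).det = ‖wderiv f z‖ ^ 2 - ‖wderivBar f z‖ ^ 2 := aux_det _
  have h2 := hqc z (hC hz)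
  have h3 : ‖wderivBar f z‖ ^ 2 ≤ ((K - 1) / (K + 1)) ^ 2 * ‖wderiv f z‖ ^ 2 := by
    rw [← mul_pow]; gcongr
  have h4 : ((K - 1) / (K + 1)) ^ 2 = 1 - ((K + 1) ^ 2 / (4 * K))⁻¹ := by
    field_simp; ring
  have h5 : ((K + 1) ^ 2 / (4 * K))⁻¹ * ‖wderiv f z‖ ^ 2 ≤ |(fderiv ℝ f z).det| := by
    refine le_trans ?_ (le_abs_self _)
    rw [h1]; rw [h4] at h3; linarith
  have hpos : 0 < (K + 1) ^ 2 / (4 * K) := by positivity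
  rw [inv_mul_eq_div, div_le_iff₀ hpos] at h5
  linarith

theorem aux_ibp (U : Set ℂ) (hU : IsOpen U) (f : ℂ → ℂ) (hC1 : ContDiffOn ℝ 1 f U)
    (φ : ℂ → ℂ) (hφ : ContDiff ℝ (⊤ : ℕ∞) φ) (hφc : HasCompactSupport φ) (hφU : tsupport φ ⊆ U)
    (v : ℂ) : ∫ z, f z * fderiv ℝ φ z v = - ∫ z, fderiv ℝ f z v * φ z := by
  have hint : ∀ G : ℂ → ℂ, ContinuousOn G U → (∀ z, z ∉ tsupport φ → G z = 0) → Integrable G := by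
    intro G hG h0
    refine (integrableOn_iff_integrable_of_support_subset (s := tsupport φ) ?_).mp
      ((hG.mono hφU).integrableOn_compact hφc)
    intro z hz
    by_contra h
    exact hz (h0 z h)
  have hφd : Continuous (fun z => fderiv ℝ φ z v) :=
    (hφ.continuous_fderiv (by simp)).clm_apply continuous_const
  have hfd : ContinuousOn (fun z => fderiv ℝ f z v) U :=
    (hC1.continuousOn_fderiv_of_isOpen hU le_rfl).clm_apply continuousOn_const
  have hφ0 : ∀ z, z ∉ tsupport φ → φ z = 0 := fun z hz => image_eq_zero_of_notMem_tsupport hz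
  have hφd0 : ∀ z, z ∉ tsupport φ → fderiv ℝ φ z v = 0 := fun z hz => by
    rw [fderiv_of_notMem_tsupport ℝ hz]; rfl
  have := integral_bilinear_hasLineDerivAt_right_eq_neg_left_of_integrable (μ := volume)
    (f := f) (f' := fun z => fderiv ℝ f z v) (g := φ) (g' := fun z => fderiv ℝ φ z v) (v := v)
    (B := ContinuousLinearMap.mul ℝ ℂ)
    (hint _ (hfd.mul hφ.continuous.continuousOn) fun z hz => by simp [hφ0 z hz])
    (hint _ (hC1.continuousOn.mul hφd.continuousOn) fun z hz => by simp [hφd0 z hz])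
    (hint _ (hC1.continuousOn.mul hφ.continuous.continuousOn) fun z hz => by simp [hφ0 z hz])
    (fun z hz => ((hC1.differentiableOn one_ne_zero).differentiableAt
      (hU.mem_nhds (hφU hz))).hasFDerivAt.hasLineDerivAt v)
    (fun z hz => ((hφ.differentiable (by simp)) z).hasFDerivAt.hasLineDerivAt v)
  simpa using this

theorem aux_unif (Φseq : ℕ → ℂ → ℂ) (Φ : ℂ → ℂ) (C : Set ℂ) (hCc : IsCompact C)
    (hcont : ∀ n, ContinuousOn (Φseq n) C) (hΦ : ContinuousOn Φ C)
    (hconv : TendstoUniformlyOn Φseq Φ Filter.atTop C) (ψ : ℂ → ℂ) (hψ : Continuous ψ)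
    (h0 : ∀ z, z ∉ C → ψ z = 0) :
    Filter.Tendsto (fun n => ∫ z, Φseq n z * ψ z) Filter.atTop (nhds (∫ z, Φ z * ψ z)) := by
  have e : ∀ G : ℂ → ℂ, ∫ z, G z * ψ z = ∫ z in C, G z * ψ z := fun G =>
    (setIntegral_eq_integral_of_forall_compl_eq_zero fun z hz => by simp [h0 z hz]).symm
  simp only [e]
  obtain ⟨R, hR⟩ := (hCc.image_of_continuousOn hΦ).isBounded.exists_norm_le
  have hiψ : IntegrableOn (fun z => (R + 1) * ‖ψ z‖) C :=
    ContinuousOn.integrableOn_compact hCc (by fun_prop)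
  refine tendsto_integral_filter_of_dominated_convergence (fun z => (R + 1) * ‖ψ z‖) ?_ ?_ hiψ ?_
  · exact Filter.Eventually.of_forall fun n =>
      ((hcont n).mul hψ.continuousOn).aestronglyMeasurable hCc.measurableSet
  · filter_upwards [Metric.tendstoUniformlyOn_iff.mp hconv 1 one_pos] with n hn
    filter_upwards [ae_restrict_mem hCc.measurableSet] with z hz
    rw [norm_mul]
    gcongr
    have h1 := hn z hz
    have h2 := hR _ (Set.mem_image_of_mem Φ hz)
    rw [dist_comm, dist_eq_norm] at h1
    have h3 : Φseq n z = Φ z + (Φseq n z - Φ z) := by ring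
    rw [h3]
    exact (norm_add_le _ _).trans (by linarith)
  · filter_upwards [ae_restrict_mem hCc.measurableSet] with z hz
    exact (hconv.tendsto_at hz).mul_const _

theorem aux_bound (Φseq : ℕ → ℂ → ℂ) (Φ : ℂ → ℂ) (C : Set ℂ) (hCc : IsCompact C)
    (hcont : ∀ n, ContinuousOn (Φseq n) C) (hΦ : ContinuousOn Φ C)
    (hconv : TendstoUniformlyOn Φseq Φ Filter.atTop C) :
    ∃ M : ℝ≥0, ∀ n, volume (Φseq n '' C) ≤ M := by
  obtain ⟨R, hR⟩ := (hCc.image_of_continuousOn hΦ).isBounded.exists_norm_le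
  have hlt : ∀ n, volume (Φseq n '' C) < ⊤ := fun n =>
    (hCc.image_of_continuousOn (hcont n)).measure_lt_top
  have hB : Filter.IsBoundedUnder (· ≤ ·) Filter.atTop
      (fun n => (volume (Φseq n '' C)).toNNReal) := by
    refine ⟨(volume (Metric.closedBall (0 : ℂ) (R + 1))).toNNReal, ?_⟩
    rw [Filter.eventually_map]
    filter_upwards [Metric.tendstoUniformlyOn_iff.mp hconv 1 one_pos] with n hn
    refine ENNReal.toNNReal_mono (isCompact_closedBall _ _).measure_lt_top.ne (measure_mono ?_)
    rintro _ ⟨z, hz, rfl⟩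
    have h1 := hn z hz
    have h2 := hR _ (Set.mem_image_of_mem Φ hz)
    rw [dist_comm, dist_eq_norm] at h1
    have h3 : Φseq n z = Φ z + (Φseq n z - Φ z) := by ring
    rw [mem_closedBall_zero_iff, h3]
    exact (norm_add_le _ _).trans (by linarith)
  obtain ⟨M, hM⟩ := hB.bddAbove_range
  refine ⟨M, fun n => ?_⟩
  rw [← ENNReal.coe_toNNReal (hlt n).ne]
  exact ENNReal.coe_le_coe.mpr (hM ⟨n, rfl⟩)

theorem aux_strong (p e : ℕ → ℂ → ℂ) (C : Set ℂ) (hCc : IsCompact C)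
    (hp : ∀ n, Measurable (p n)) (he : ∀ n, Measurable (e n)) (M B : ℝ≥0)
    (hM : ∀ n, ∫⁻ z in C, ‖p n z‖ₑ ^ 2 ≤ M) (hB : ∀ n, ∀ z ∈ C, ‖e n z‖ₑ ≤ B)
    (h0 : ∀ n z, z ∉ C → e n z = 0)
    (hlim : ∀ᵐ z ∂(volume.restrict C), Filter.Tendsto (fun n => e n z) Filter.atTop (nhds 0)) :
    Filter.Tendsto (fun n => ∫ z, p n z * e n z) Filter.atTop (nhds 0) := by
  have h1 : Filter.Tendsto (fun n => ∫⁻ z in C, ‖e n z‖ₑ ^ 2) Filter.atTop (nhds 0) := by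
    have := tendsto_lintegral_of_dominated_convergence (μ := volume.restrict C)
      (F := fun n z => ‖e n z‖ₑ ^ 2) (f := fun _ => 0) (fun _ => (B : ℝ≥0∞) ^ 2)
      (fun n => by have := he n; fun_prop)
      (fun n => by
        filter_upwards [ae_restrict_mem hCc.measurableSet] with z hz
        have := hB n z hz
        gcongr)
      (by rw [setLIntegral_const]
          exact (ENNReal.mul_lt_top (by simp) hCc.measure_lt_top).ne)
      (by filter_upwards [hlim] with z hz
          have h := (ENNReal.continuous_pow 2).tendsto _ |>.comp (hz.enorm)
          simpa [Function.comp_def] using h)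
    simpa using this
  rw [tendsto_zero_iff_enorm_tendsto_zero]
  have h2 : Filter.Tendsto (fun n => (M : ℝ≥0∞) ^ (1 / 2 : ℝ) *
      (∫⁻ z in C, ‖e n z‖ₑ ^ 2) ^ (1 / 2 : ℝ)) Filter.atTop (nhds 0) := by
    have h3 := (ENNReal.continuous_rpow_const (y := 1 / 2)).tendsto _ |>.comp h1
    have h4 := ENNReal.Tendsto.const_mul (a := (M : ℝ≥0∞) ^ (1 / 2 : ℝ)) h3
      (Or.inr (ENNReal.rpow_ne_top_of_nonneg (by norm_num) (by simp)))
    simpa [Function.comp_def] using h4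
  refine tendsto_of_tendsto_of_tendsto_of_le_of_le tendsto_const_nhds h2 (fun _ => zero_le) ?_
  intro n
  calc ‖∫ z, p n z * e n z‖ₑ = ‖∫ z in C, p n z * e n z‖ₑ := by
        rw [setIntegral_eq_integral_of_forall_compl_eq_zero fun z hz => by simp [h0 n z hz]]
    _ ≤ ∫⁻ z in C, ‖p n z * e n z‖ₑ := enorm_integral_le_lintegral_enorm _
    _ = ∫⁻ z in C, ((fun z => ‖p n z‖ₑ) * (fun z => ‖e n z‖ₑ)) z := by simp [enorm_mul]
    _ ≤ (∫⁻ z in C, ‖p n z‖ₑ ^ (2 : ℝ)) ^ (1 / 2 : ℝ) *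
        (∫⁻ z in C, ‖e n z‖ₑ ^ (2 : ℝ)) ^ (1 / 2 : ℝ) :=
        ENNReal.lintegral_mul_le_Lp_mul_Lq _ Real.HolderConjugate.two_two
          (hp n).enorm.aemeasurable (he n).enorm.aemeasurable
    _ ≤ _ := by
        simp only [ENNReal.rpow_two]
        gcongr
        exact hM n

/-- **Limits of `K`-quasiconformal maps (Lemma 3.2).** Let `U ⊆ ℂ` be a domain and
`Φₙ` orientation-preserving injective `C¹` maps on `U` with nonvanishing
differential and `|∂Φₙ/∂z̄| ≤ k |∂Φₙ/∂z|` (`k = (K−1)/(K+1)`), converging uniformly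
on compact subsets of `U` to a homeomorphism `Φ` of `U` onto `Φ(U)`. If the
Beltrami coefficients `μₙ = (∂Φₙ/∂z̄)/(∂Φₙ/∂z)` converge a.e. on `U` to a
measurable `μ`, then `Φ` has locally `L²` distributional derivatives and
satisfies `∂Φ/∂z̄ = μ ∂Φ/∂z` a.e. on `U`. -/
theorem limit_of_qc_maps
    (U : Set ℂ) (hU : IsOpen U) (hUconn : IsConnected U)
    (K : ℝ) (hK : 1 ≤ K)
    (Φseq : ℕ → ℂ → ℂ) (Φ : ℂ → ℂ) (μ : ℂ → ℂ)
    (hC1 : ∀ n, ContDiffOn ℝ 1 (Φseq n) U)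
    (hinj : ∀ n, Set.InjOn (Φseq n) U)
    (hnondeg : ∀ n, ∀ z ∈ U, wderiv (Φseq n) z ≠ 0)
    (hqc : ∀ n, ∀ z ∈ U,
      ‖wderivBar (Φseq n) z‖ ≤ (K - 1) / (K + 1) * ‖wderiv (Φseq n) z‖)
    (hconv : ∀ C : Set ℂ, C ⊆ U → IsCompact C →
      TendstoUniformlyOn Φseq Φ Filter.atTop C)
    (hΦcont : ContinuousOn Φ U) (hΦinj : Set.InjOn Φ U)
    (hΦinvcont : ContinuousOn (Function.invFunOn Φ U) (Φ '' U))
    (hμ : Measurable μ)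
    (hμconv : ∀ᵐ z ∂(volume.restrict U),
      Filter.Tendsto (fun n => wderivBar (Φseq n) z / wderiv (Φseq n) z)
        Filter.atTop (nhds (μ z))) :
    ∃ g h : ℂ → ℂ, HasWeakDerivsOn U Φ g h ∧
      ∀ᵐ z ∂(volume.restrict U),
        (g z + Complex.I * h z) / 2 = μ z * ((g z - Complex.I * h z) / 2) := by
  
  have hk0 : 0 ≤ (K - 1) / (K + 1) := div_nonneg (by linarith) (by linarith)
  have hk1 : (K - 1) / (K + 1) ≤ 1 := by rw [div_le_one (by linarith)]; linarith
  let p : ℕ → ℂ → ℂ := fun n => wderiv (Φseq n)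
  let q : ℕ → ℂ → ℂ := fun n => wderivBar (Φseq n)
  have hpm : ∀ n, Measurable (p n) := fun n => by
    have h1 := measurable_fderiv_apply_const ℝ (Φseq n) 1
    have h2 := measurable_fderiv_apply_const ℝ (Φseq n) Complex.I
    exact (h1.sub (h2.const_mul _)).div_const _
  have hqm : ∀ n, Measurable (q n) := fun n => by
    have h1 := measurable_fderiv_apply_const ℝ (Φseq n) 1
    have h2 := measurable_fderiv_apply_const ℝ (Φseq n) Complex.I
    exact (h1.add (h2.const_mul _)).div_const _
  have hqp : ∀ n, ∀ z ∈ U, ‖q n z‖ ≤ ‖p n z‖ := fun n z hz =>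
    (hqc n z hz).trans (mul_le_of_le_one_left (norm_nonneg _) hk1)
  have hpb : ∀ C : Set ℂ, C ⊆ U → IsCompact C →
      ∃ M : ℝ≥0, ∀ n, ∫⁻ z in C, ‖p n z‖ₑ ^ 2 ≤ M := by
    intro C hC hCc
    obtain ⟨M, hM⟩ := aux_bound Φseq Φ C hCc (fun n => (hC1 n).continuousOn.mono hC)
      (hΦcont.mono hC) (hconv C hC hCc)
    refine ⟨Real.toNNReal ((K + 1) ^ 2 / (4 * K)) * M, fun n => ?_⟩
    refine (aux_energy U hU K hK _ (hC1 n) (hinj n) (hqc n) C hC hCc).trans ?_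
    rw [ENNReal.coe_mul]
    gcongr
    · exact le_rfl
    · exact hM n
  have hqb : ∀ C : Set ℂ, C ⊆ U → IsCompact C →
      ∃ M : ℝ≥0, ∀ n, ∫⁻ z in C, ‖q n z‖ₑ ^ 2 ≤ M := by
    intro C hC hCc
    obtain ⟨M, hM⟩ := hpb C hC hCc
    refine ⟨M, fun n => le_trans ?_ (hM n)⟩
    refine setLIntegral_mono' hCc.measurableSet fun z hz => ?_
    have := enorm_le_iff_norm_le.mpr (hqp n z (hC hz))
    gcongr
  obtain ⟨P, hPm, hPL, hP⟩ := aux_loc U hU p hpm hpb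
  obtain ⟨Q, hQm, hQL, hQ⟩ := aux_loc U hU q hqm hqb
  have hsupp : ∀ φ : ℂ → ℂ, Continuous φ → HasCompactSupport φ →
      ∃ B : ℝ≥0, ∀ z, ‖φ z‖ₑ ≤ B := by
    intro φ hφ hφc
    obtain ⟨B, hB⟩ := hφc.exists_bound_of_continuous hφ
    refine ⟨B.toNNReal, fun z => ?_⟩
    rw [← ofReal_norm]
    exact ENNReal.ofReal_le_ofReal (hB z)
  -- Beltrami equation
  let μ' : ℂ → ℂ := {z | ‖μ z‖ ≤ 1}.indicator μ
  have hμ'm : Measurable μ' := hμ.indicator (measurableSet_le hμ.norm measurable_const)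
  have hμ'1 : ∀ z, ‖μ' z‖ ≤ 1 := fun z => by
    by_cases h : ‖μ z‖ ≤ 1
    · simp [μ', h]
    · simp [μ', h]
  have hm1 : ∀ n, ∀ z ∈ U, ‖q n z / p n z‖ ≤ 1 := fun n z hz => by
    rw [norm_div]
    exact div_le_one_of_le₀ (hqp n z hz) (norm_nonneg _)
  have hμμ' : ∀ᵐ z ∂(volume.restrict U), μ z = μ' z := by
    filter_upwards [hμconv, ae_restrict_mem hU.measurableSet] with z hz hzU
    have : ‖μ z‖ ≤ 1 := le_of_tendsto hz.norm (Filter.Eventually.of_forall fun n => hm1 n z hzU)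
    simp [μ', this]
  have hyp : Filter.Tendsto id (Filter.hyperfilter ℕ : Filter ℕ) Filter.atTop := by
    rw [← Nat.cofinite_eq_atTop]
    exact Filter.hyperfilter_le_cofinite
  have hbel : ∀ᵐ z, z ∈ U → Q z - P z * μ' z = 0 := by
    refine hU.ae_eq_zero_of_integral_contDiff_smul_eq_zero ?_ ?_
    · rw [locallyIntegrableOn_iff hU.isLocallyClosed]
      intro C hC hCc
      have : IsFiniteMeasure (volume.restrict C) := ⟨by simpa using hCc.measure_lt_top⟩
      have h1 : Integrable Q (volume.restrict C) :=
        (aux_memLp hQm (hQL C hC hCc)).integrable (by norm_num)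
      have h2 : Integrable P (volume.restrict C) :=
        (aux_memLp hPm (hPL C hC hCc)).integrable (by norm_num)
      exact h1.sub (h2.mul_bdd (c := 1) hμ'm.aestronglyMeasurable
        (Filter.Eventually.of_forall hμ'1))
    · intro φ hφ hφc hφU
      let ψ : ℂ → ℂ := fun z => (φ z : ℂ)
      have hψ : Continuous ψ := Complex.continuous_ofReal.comp hφ.continuous
      have hψm : Measurable ψ := hψ.measurable
      have hψc : HasCompactSupport ψ := hφc.comp_left Complex.ofReal_zero
      have hψ0 : ∀ z, z ∉ tsupport φ → ψ z = 0 := fun z hz => by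
        simp [ψ, image_eq_zero_of_notMem_tsupport hz]
      obtain ⟨B, hB⟩ := hsupp ψ hψ hψc
      have hB2 : ∀ z, ‖μ' z * ψ z‖ₑ ≤ B := fun z => by
        rw [enorm_mul]
        refine le_trans (mul_le_of_le_one_left zero_le ?_) (hB z)
        rw [← ofReal_norm]
        exact (ENNReal.ofReal_le_ofReal (hμ'1 z)).trans (by simp)
      have hμψ0 : ∀ z, z ∉ tsupport φ → μ' z * ψ z = 0 := fun z hz => by simp [hψ0 z hz]
      have t1 := hQ ψ hψm ⟨B, hB⟩ _ hφU hφc hψ0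
      have t2 := hP (fun z => μ' z * ψ z) (hμ'm.mul hψm) ⟨B, hB2⟩ _ hφU hφc hμψ0
      obtain ⟨M, hM⟩ := hpb _ hφU hφc
      obtain ⟨M', hM'⟩ := hqb _ hφU hφc
      have t3 := aux_strong p (fun n z => (q n z / p n z - μ' z) * ψ z) _ hφc hpm
        (fun n => (((hqm n).div (hpm n)).sub hμ'm).mul hψm) M (2 * B) hM
        (fun n z hz => by
          rw [enorm_mul, ENNReal.coe_mul]
          gcongr
          · rw [← ofReal_norm]
            refine ENNReal.ofReal_le_of_le_toReal ?_
            refine (norm_sub_le _ _).trans ?_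
            have h1 := hm1 n z (hφU hz)
            have h2 := hμ'1 z
            rw [ENNReal.coe_ofNat, ENNReal.toReal_ofNat]
            linarith
          · exact hB z)
        (fun n z hz => by simp [hψ0 z hz])
        (by
          refine ae_restrict_of_ae_restrict_of_subset hφU ?_
          filter_upwards [hμconv, hμμ'] with z h1 h2
          rw [h2] at h1
          have := ((h1.sub_const (μ' z)).mul_const (ψ z))
          simpa using this)
      have t4 := t1.sub t2
      have t5 := tendsto_nhds_unique (t4.congr fun n => ?_) (t3.comp hyp)
      · rw [← integral_sub (aux_int hQm hψm _ hφc (hQL _ hφU hφc) B hB hψ0)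
          (aux_int (f := fun z => μ' z * ψ z) hPm (hμ'm.mul hψm) _ hφc (hPL _ hφU hφc) B hB2 hμψ0)] at t5
        rw [← t5]
        congr 1; ext z
        simp only [ψ, Complex.real_smul]
        ring
      · rw [← integral_sub
          (aux_int (hqm n) hψm _ hφc ((hM' n).trans_lt (by simp)) B hB hψ0)
          (aux_int (f := fun z => μ' z * ψ z) (hpm n) (hμ'm.mul hψm) _ hφc ((hM n).trans_lt (by simp)) B hB2 hμψ0)]
        simp only [Function.comp_apply, id]
        congr 1; ext z
        by_cases hz : z ∈ tsupport φ
        · have := hnondeg n z (hφU hz)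
          change p n z ≠ 0 at this
          field_simp
        · simp [hψ0 z hz]
  have hPC : ∀ C : Set ℂ, C ⊆ U → IsCompact C → MemLp P 2 (volume.restrict C) :=
    fun C hC hCc => aux_memLp hPm (hPL C hC hCc)
  have hQC : ∀ C : Set ℂ, C ⊆ U → IsCompact C → MemLp Q 2 (volume.restrict C) :=
    fun C hC hCc => aux_memLp hQm (hQL C hC hCc)
  have key : ∀ (v a b : ℂ), (∀ n z, fderiv ℝ (Φseq n) z v = a * p n z + b * q n z) →
      ∀ φ : ℂ → ℂ, ContDiff ℝ (⊤ : ℕ∞) φ → HasCompactSupport φ → tsupport φ ⊆ U →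
      (∫ z in U, Φ z * fderiv ℝ φ z v) = -∫ z in U, (a * P z + b * Q z) * φ z := by
    intro v a b hab φ hφ hφc hφU
    have hφ0 : ∀ z, z ∉ tsupport φ → φ z = 0 := fun z hz => image_eq_zero_of_notMem_tsupport hz
    have hφd0 : ∀ z, z ∉ tsupport φ → fderiv ℝ φ z v = 0 := fun z hz => by
      rw [fderiv_of_notMem_tsupport ℝ hz]; rfl
    rw [setIntegral_eq_integral_of_forall_compl_eq_zero
        (fun z hz => by simp [hφd0 z (fun h => hz (hφU h))]),
      setIntegral_eq_integral_of_forall_compl_eq_zero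
        (fun z hz => by simp [hφ0 z (fun h => hz (hφU h))])]
    have hφm : Measurable φ := hφ.continuous.measurable
    obtain ⟨B, hB⟩ := hsupp φ hφ.continuous hφc
    obtain ⟨M, hM⟩ := hpb _ hφU hφc
    obtain ⟨M', hM'⟩ := hqb _ hφU hφc
    have t1 := aux_unif Φseq Φ _ hφc (fun n => (hC1 n).continuousOn.mono hφU)
      (hΦcont.mono hφU) (hconv _ hφU hφc) (fun z => fderiv ℝ φ z v)
      ((hφ.continuous_fderiv (by simp)).clm_apply continuous_const) hφd0
    have t2 := ((hP φ hφm ⟨B, hB⟩ _ hφU hφc hφ0).const_mul a).add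
      ((hQ φ hφm ⟨B, hB⟩ _ hφU hφc hφ0).const_mul b) |>.neg
    have split : ∀ F G : ℂ → ℂ, Integrable (fun z => F z * φ z) →
        Integrable (fun z => G z * φ z) →
        ∫ z, (a * F z + b * G z) * φ z = a * (∫ z, F z * φ z) + b * ∫ z, G z * φ z := by
      intro F G hF hG
      rw [← integral_const_mul, ← integral_const_mul,
        ← integral_add (hF.const_mul a) (hG.const_mul b)]
      congr 1; ext z; ring
    rw [split P Q (aux_int hPm hφm _ hφc (hPL _ hφU hφc) B hB hφ0)
      (aux_int hQm hφm _ hφc (hQL _ hφU hφc) B hB hφ0)]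
    refine tendsto_nhds_unique (t1.comp hyp) (t2.congr fun n => ?_)
    simp only [Function.comp_apply, id]
    rw [aux_ibp U hU _ (hC1 n) φ hφ hφc hφU v]
    simp only [hab]
    rw [split (p n) (q n)
      (aux_int (hpm n) hφm _ hφc ((hM n).trans_lt (by simp)) B hB hφ0)
      (aux_int (hqm n) hφm _ hφc ((hM' n).trans_lt (by simp)) B hB hφ0)]
  have hL2 : ∀ a b : ℂ, LocallyL2On U (fun z => a * P z + b * Q z) := by
    intro a b C hC hCc
    have h := ((hPC C hC hCc).const_mul a).add ((hQC C hC hCc).const_mul b)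
    exact (memLp_two_iff_integrable_sq_norm h.1).mp h
  refine ⟨fun z => 1 * P z + 1 * Q z, fun z => Complex.I * P z + (-Complex.I) * Q z,
    ⟨hL2 _ _, hL2 _ _, fun φ hφ hφc hφU => ⟨key 1 1 1 ?_ φ hφ hφc hφU,
      key Complex.I Complex.I (-Complex.I) ?_ φ hφ hφc hφU⟩⟩, ?_⟩
  · intro n z
    simp only [p, q, wderiv, wderivBar]
    ring
  · intro n z
    simp only [p, q, wderiv, wderivBar]
    linear_combination (fderiv ℝ (Φseq n) z Complex.I) * Complex.I_mul_I
  · filter_upwards [ae_restrict_of_ae hbel, hμμ', ae_restrict_mem hU.measurableSet] with z h1 h2 h3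
    have h4 := h1 h3
    rw [h2]
    have hI := Complex.I_mul_I
    linear_combination h4 + (P z - Q z) / 2 * (1 + μ' z) * hI
end

section
/- Let U, V ⊆ ℂ be domains and let Φ : U → V be a homeomorphism that has locally L² distributional derivatives and satisfies |∂Φ/∂z̄| ≤ k·|∂Φ/∂z| almost everywhere on U for some constant 0 ≤ k < 1. Then Φ maps Lebesgue-null sets to Lebesgue-null sets: for every S ⊆ U of Lebesgue measure zero, Φ(S) has Lebesgue measure zero. -/
open MeasureTheory

lemma qa_deriv (U : Set ℂ) (Φ g : ℂ → ℂ) (v : ℂ)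
    (hw : ∀ φ : ℂ → ℂ, ContDiff ℝ (⊤ : ℕ∞) φ → HasCompactSupport φ → tsupport φ ⊆ U →
      ((∫ z in U, Φ z * fderiv ℝ φ z v ∂volume) = -∫ z in U, g z * φ z ∂volume))
    (hUm : IsOpen U)
    (B : Set ℂ) (hB : MeasurableSet B) (hBU : B ⊆ U)
    (hint : LocallyIntegrable (B.indicator Φ) volume) (ρ : ContDiffBump (0:ℂ)) (z : ℂ)
    (hz : Metric.closedBall z ρ.rOut ⊆ B) :
    ‖fderiv ℝ (convolution (ρ.normed volume) (B.indicator Φ)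
      (ContinuousLinearMap.lsmul ℝ ℝ) volume) z v‖ₑ ≤
      ∫⁻ y in B, ‖g y‖ₑ * ‖ρ.normed volume (z - y)‖ₑ := by
  have hρ : ContDiff ℝ (⊤ : ℕ∞) (ρ.normed volume) := ρ.contDiff_normed
  have hρc : HasCompactSupport (ρ.normed volume) := ρ.hasCompactSupport_normed
  have hd := HasCompactSupport.hasFDerivAt_convolution_left (𝕜 := ℝ)
    (ContinuousLinearMap.lsmul ℝ ℝ) (μ := volume) hρc (hρ.of_le (by simp)) hint z
  have hex := (hρc.fderiv (𝕜 := ℝ)).convolutionExists_left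
    (ContinuousLinearMap.precompL ℂ (ContinuousLinearMap.lsmul ℝ ℝ)) (μ := volume)
    (hρ.continuous_fderiv (by simp)) hint z
  let φ : ℂ → ℂ := fun y => ((ρ.normed volume (z - y) : ℝ) : ℂ)
  have hφ : ContDiff ℝ (⊤ : ℕ∞) φ :=
    Complex.ofRealCLM.contDiff.comp (hρ.comp (contDiff_const.sub contDiff_id))
  have hsupp : tsupport φ ⊆ Metric.closedBall z ρ.rOut := by
    apply closure_minimal _ Metric.isClosed_closedBall
    intro y hy
    have h1 : ρ.normed volume (z - y) ≠ 0 := by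
      intro h0; apply hy; simp [φ, h0]
    have h2 : z - y ∈ Function.support (ρ.normed volume) := h1
    rw [ρ.support_normed_eq] at h2
    simp only [Metric.mem_ball, dist_zero_right] at h2
    rw [Metric.mem_closedBall, dist_comm, dist_eq_norm]
    exact h2.le
  have hφc : HasCompactSupport φ :=
    HasCompactSupport.of_support_subset_isCompact (isCompact_closedBall z ρ.rOut)
      ((subset_tsupport _).trans hsupp)
  have hφd : ∀ y, fderiv ℝ φ y v = -((fderiv ℝ (ρ.normed volume) (z - y) v : ℝ) : ℂ) := by
    intro y
    have h1 : HasFDerivAt (ρ.normed volume) (fderiv ℝ (ρ.normed volume) (z - y)) (z - y) :=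
      ((hρ.differentiable (by simp)) (z - y)).hasFDerivAt
    have h2 : HasFDerivAt (fun y : ℂ => z - y) (-ContinuousLinearMap.id ℝ ℂ) y :=
      (hasFDerivAt_id y).const_sub z
    have h3 := (Complex.ofRealCLM.hasFDerivAt (x := ρ.normed volume (z - y))).comp y (h1.comp y h2)
    have h4 : HasFDerivAt φ _ y := h3
    rw [h4.fderiv]
    simp
  have key : fderiv ℝ (convolution (ρ.normed volume) (B.indicator Φ)
      (ContinuousLinearMap.lsmul ℝ ℝ) volume) z v = ∫ y in U, g y * φ y := by
    rw [hd.fderiv, convolution_def, ContinuousLinearMap.integral_apply hex]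
    have h5 := hw φ hφ hφc (hsupp.trans (hz.trans hBU))
    rw [← neg_eq_iff_eq_neg] at h5
    rw [← h5, ← integral_sub_left_eq_self _ volume z, ← integral_indicator hUm.measurableSet,
      ← integral_neg]
    congr 1
    ext1 y
    simp only [ContinuousLinearMap.precompL_apply, sub_sub_cancel, ContinuousLinearMap.lsmul_apply]
    by_cases hy : y ∈ B
    · rw [Set.indicator_of_mem hy, Set.indicator_of_mem (hBU hy), hφd]
      simp [mul_comm]
    · have hy0 : fderiv ℝ φ y = 0 := by
        have : y ∉ tsupport (fderiv ℝ φ) := fun hh =>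
          hy (hz (hsupp (tsupport_fderiv_subset ℝ hh)))
        exact image_eq_zero_of_notMem_tsupport this
      rw [Set.indicator_of_notMem hy]
      by_cases hyU : y ∈ U
      · rw [Set.indicator_of_mem hyU, hy0]; simp
      · rw [Set.indicator_of_notMem hyU]; simp
  rw [key]
  have h6 : ∫ y in U, g y * φ y = ∫ y in B, g y * φ y := by
    apply setIntegral_eq_of_subset_of_forall_sdiff_eq_zero hUm.measurableSet hBU
    intro y hy
    rw [image_eq_zero_of_notMem_tsupport (fun hh => hy.2 (hz (hsupp hh))), mul_zero]
  rw [h6]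
  refine (enorm_integral_le_lintegral_enorm _).trans (le_of_eq ?_)
  congr 1
  ext1 y
  rw [enorm_mul]
  congr 1
  simp [φ, enorm_eq_nnnorm]

lemma qa_L1 (g : ℂ → ℂ) (B : Set ℂ) (hg : AEMeasurable (fun z => ‖g z‖ₑ) (volume.restrict B))
    (ρ : ContDiffBump (0:ℂ)) :
    ∫⁻ z, ∫⁻ y in B, ‖g y‖ₑ * ‖ρ.normed volume (z - y)‖ₑ = ∫⁻ y in B, ‖g y‖ₑ := by
  have hρ : Continuous (ρ.normed volume) := ρ.continuous_normed
  rw [lintegral_lintegral_swap]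
  · congr 1
    ext1 y
    rw [lintegral_const_mul _ (Continuous.measurable (by fun_prop))]
    have : ∫⁻ z, ‖ρ.normed volume (z - y)‖ₑ = ∫⁻ z, ‖ρ.normed volume z‖ₑ :=
      lintegral_sub_right_eq_self (fun z => ‖ρ.normed volume z‖ₑ) y
    rw [this]
    have h1 : ∫⁻ z, ‖ρ.normed volume z‖ₑ = 1 := by
      have h2 := ofReal_integral_eq_lintegral_ofReal (μ := volume) ρ.integrable_normed
        (Filter.Eventually.of_forall (fun x => ρ.nonneg_normed x))
      rw [ρ.integral_normed] at h2
      rw [ENNReal.ofReal_one] at h2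
      rw [h2]
      congr 1
      ext1 z
      exact Real.enorm_of_nonneg (ρ.nonneg_normed z)
    rw [h1, mul_one]
  · have h1 : AEMeasurable (fun p : ℂ × ℂ => ‖g p.2‖ₑ)
      ((volume : Measure ℂ).prod (volume.restrict B)) := hg.comp_snd
    apply AEMeasurable.mul h1
    have : Continuous (fun p : ℂ × ℂ => ‖ρ.normed volume (p.1 - p.2)‖ₑ) := by fun_prop
    exact this.aemeasurable

lemma qa_moll (U : Set ℂ) (Φ g h : ℂ → ℂ) (hU : IsOpen U) (hcont : ContinuousOn Φ U)
    (hweak : HasWeakDerivsOn U Φ g h) (x : ℂ) (R R' : ℝ) (hR : R < R')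
    (hB : Metric.closedBall x R' ⊆ U)
    (hg : AEMeasurable (fun z => ‖g z‖ₑ) (volume.restrict (Metric.closedBall x R')))
    (hh : AEMeasurable (fun z => ‖h z‖ₑ) (volume.restrict (Metric.closedBall x R')))
    (δ : ℝ) (hδ : 0 < δ) :
    ∃ F : ℂ → ℂ, ContDiff ℝ 1 F ∧ (∀ z ∈ Metric.closedBall x R, dist (F z) (Φ z) ≤ δ) ∧
      (∫⁻ z in Metric.closedBall x R, ‖fderiv ℝ F z 1‖ₑ ≤
        ∫⁻ z in Metric.closedBall x R', ‖g z‖ₑ) ∧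
      (∫⁻ z in Metric.closedBall x R, ‖fderiv ℝ F z Complex.I‖ₑ ≤
        ∫⁻ z in Metric.closedBall x R', ‖h z‖ₑ) := by
  set B := Metric.closedBall x R' with hBdef
  have hBc : IsCompact B := isCompact_closedBall x R'
  have hBm : MeasurableSet B := hBc.measurableSet
  have huc := hBc.uniformContinuousOn_of_continuous (hcont.mono hB)
  rw [Metric.uniformContinuousOn_iff] at huc
  obtain ⟨η, hη, huc⟩ := huc δ hδ
  have hint : LocallyIntegrable (B.indicator Φ) volume := by
    apply Integrable.locallyIntegrable
    rw [integrable_indicator_iff hBm]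
    exact (hcont.mono hB).integrableOn_compact hBc
  set e := min η (R' - R) with he
  have hepos : 0 < e := lt_min hη (by linarith)
  let ρ : ContDiffBump (0:ℂ) := ⟨e/2, e, by linarith, by linarith⟩
  have hρe : ρ.rOut = e := rfl
  have hsub : ∀ z ∈ Metric.closedBall x R, Metric.closedBall z ρ.rOut ⊆ B := by
    intro z hz y hy
    rw [Metric.mem_closedBall] at *
    have := dist_triangle y z x
    have h2 : e ≤ R' - R := min_le_right _ _
    rw [hρe] at hy
    linarith
  refine ⟨convolution (ρ.normed volume) (B.indicator Φ)
      (ContinuousLinearMap.lsmul ℝ ℝ) volume, ?_, ?_, ?_, ?_⟩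
  · exact ρ.hasCompactSupport_normed.contDiff_convolution_left (n := 1) _
      ρ.contDiff_normed hint
  · intro z hz
    have hzB : z ∈ B := hsub z hz (Metric.mem_closedBall_self (by rw [hρe]; exact hepos.le))
    have := ContDiffBump.dist_normed_convolution_le (φ := ρ) (x₀ := z) (ε := δ)
      hint.aestronglyMeasurable (μ := volume) (fun y hy => by
        have hyB : y ∈ B := hsub z hz (Metric.ball_subset_closedBall hy)
        rw [Set.indicator_of_mem hzB, Set.indicator_of_mem hyB]
        refine (huc y hyB z hzB ?_).le
        rw [Metric.mem_ball, hρe] at hy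
        exact hy.trans_le (min_le_left _ _))
    rwa [Set.indicator_of_mem hzB] at this
  · rw [← qa_L1 g B hg ρ]
    refine le_trans ?_ (setLIntegral_le_lintegral (Metric.closedBall x R) _)
    refine setLIntegral_mono' measurableSet_closedBall (fun z hz => ?_)
    exact qa_deriv U Φ g 1 (fun φ h1 h2 h3 => (hweak.2.2 φ h1 h2 h3).1) hU B hBm hB hint ρ z
      (hsub z hz)
  · rw [← qa_L1 h B hh ρ]
    refine le_trans ?_ (setLIntegral_le_lintegral (Metric.closedBall x R) _)
    refine setLIntegral_mono' measurableSet_closedBall (fun z hz => ?_)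
    exact qa_deriv U Φ h Complex.I (fun φ h1 h2 h3 => (hweak.2.2 φ h1 h2 h3).2) hU B hBm hB hint
      ρ z (hsub z hz)

lemma qa_line (H : ℂ → ENNReal) (hH : Measurable H) (T : Set ℂ) (c r : ℝ) (hr : 0 < r)
    (J : Set ℝ)
    (hT : ∀ s ∈ Set.Icc c (c + r), ∀ t ∈ J, (⟨s, t⟩ : ℂ) ∈ T) :
    ∃ s ∈ Set.Icc c (c + r), ∫⁻ t in J, H ⟨s, t⟩ ≤ (∫⁻ z in T, H z) / ENNReal.ofReal r := by
  have hm : Measurable (fun p : ℝ × ℝ => H ⟨p.1, p.2⟩) :=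
    hH.comp Complex.measurableEquivRealProd.symm.measurable
  have hv : volume (Set.Icc c (c + r)) = ENNReal.ofReal r := by simp
  obtain ⟨s, hs, hle⟩ := exists_le_setLAverage (μ := volume) (s := Set.Icc c (c + r))
    (f := fun s => ∫⁻ t in J, H ⟨s, t⟩) (by rw [hv]; simpa using hr) (by rw [hv]; simp)
    (hm.lintegral_prod_right' (ν := volume.restrict J)).aemeasurable
  refine ⟨s, hs, hle.trans ?_⟩
  rw [setLAverage_eq, hv]
  gcongr
  rw [← lintegral_prod (μ := volume.restrict (Set.Icc c (c + r))) (ν := volume.restrict J)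
    (fun p : ℝ × ℝ => H ⟨p.1, p.2⟩) hm.aemeasurable, Measure.prod_restrict]
  have h1 := Complex.volume_preserving_equiv_real_prod.symm.setLIntegral_comp_preimage_emb
    Complex.measurableEquivRealProd.symm.measurableEmbedding H
    (Complex.measurableEquivRealProd ⁻¹' (Set.Icc c (c + r) ×ˢ J))
  have h2 : (Complex.measurableEquivRealProd.symm ⁻¹'
    (Complex.measurableEquivRealProd ⁻¹' (Set.Icc c (c + r) ×ˢ J))) = Set.Icc c (c + r) ×ˢ J := by
    ext p; simp
  rw [h2] at h1
  refine le_trans (le_of_eq h1) (lintegral_mono_set ?_)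
  rintro z ⟨hz1, hz2⟩
  exact hT _ hz1 _ hz2

lemma qa_line' (H : ℂ → ENNReal) (hH : Measurable H) (T : Set ℂ) (c r : ℝ) (hr : 0 < r)
    (J : Set ℝ)
    (hT : ∀ s ∈ Set.Icc c (c + r), ∀ t ∈ J, (⟨t, s⟩ : ℂ) ∈ T) :
    ∃ s ∈ Set.Icc c (c + r), ∫⁻ t in J, H ⟨t, s⟩ ≤ (∫⁻ z in T, H z) / ENNReal.ofReal r := by
  have hm : Measurable (fun p : ℝ × ℝ => H ⟨p.1, p.2⟩) :=
    hH.comp Complex.measurableEquivRealProd.symm.measurable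
  have hv : volume (Set.Icc c (c + r)) = ENNReal.ofReal r := by simp
  obtain ⟨s, hs, hle⟩ := exists_le_setLAverage (μ := volume) (s := Set.Icc c (c + r))
    (f := fun s => ∫⁻ t in J, H ⟨t, s⟩) (by rw [hv]; simpa using hr) (by rw [hv]; simp)
    (hm.lintegral_prod_left' (μ := volume.restrict J)).aemeasurable
  refine ⟨s, hs, hle.trans ?_⟩
  rw [setLAverage_eq, hv]
  gcongr
  rw [← lintegral_prod_symm (ν := volume.restrict (Set.Icc c (c + r))) (μ := volume.restrict J)
    (fun p : ℝ × ℝ => H ⟨p.1, p.2⟩) hm.aemeasurable, Measure.prod_restrict]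
  have h1 := Complex.volume_preserving_equiv_real_prod.symm.setLIntegral_comp_preimage_emb
    Complex.measurableEquivRealProd.symm.measurableEmbedding H
    (Complex.measurableEquivRealProd ⁻¹' (J ×ˢ Set.Icc c (c + r)))
  have h2 : (Complex.measurableEquivRealProd.symm ⁻¹'
    (Complex.measurableEquivRealProd ⁻¹' (J ×ˢ Set.Icc c (c + r)))) = J ×ˢ Set.Icc c (c + r) := by
    ext p; simp
  rw [h2] at h1
  refine le_trans (le_of_eq h1) (lintegral_mono_set ?_)
  rintro z ⟨hz1, hz2⟩
  exact hT _ hz2 _ hz1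

lemma qa_ftcV (F : ℂ → ℂ) (hF : ContDiff ℝ 1 F) (s : ℝ) (t1 t2 : ℝ) (h : t1 ≤ t2) (J : Set ℝ)
    (hJ : Set.Icc t1 t2 ⊆ J) :
    edist (F ⟨s, t2⟩) (F ⟨s, t1⟩) ≤ ∫⁻ t in J, ‖fderiv ℝ F ⟨s, t⟩ Complex.I‖ₑ := by
  have hl : ∀ t : ℝ, HasDerivAt (fun t : ℝ => (⟨s, t⟩ : ℂ)) Complex.I t := by
    intro t
    have h1 : HasDerivAt (fun t : ℝ => (s:ℂ) + t * Complex.I) (1 * Complex.I) t :=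
      ((Complex.ofRealCLM.hasDerivAt (x := t)).mul_const Complex.I).const_add _
    rw [one_mul] at h1
    convert h1 using 2 with t
    rw [Complex.mk_eq_add_mul_I]
  have hd : ∀ t : ℝ, HasDerivAt (fun t : ℝ => F ⟨s, t⟩) (fderiv ℝ F ⟨s, t⟩ Complex.I) t := fun t =>
    ((hF.differentiable (by simp)) _).hasFDerivAt.comp_hasDerivAt t (hl t)
  have hc : ContDiff ℝ 1 (fun t : ℝ => (⟨s, t⟩ : ℂ)) := by
    have : ContDiff ℝ 1 (fun t : ℝ => (s:ℂ) + t * Complex.I) :=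
      contDiff_const.add (Complex.ofRealCLM.contDiff.mul contDiff_const)
    convert this using 2 with t
    rw [Complex.mk_eq_add_mul_I]
  have := enorm_sub_le_lintegral_deriv_of_contDiffOn_Icc (hF.comp hc).contDiffOn h
  rw [edist_eq_enorm_sub]
  refine this.trans (le_trans (le_of_eq ?_) (lintegral_mono_set hJ))
  congr 1
  ext1 t
  exact congrArg _ (hd t).deriv

lemma qa_ftcH (F : ℂ → ℂ) (hF : ContDiff ℝ 1 F) (s : ℝ) (t1 t2 : ℝ) (h : t1 ≤ t2) (J : Set ℝ)
    (hJ : Set.Icc t1 t2 ⊆ J) :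
    edist (F ⟨t2, s⟩) (F ⟨t1, s⟩) ≤ ∫⁻ t in J, ‖fderiv ℝ F ⟨t, s⟩ 1‖ₑ := by
  have hl : ∀ t : ℝ, HasDerivAt (fun t : ℝ => (⟨t, s⟩ : ℂ)) 1 t := by
    intro t
    have h1 : HasDerivAt (fun t : ℝ => (t:ℂ) + s * Complex.I) 1 t :=
      ((Complex.ofRealCLM.hasDerivAt (x := t))).add_const _
    convert h1 using 2 with t
    rw [Complex.mk_eq_add_mul_I]
  have hd : ∀ t : ℝ, HasDerivAt (fun t : ℝ => F ⟨t, s⟩) (fderiv ℝ F ⟨t, s⟩ 1) t := fun t =>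
    ((hF.differentiable (by simp)) _).hasFDerivAt.comp_hasDerivAt t (hl t)
  have hc : ContDiff ℝ 1 (fun t : ℝ => (⟨t, s⟩ : ℂ)) := by
    have : ContDiff ℝ 1 (fun t : ℝ => (t:ℂ) + s * Complex.I) :=
      Complex.ofRealCLM.contDiff.add contDiff_const
    convert this using 2 with t
    rw [Complex.mk_eq_add_mul_I]
  have := enorm_sub_le_lintegral_deriv_of_contDiffOn_Icc (hF.comp hc).contDiffOn h
  rw [edist_eq_enorm_sub]
  refine this.trans (le_trans (le_of_eq ?_) (lintegral_mono_set hJ))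
  congr 1
  ext1 t
  exact congrArg _ (hd t).deriv

lemma qa_top (U : Set ℂ) (Φ : ℂ → ℂ) (hcont : ContinuousOn Φ U)
    (hop : ∀ O ⊆ U, IsOpen O → IsOpen (Φ '' O)) (R O : Set ℂ) (hR : IsCompact R) (hRU : R ⊆ U)
    (hO : IsOpen O) (hOR : O ⊆ R) (c : ℂ) (D : ENNReal)
    (hD : ∀ p ∈ R, p ∉ O → edist (Φ p) c ≤ D) : ∀ p ∈ R, edist (Φ p) c ≤ D := by
  intro p hp
  have hcd : ContinuousOn (fun p => dist (Φ p) c) R :=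
    continuous_dist.comp_continuousOn ((hcont.mono hRU).prodMk continuousOn_const)
  obtain ⟨q, hq, hmax⟩ := hR.exists_isMaxOn ⟨p, hp⟩ hcd
  have hpq : dist (Φ p) c ≤ dist (Φ q) c := hmax hp
  by_cases hqO : q ∈ O
  · exfalso
    have hsub : Φ '' O ⊆ Metric.closedBall c (dist (Φ q) c) := by
      rintro _ ⟨y, hy, rfl⟩
      exact hmax (hOR hy)
    have h1 : Φ '' O ⊆ interior (Metric.closedBall c (dist (Φ q) c)) :=
      interior_maximal hsub (hop O (hOR.trans hRU) hO)
    by_cases h0 : dist (Φ q) c = 0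
    · rw [h0, Metric.closedBall_zero, interior_singleton] at h1
      exact h1 ⟨q, hqO, rfl⟩
    · rw [interior_closedBall _ h0] at h1
      exact lt_irrefl _ (Metric.mem_ball.1 (h1 ⟨q, hqO, rfl⟩))
  · refine le_trans ?_ (hD q hq hqO)
    rw [edist_dist, edist_dist]
    exact ENNReal.ofReal_le_ofReal hpq

lemma qa_osc (U : Set ℂ) (Φ g h : ℂ → ℂ) (hU : IsOpen U) (hcont : ContinuousOn Φ U)
    (hop : ∀ O ⊆ U, IsOpen O → IsOpen (Φ '' O))
    (hweak : HasWeakDerivsOn U Φ g h) (x : ℂ) (r : ℝ) (hr : 0 < r)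
    (hB : Metric.closedBall x (4 * r) ⊆ U)
    (hg : AEMeasurable (fun z => ‖g z‖ₑ) (volume.restrict (Metric.closedBall x (4 * r))))
    (hh : AEMeasurable (fun z => ‖h z‖ₑ) (volume.restrict (Metric.closedBall x (4 * r)))) :
    ∀ z ∈ Metric.closedBall x r, ∀ w ∈ Metric.closedBall x r, edist (Φ z) (Φ w) ≤
      4 * ((∫⁻ z in Metric.closedBall x (4 * r), (‖g z‖ₑ + ‖h z‖ₑ)) / ENNReal.ofReal r) := by
  intro z hz w hw
  set P := (∫⁻ z in Metric.closedBall x (4 * r), (‖g z‖ₑ + ‖h z‖ₑ)) / ENNReal.ofReal r with hP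
  apply ENNReal.le_of_forall_pos_le_add
  intro ε hε _
  obtain ⟨F, hF, hFΦ, hF1, hF2⟩ := qa_moll U Φ g h hU hcont hweak x (3 * r) (4 * r) (by linarith)
    hB hg hh (ε / 2) (by positivity)
  have hm : ∀ v : ℂ, Measurable (fun z => ‖fderiv ℝ F z v‖ₑ) := fun v => by
    have : Continuous (fun z => ‖fderiv ℝ F z v‖ₑ) :=
      (((hF.continuous_fderiv (by simp)).clm_apply continuous_const)).enorm
    exact this.measurable
  have hP1 : (∫⁻ z in Metric.closedBall x (3 * r), ‖fderiv ℝ F z 1‖ₑ) / ENNReal.ofReal r ≤ P := by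
    rw [hP]
    exact ENNReal.div_le_div_right (hF1.trans (lintegral_mono fun z => le_self_add)) _
  have hP2 : (∫⁻ z in Metric.closedBall x (3 * r), ‖fderiv ℝ F z Complex.I‖ₑ) / ENNReal.ofReal r
      ≤ P := by
    rw [hP]
    exact ENNReal.div_le_div_right (hF2.trans (lintegral_mono fun z => le_add_self)) _
  have hin : ∀ s t : ℝ, |s - x.re| ≤ 2 * r → |t - x.im| ≤ 2 * r →
      (⟨s, t⟩ : ℂ) ∈ Metric.closedBall x (3 * r) := by
    intro s t hs ht
    rw [Metric.mem_closedBall, Complex.dist_eq, Complex.norm_eq_sqrt_sq_add_sq]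
    apply Real.sqrt_le_iff.2 ⟨by linarith, ?_⟩
    simp only [Complex.sub_re, Complex.sub_im]
    have h1 := sq_le_sq' (by linarith [abs_le.1 hs]) (abs_le.1 hs).2
    have h2 := sq_le_sq' (by linarith [abs_le.1 ht]) (abs_le.1 ht).2
    nlinarith
  set a := x.re with ha
  set b := x.im with hb
  obtain ⟨x1, hx1, hL1⟩ := qa_line _ (hm Complex.I) (Metric.closedBall x (3 * r)) (a - 2 * r) r hr
    (Set.Icc (b - 2 * r) (b + 2 * r)) (fun s hs t ht => hin s t
      (abs_le.2 ⟨by linarith [hs.1], by linarith [hs.2]⟩)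
      (abs_le.2 ⟨by linarith [ht.1], by linarith [ht.2]⟩))
  obtain ⟨x2, hx2, hL2⟩ := qa_line _ (hm Complex.I) (Metric.closedBall x (3 * r)) (a + r) r hr
    (Set.Icc (b - 2 * r) (b + 2 * r)) (fun s hs t ht => hin s t
      (abs_le.2 ⟨by linarith [hs.1], by linarith [hs.2]⟩)
      (abs_le.2 ⟨by linarith [ht.1], by linarith [ht.2]⟩))
  obtain ⟨y1, hy1, hL3⟩ := qa_line' _ (hm 1) (Metric.closedBall x (3 * r)) (b - 2 * r) r hr
    (Set.Icc (a - 2 * r) (a + 2 * r)) (fun s hs t ht => hin t s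
      (abs_le.2 ⟨by linarith [ht.1], by linarith [ht.2]⟩)
      (abs_le.2 ⟨by linarith [hs.1], by linarith [hs.2]⟩))
  obtain ⟨y2, hy2, hL4⟩ := qa_line' _ (hm 1) (Metric.closedBall x (3 * r)) (b + r) r hr
    (Set.Icc (a - 2 * r) (a + 2 * r)) (fun s hs t ht => hin t s
      (abs_le.2 ⟨by linarith [ht.1], by linarith [ht.2]⟩)
      (abs_le.2 ⟨by linarith [hs.1], by linarith [hs.2]⟩))
  replace hL1 := hL1.trans hP2
  replace hL2 := hL2.trans hP2
  replace hL3 := hL3.trans hP1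
  replace hL4 := hL4.trans hP1
  obtain ⟨hx1a, hx1b⟩ := hx1
  obtain ⟨hx2a, hx2b⟩ := hx2
  obtain ⟨hy1a, hy1b⟩ := hy1
  obtain ⟨hy2a, hy2b⟩ := hy2
  -- vertical and horizontal bounds
  have hV1 : ∀ t ∈ Set.Icc y1 y2, edist (F ⟨x1, t⟩) (F ⟨x1, y1⟩) ≤ P := fun t ht =>
    (qa_ftcV F hF x1 y1 t ht.1 _ (Set.Icc_subset_Icc (by linarith) (by linarith [ht.2]))).trans hL1
  have hV2 : ∀ t ∈ Set.Icc y1 y2, edist (F ⟨x2, t⟩) (F ⟨x2, y1⟩) ≤ P := fun t ht =>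
    (qa_ftcV F hF x2 y1 t ht.1 _ (Set.Icc_subset_Icc (by linarith) (by linarith [ht.2]))).trans hL2
  have hH1 : ∀ t ∈ Set.Icc x1 x2, edist (F ⟨t, y1⟩) (F ⟨x1, y1⟩) ≤ P := fun t ht =>
    (qa_ftcH F hF y1 x1 t ht.1 _ (Set.Icc_subset_Icc (by linarith) (by linarith [ht.2]))).trans hL3
  have hH2 : ∀ t ∈ Set.Icc x1 x2, edist (F ⟨t, y2⟩) (F ⟨x1, y2⟩) ≤ P := fun t ht =>
    (qa_ftcH F hF y2 x1 t ht.1 _ (Set.Icc_subset_Icc (by linarith) (by linarith [ht.2]))).trans hL4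
  have hRB : Set.Icc x1 x2 ×ℂ Set.Icc y1 y2 ⊆ Metric.closedBall x (3 * r) := by
    rintro p ⟨⟨h1, h2⟩, ⟨h3, h4⟩⟩
    exact hin p.re p.im (abs_le.2 ⟨by linarith, by linarith⟩) (abs_le.2 ⟨by linarith, by linarith⟩)
  have h34 : Metric.closedBall x (3 * r) ⊆ U :=
    (Metric.closedBall_subset_closedBall (by linarith)).trans hB
  have hkey : ∀ p ∈ Set.Icc x1 x2 ×ℂ Set.Icc y1 y2, edist (Φ p) (F ⟨x1, y1⟩) ≤
      2 * P + ENNReal.ofReal (ε / 2) := by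
    apply qa_top U Φ hcont hop _ (Set.Ioo x1 x2 ×ℂ Set.Ioo y1 y2)
      (isCompact_Icc.reProdIm isCompact_Icc) (hRB.trans h34) (isOpen_Ioo.reProdIm isOpen_Ioo)
    · rintro p ⟨h1, h2⟩
      exact ⟨Set.Ioo_subset_Icc_self h1, Set.Ioo_subset_Icc_self h2⟩
    · rintro p hp hpO
      have hdist : edist (Φ p) (F p) ≤ ENNReal.ofReal (ε / 2) := by
        rw [edist_comm, edist_dist]
        exact ENNReal.ofReal_le_ofReal (hFΦ p (hRB hp))
      have hFp : edist (F p) (F ⟨x1, y1⟩) ≤ 2 * P := by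
        obtain ⟨hpx, hpy⟩ := hp
        obtain ⟨s, t⟩ := p
        simp only [Set.mem_preimage] at hpx hpy
        have hcases : s = x1 ∨ s = x2 ∨ t = y1 ∨ t = y2 := by
          by_contra! hne
          apply hpO
          exact ⟨⟨lt_of_le_of_ne hpx.1 hne.1.symm, lt_of_le_of_ne hpx.2 hne.2.1⟩,
            ⟨lt_of_le_of_ne hpy.1 hne.2.2.1.symm, lt_of_le_of_ne hpy.2 hne.2.2.2⟩⟩
        have hP2P : P ≤ 2 * P := by rw [two_mul]; exact le_self_add
        rcases hcases with rfl | rfl | rfl | rfl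
        · exact (hV1 t hpy).trans hP2P
        · refine (edist_triangle _ (F ⟨s, y1⟩) _).trans ?_
          rw [two_mul]
          exact add_le_add (hV2 t hpy) (hH1 s hpx)
        · exact (hH1 s hpx).trans hP2P
        · refine (edist_triangle _ (F ⟨x1, t⟩) _).trans ?_
          rw [two_mul]
          exact add_le_add (hH2 s hpx) (hV1 t hpy)
      refine (edist_triangle _ (F p) _).trans ?_
      rw [add_comm]
      exact add_le_add hFp hdist
  have hBR : Metric.closedBall x r ⊆ Set.Icc x1 x2 ×ℂ Set.Icc y1 y2 := by
    intro p hp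
    rw [Metric.mem_closedBall, Complex.dist_eq] at hp
    have h1 := abs_le.1 ((Complex.abs_re_le_norm (p - x)).trans hp)
    have h2 := abs_le.1 ((Complex.abs_im_le_norm (p - x)).trans hp)
    simp only [Complex.sub_re, Complex.sub_im] at h1 h2
    exact ⟨⟨by linarith, by linarith⟩, ⟨by linarith, by linarith⟩⟩
  have h1 := hkey z (hBR hz)
  have h2 := hkey w (hBR hw)
  refine (edist_triangle_right _ _ (F ⟨x1, y1⟩)).trans ((add_le_add h1 h2).trans (le_of_eq ?_))
  have h3 : (ε : ENNReal) = ENNReal.ofReal (ε / 2) + ENNReal.ofReal (ε / 2) := by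
    rw [← ENNReal.ofReal_add (by positivity) (by positivity), add_halves, ENNReal.ofReal_coe_nnreal]
  rw [h3]
  ring

lemma qa_cs (f : ℂ → ENNReal) (μ : Measure ℂ) (hf : AEMeasurable f μ) :
    (∫⁻ z, f z ∂μ) ^ 2 ≤ μ Set.univ * ∫⁻ z, f z ^ 2 ∂μ := by
  have h1 := ENNReal.lintegral_mul_le_Lp_mul_Lq μ (p := 2) (q := 2)
    (Real.holderConjugate_iff.2 ⟨by norm_num, by norm_num⟩) hf (aemeasurable_const (b := 1))
  simp only [Pi.mul_apply, mul_one, ENNReal.one_rpow, lintegral_const, one_mul] at h1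
  have h2 : (∫⁻ z, f z ∂μ) ^ 2 ≤ _ := pow_le_pow_left' h1 2
  refine h2.trans (le_of_eq ?_)
  rw [mul_pow, ← ENNReal.rpow_natCast, ← ENNReal.rpow_natCast, ← ENNReal.rpow_mul,
    ← ENNReal.rpow_mul]
  norm_num
  rw [mul_comm]

lemma qa_key (U : Set ℂ) (Φ g h : ℂ → ℂ) (hU : IsOpen U) (hcont : ContinuousOn Φ U)
    (hop : ∀ O ⊆ U, IsOpen O → IsOpen (Φ '' O))
    (hweak : HasWeakDerivsOn U Φ g h) (x : ℂ) (r : ℝ) (hr : 0 < r)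
    (hB : Metric.closedBall x (4 * r) ⊆ U)
    (hg : AEMeasurable (fun z => ‖g z‖ₑ) (volume.restrict (Metric.closedBall x (4 * r))))
    (hh : AEMeasurable (fun z => ‖h z‖ₑ) (volume.restrict (Metric.closedBall x (4 * r)))) :
    volume (Φ '' Metric.closedBall x r) ≤
      (256 * NNReal.pi ^ 2 : NNReal) *
        ∫⁻ z in Metric.closedBall x (4 * r), (‖g z‖ₑ + ‖h z‖ₑ) ^ 2 := by
  have hosc := qa_osc U Φ g h hU hcont hop hweak x r hr hB hg hh
  have hcs := qa_cs _ _ (hg.add hh)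
  set M := ∫⁻ z in Metric.closedBall x (4 * r), (‖g z‖ₑ + ‖h z‖ₑ) with hM
  simp only [Pi.add_apply] at hcs
  rw [← hM, Measure.restrict_apply_univ, Complex.volume_closedBall] at hcs
  set W := ∫⁻ z in Metric.closedBall x (4 * r), (‖g z‖ₑ + ‖h z‖ₑ) ^ 2 with hW
  have hr0 : ENNReal.ofReal r ≠ 0 := by simpa using hr
  have hrt : ENNReal.ofReal r ≠ ⊤ := ENNReal.ofReal_ne_top
  set D := 4 * (M / ENNReal.ofReal r) with hD
  by_cases hWt : W = ⊤
  · rw [hWt, ENNReal.mul_top]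
    · exact le_top
    · have : NNReal.pi ≠ 0 := NNReal.pi_ne_zero
      simpa using this
  have hMt : M ≠ ⊤ := by
    intro hMt
    rw [hMt] at hcs
    simp only [ne_eq, OfNat.ofNat_ne_zero, not_false_eq_true, ENNReal.top_pow, top_le_iff] at hcs
    exact ENNReal.mul_ne_top (ENNReal.mul_ne_top (ENNReal.pow_ne_top ENNReal.ofReal_ne_top)
      ENNReal.coe_ne_top) hWt hcs
  have hDt : D ≠ ⊤ := ENNReal.mul_ne_top (by simp) (ENNReal.div_ne_top hMt hr0)
  have hsub : Φ '' Metric.closedBall x r ⊆ Metric.closedBall (Φ x) D.toReal := by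
    rintro _ ⟨z, hz, rfl⟩
    rw [Metric.mem_closedBall, dist_edist]
    exact ENNReal.toReal_mono hDt (hosc z hz x (Metric.mem_closedBall_self hr.le))
  refine (measure_mono hsub).trans ?_
  rw [Complex.volume_closedBall, ENNReal.ofReal_toReal hDt]
  have h4 : ENNReal.ofReal (4 * r) = 4 * ENNReal.ofReal r := by
    rw [ENNReal.ofReal_mul (by norm_num)]; norm_num
  rw [h4] at hcs
  have hD2 : D ^ 2 ≤ 256 * NNReal.pi * W := by
    rw [hD, mul_pow, ENNReal.div_eq_inv_mul, mul_pow]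
    calc (4:ENNReal) ^ 2 * ((ENNReal.ofReal r)⁻¹ ^ 2 * M ^ 2)
        ≤ 4 ^ 2 * ((ENNReal.ofReal r)⁻¹ ^ 2 * ((4 * ENNReal.ofReal r) ^ 2 * NNReal.pi * W)) := by
          gcongr
      _ = 256 * NNReal.pi * W * ((ENNReal.ofReal r)⁻¹ * ENNReal.ofReal r) ^ 2 := by ring
      _ = 256 * NNReal.pi * W := by rw [ENNReal.inv_mul_cancel hr0 hrt]; ring
  calc D ^ 2 * NNReal.pi ≤ 256 * NNReal.pi * W * NNReal.pi := by gcongr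
    _ = _ := by push_cast; ring

lemma qa_fub (μ : Measure ℂ) [IsFiniteMeasure μ] (R : ℝ) :
    ∫⁻ x, μ (Metric.closedBall x R) = ENNReal.ofReal R ^ 2 * NNReal.pi * μ Set.univ := by
  have hcl : MeasurableSet {p : ℂ × ℂ | dist p.1 p.2 ≤ R} :=
    (isClosed_le continuous_dist continuous_const).measurableSet
  have h1 : ∀ x, μ (Metric.closedBall x R) =
      ∫⁻ y, ({p : ℂ × ℂ | dist p.1 p.2 ≤ R}.indicator 1 (x, y)) ∂μ := by
    intro x
    rw [← lintegral_indicator_one measurableSet_closedBall]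
    congr 1
    ext1 y
    simp only [Set.indicator, Metric.mem_closedBall, Set.mem_ofPred_eq, dist_comm, Pi.one_apply]
  have h2 : ∀ y : ℂ, ∫⁻ x, ({p : ℂ × ℂ | dist p.1 p.2 ≤ R}.indicator (1 : ℂ × ℂ → ENNReal) (x, y))
      = ENNReal.ofReal R ^ 2 * NNReal.pi := by
    intro y
    rw [← Complex.volume_closedBall y R, ← lintegral_indicator_one measurableSet_closedBall]
    congr 1
  simp_rw [h1]
  rw [lintegral_lintegral_swap]
  · simp_rw [h2]
    rw [lintegral_const]
  · exact (measurable_one.indicator hcl).aemeasurable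

lemma qa_enorm_meas (U K : Set ℂ) (g : ℂ → ℂ) (hg : LocallyL2On U g) (hK : IsCompact K)
    (hKU : K ⊆ U) : AEMeasurable (fun z => ‖g z‖ₑ) (volume.restrict K) := by
  have h1 := (hg K hKU hK).aestronglyMeasurable.aemeasurable
  have h2 := (Real.continuous_sqrt.measurable.comp_aemeasurable h1).ennreal_ofReal
  refine h2.congr (Filter.Eventually.of_forall fun z => ?_)
  simp [Real.sqrt_sq]

lemma qa_compact (U V : Set ℂ) (hU : IsOpen U) (hV : IsOpen V) (Φ Ψ g h : ℂ → ℂ)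
    (hcont : ContinuousOn Φ U) (hinv : ContinuousOn Ψ V)
    (hmaps : ∀ z ∈ U, Φ z ∈ V) (hΨΦ : ∀ z ∈ U, Ψ (Φ z) = z)
    (hop : ∀ O ⊆ U, IsOpen O → IsOpen (Φ '' O))
    (hweak : HasWeakDerivsOn U Φ g h)
    (S : Set ℂ) (hS : IsCompact S) (hSU : S ⊆ U) (hS0 : volume S = 0) : volume (Φ '' S) = 0 := by
  obtain ⟨δ, hδ, hδU⟩ := hS.exists_cthickening_subset_open hU hSU
  set K := Metric.cthickening δ S with hKdef
  have hK : IsCompact K := hS.cthickening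
  have hgm := qa_enorm_meas U K g hweak.1 hK hδU
  have hhm := qa_enorm_meas U K h hweak.2.1 hK hδU
  let ν : Measure ℂ := (volume.restrict K).withDensity (fun z => (‖g z‖ₑ + ‖h z‖ₑ) ^ 2)
  have hfin : ∀ u : ℂ → ℂ, LocallyL2On U u → ∫⁻ z in K, ‖u z‖ₑ ^ 2 < ⊤ := by
    intro u hu
    have := (hu K hδU hK).2
    rw [hasFiniteIntegral_iff_enorm] at this
    simpa using this
  have hνfin : IsFiniteMeasure ν := by
    apply isFiniteMeasure_withDensity
    refine ne_of_lt (lt_of_le_of_lt (b := ∫⁻ z in K, (2 * ‖g z‖ₑ ^ 2 + 2 * ‖h z‖ₑ ^ 2)) ?_ ?_)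
    · refine lintegral_mono fun z => ?_
      have : ‖g z‖₊ ^ 2 + ‖h z‖₊ ^ 2 ≥ 2 * ‖g z‖₊ * ‖h z‖₊ := two_mul_le_add_sq _ _
      have h2 : (‖g z‖₊ + ‖h z‖₊) ^ 2 ≤ 2 * ‖g z‖₊ ^ 2 + 2 * ‖h z‖₊ ^ 2 := add_sq_le.trans (by rw [mul_add])
      simp only [enorm_eq_nnnorm]
      exact_mod_cast h2
    · rw [lintegral_add_left' ((hgm.pow_const 2).const_mul 2),
        lintegral_const_mul'' _ (hgm.pow_const 2), lintegral_const_mul'' _ (hhm.pow_const 2)]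
      exact ENNReal.add_lt_top.2 ⟨ENNReal.mul_lt_top (by simp) (hfin g hweak.1),
        ENNReal.mul_lt_top (by simp) (hfin h hweak.2.1)⟩
  have hν0 : ν S = 0 := by
    have h1 : volume.restrict K S = 0 := Measure.absolutelyContinuous_of_le Measure.restrict_le_self hS0
    exact withDensity_absolutelyContinuous _ _ h1
  set T := Φ '' S with hT
  have hTc : IsCompact T := hS.image_of_continuousOn (hcont.mono hSU)
  have hTV : T ⊆ V := by rintro _ ⟨z, hz, rfl⟩; exact hmaps z (hSU hz)
  have hΨm : AEMeasurable Ψ (volume.restrict T) := (hinv.mono hTV).aemeasurable hTc.measurableSet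
  have hTfin : IsFiniteMeasure (volume.restrict T) :=
    ⟨by rw [Measure.restrict_apply_univ]; exact hTc.measure_lt_top⟩
  let μ : Measure ℂ := (volume.restrict T).map Ψ
  have hμfin : IsFiniteMeasure μ := Measure.isFiniteMeasure_map _ _
  have hμu : μ Set.univ = volume T := by
    rw [Measure.map_apply_of_aemeasurable hΨm MeasurableSet.univ]; simp
  set C : NNReal := 256 * NNReal.pi ^ 2 with hC
  have hmain : ∀ d, 0 < d → 5 * d ≤ δ → volume T ≤ 16 * C * ν (Metric.cthickening (5 * d) S) := by
    intro d hd hd5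
    set E := Metric.cthickening (5 * d) S with hE
    have hEm : MeasurableSet E := Metric.isClosed_cthickening.measurableSet
    have hEK : E ⊆ K := Metric.cthickening_mono hd5 S
    have hpt : ∀ x, μ (Metric.closedBall x d) ≤ C * (ν.restrict E) (Metric.closedBall x (4 * d)) := by
      intro x
      rw [Measure.map_apply_of_aemeasurable hΨm measurableSet_closedBall]
      have hsub : Ψ ⁻¹' Metric.closedBall x d ∩ T ⊆ Φ '' (S ∩ Metric.closedBall x d) := by
        rintro _ ⟨hy, ⟨z, hz, rfl⟩⟩
        refine ⟨z, ⟨hz, ?_⟩, rfl⟩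
        rwa [Set.mem_preimage, hΨΦ z (hSU hz)] at hy
      have hle : volume.restrict T (Ψ ⁻¹' Metric.closedBall x d) ≤
          volume (Φ '' (S ∩ Metric.closedBall x d)) := by
        rw [Measure.restrict_apply' hTc.measurableSet]
        exact measure_mono hsub
      refine hle.trans ?_
      by_cases hne : (S ∩ Metric.closedBall x d).Nonempty
      · obtain ⟨s, hs, hsx⟩ := hne
        have hBE : Metric.closedBall x (4 * d) ⊆ E := by
          intro y hy
          apply Metric.mem_cthickening_of_dist_le y s _ _ hs
          rw [Metric.mem_closedBall] at hy hsx
          have := dist_triangle_right y s x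
          linarith
        have hBK := hBE.trans hEK
        refine (measure_mono (Set.image_mono Set.inter_subset_right)).trans ?_
        refine (qa_key U Φ g h hU hcont hop hweak x d hd (hBK.trans hδU)
          (hgm.mono_measure (Measure.restrict_mono hBK le_rfl))
          (hhm.mono_measure (Measure.restrict_mono hBK le_rfl))).trans (le_of_eq ?_)
        rw [Measure.restrict_apply measurableSet_closedBall, Set.inter_eq_left.2 hBE,
          withDensity_apply _ measurableSet_closedBall, Measure.restrict_restrict
          measurableSet_closedBall, Set.inter_eq_left.2 hBK]
      · rw [Set.not_nonempty_iff_eq_empty.1 hne]; simp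
    have hint : ∫⁻ x, μ (Metric.closedBall x d) ≤
        ∫⁻ x, C * (ν.restrict E) (Metric.closedBall x (4 * d)) := lintegral_mono hpt
    rw [lintegral_const_mul' _ _ (by simp), qa_fub, qa_fub, hμu, Measure.restrict_apply_univ] at hint
    have h4 : ENNReal.ofReal (4 * d) = 4 * ENNReal.ofReal d := by
      rw [ENNReal.ofReal_mul (by norm_num)]; norm_num
    rw [h4] at hint
    have hc0 : ENNReal.ofReal d ^ 2 * NNReal.pi ≠ 0 := by
      have : NNReal.pi ≠ 0 := NNReal.pi_ne_zero
      simp [this, hd]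
    have hct : ENNReal.ofReal d ^ 2 * NNReal.pi ≠ ⊤ := ENNReal.mul_ne_top (by simp) (by simp)
    rw [← ENNReal.mul_le_mul_iff_right hc0 hct]
    refine hint.trans (le_of_eq ?_)
    ring
  have hlim : Filter.Tendsto (fun d : ℝ => 16 * C * ν (Metric.cthickening (5 * d) S))
      (nhdsWithin 0 (Set.Ioi 0)) (nhds 0) := by
    have h1 : Filter.Tendsto (fun d : ℝ => ν (Metric.cthickening d S)) (nhds 0) (nhds 0) := by
      have := tendsto_measure_cthickening_of_isCompact (μ := ν) hS
      rwa [hν0] at this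
    have h2 : Filter.Tendsto (fun d : ℝ => 5 * d) (nhdsWithin 0 (Set.Ioi 0)) (nhds 0) := by
      have : Filter.Tendsto (fun d : ℝ => 5 * d) (nhds 0) (nhds (5 * 0)) :=
        (continuous_const.mul continuous_id).tendsto 0
      rw [mul_zero] at this
      exact this.mono_left nhdsWithin_le_nhds
    have h3 := ENNReal.Tendsto.const_mul (a := 16 * (C : ENNReal)) (h1.comp h2)
      (Or.inr (ENNReal.mul_ne_top (by simp) (by simp)))
    rw [mul_zero] at h3
    exact h3
  have hev : ∀ᶠ d in nhdsWithin (0:ℝ) (Set.Ioi 0),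
      volume T ≤ 16 * C * ν (Metric.cthickening (5 * d) S) := by
    filter_upwards [Ioo_mem_nhdsGT (show (0:ℝ) < δ / 5 by positivity)] with d hd
    exact hmain d hd.1 (by linarith [hd.2])
  exact le_antisymm (ge_of_tendsto hlim hev) bot_le

/-- **Quasiconformal homeomorphisms map null sets to null sets.** If `Φ` is a
homeomorphism of a domain `U` onto a domain `V` with locally `L²` distributional
derivatives satisfying `|∂Φ/∂z̄| ≤ k |∂Φ/∂z|` a.e. on `U` for some `0 ≤ k < 1`,
then the `Φ`-image of every Lebesgue-null subset of `U` is Lebesgue-null. -/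
theorem qc_maps_null_to_null
    (U V : Set ℂ) (hU : IsOpen U) (hUconn : IsConnected U)
    (hV : IsOpen V) (hVconn : IsConnected V)
    (Φ g h : ℂ → ℂ)
    (hbij : Set.BijOn Φ U V) (hcont : ContinuousOn Φ U)
    (hinvcont : ContinuousOn (Function.invFunOn Φ U) V)
    (hweak : HasWeakDerivsOn U Φ g h)
    (k : ℝ) (hk0 : 0 ≤ k) (hk1 : k < 1)
    (hqc : ∀ᵐ z ∂(volume.restrict U),
      ‖(g z + Complex.I * h z) / 2‖ ≤ k * ‖(g z - Complex.I * h z) / 2‖) :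
    ∀ S : Set ℂ, S ⊆ U → volume S = 0 → volume (Φ '' S) = 0 := by
  intro S hSU hS0
  have hinj := hbij.injOn
  have hΨΦ : ∀ z ∈ U, Function.invFunOn Φ U (Φ z) = z := fun z hz => hinj.leftInvOn_invFunOn hz
  have hop : ∀ O ⊆ U, IsOpen O → IsOpen (Φ '' O) := by
    intro O hOU hO
    have h1 : Φ '' O = V ∩ Function.invFunOn Φ U ⁻¹' O := by
      ext w
      constructor
      · rintro ⟨z, hz, rfl⟩
        refine ⟨hbij.mapsTo (hOU hz), ?_⟩
        rw [Set.mem_preimage, hΨΦ z (hOU hz)]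
        exact hz
      · rintro ⟨hw, hwO⟩
        obtain ⟨z, hz, rfl⟩ := hbij.surjOn hw
        rw [Set.mem_preimage, hΨΦ z hz] at hwO
        exact ⟨z, hwO, rfl⟩
    rw [h1]
    exact hinvcont.isOpen_inter_preimage hV hO
  set S' := toMeasurable volume S ∩ U with hS'
  have hS'm : MeasurableSet S' := (measurableSet_toMeasurable _ _).inter hU.measurableSet
  have hS'0 : volume S' = 0 :=
    measure_mono_null Set.inter_subset_left (by rw [measure_toMeasurable]; exact hS0)
  have hS'U : S' ⊆ U := Set.inter_subset_right
  have hSS' : S ⊆ S' := Set.subset_inter (subset_toMeasurable _ _) hSU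
  refine measure_mono_null (Set.image_mono hSS') ?_
  have hTm : MeasurableSet (Φ '' S') :=
    hS'm.image_of_continuousOn_injOn (hcont.mono hS'U) (hinj.mono hS'U)
  rw [hTm.measure_eq_iSup_isCompact]
  simp only [ENNReal.iSup_eq_zero]
  intro L hL hLc
  have hLV : L ⊆ V := hL.trans (by rintro _ ⟨z, hz, rfl⟩; exact hbij.mapsTo (hS'U hz))
  have hPc : IsCompact (Function.invFunOn Φ U '' L) := hLc.image_of_continuousOn (hinvcont.mono hLV)
  have hPS : Function.invFunOn Φ U '' L ⊆ S' := by
    rintro _ ⟨w, hw, rfl⟩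
    obtain ⟨z, hz, rfl⟩ := hL hw
    rw [hΨΦ z (hS'U hz)]
    exact hz
  have hLe : L ⊆ Φ '' (Function.invFunOn Φ U '' L) := by
    intro w hw
    refine ⟨_, ⟨w, hw, rfl⟩, ?_⟩
    obtain ⟨z, hz, rfl⟩ := hL hw
    rw [hΨΦ z (hS'U hz)]
  refine measure_mono_null hLe ?_
  exact qa_compact U V hU hV Φ (Function.invFunOn Φ U) g h hcont hinvcont
    (fun z hz => hbij.mapsTo hz) hΨΦ hop hweak _ hPc (hPS.trans hS'U)
    (measure_mono_null hPS hS'0)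
end
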